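/- For every n ≥ 1 and m ≥ 0, the mod 2 group homology of the braid group satisfies dim_{𝔽_2} H_m(B_n; 𝔽_2) = #{ finitely supported sequences (h_0, h_1, h_2, …) of nonnegative integers such that Σ_{i ≥ 0} h_i·2^i = n and Σ_{i ≥ 0} h_i·(2^i − 1) = m }; equivalently, ⊕_n H_*(B_n; 𝔽_2) has an additive basis given by the monomials x_{i_1}^{h_1}⋯x_{i_l}^{h_l} of the polynomial ring 𝔽_2[x_0, x_1, x_2, …], where x_i has homological dimension 2^i − 1 and degree 2^i, the monomial of degree n = Σ_j h_j 2^{i_j} and dimension m = Σ_j h_j(2^{i_j}−1) lying in H_m(B_n; 𝔽_2). -/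

import Mathlib

/-!
STATEMENT 18 (Fuks): For every n ≥ 1 and m ≥ 0,
dim_{𝔽₂} H_m(B_n; 𝔽₂) = #{ finitely supported sequences (h_0, h_1, …) of nonnegative
integers with Σ h_i·2^i = n and Σ h_i·(2^i − 1) = m }.
Group homology with trivial 𝔽₂-coefficients is defined via the standard (bar)
inhomogeneous chain complex C_m = (G^m →₀ 𝔽₂), whose differential (mod 2) is
d(g_1,…,g_{m+1}) = (g_2,…,g_{m+1}) + Σ_{i=1}^{m} (g_1,…,g_i g_{i+1},…,g_{m+1})
                   + (g_1,…,g_m).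
The dimension statement is expressed by a linear isomorphism with the 𝔽₂-vector space
freely spanned by the indexing set.
-/

/-- The alternating word `s t s t ⋯` with `m` factors, as an element of the free group. -/
def braidWord {B : Type*} (s t : B) (m : ℕ) : FreeGroup B :=
  ((List.range m).map (fun i => if i % 2 = 0 then FreeGroup.of s else FreeGroup.of t)).prod

/-- The Artin relations associated to a Coxeter matrix `M`. -/
def artinRels {B : Type*} (M : CoxeterMatrix B) : Set (FreeGroup B) :=
  {r | ∃ s t : B, s ≠ t ∧ M s t ≠ 0 ∧ r = braidWord s t (M s t) * (braidWord t s (M s t))⁻¹}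

/-- The Artin group associated to a Coxeter matrix `M`. -/
def ArtinGroup {B : Type*} (M : CoxeterMatrix B) : Type _ := PresentedGroup (artinRels M)

instance {B : Type*} (M : CoxeterMatrix B) : Group (ArtinGroup M) :=
  QuotientGroup.Quotient.group _

/-- The braid group on `n` strands: the Artin group of type A_{n−1}. -/
def BraidGroup (n : ℕ) : Type := ArtinGroup (CoxeterMatrix.Aₙ (n - 1))

instance (n : ℕ) : Group (BraidGroup n) :=
  inferInstanceAs (Group (ArtinGroup (CoxeterMatrix.Aₙ (n - 1))))

/-- The differential of the inhomogeneous (bar) chain complex of a group `G` with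
trivial coefficients in `𝔽₂ = ZMod 2` (signs are irrelevant mod 2). -/
noncomputable def barD (G : Type) [Group G] (m : ℕ) :
    ((Fin (m + 1) → G) →₀ ZMod 2) →ₗ[ZMod 2] ((Fin m → G) →₀ ZMod 2) :=
  Finsupp.lift _ (ZMod 2) _ (fun g =>
    Finsupp.single (fun k => g k.succ) 1
    + ∑ j : Fin m, Finsupp.single (Fin.contractNth j.castSucc (· * ·) g) 1
    + Finsupp.single (fun k => g k.castSucc) 1)

/-- The `m`-cycles of the bar complex. -/
noncomputable def barCycles (G : Type) [Group G] : (m : ℕ) → Submodule (ZMod 2) ((Fin m → G) →₀ ZMod 2)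
  | 0 => ⊤
  | (m + 1) => LinearMap.ker (barD G m)

/-- The `m`-boundaries of the bar complex, as a submodule of the `m`-cycles. -/
noncomputable def barBoundaries (G : Type) [Group G] (m : ℕ) :
    Submodule (ZMod 2) ↥(barCycles G m) :=
  Submodule.comap (barCycles G m).subtype (LinearMap.range (barD G m))

/-- Group homology `H_m(G; 𝔽₂)` with trivial coefficients, as cycles modulo boundaries
in the bar complex. -/
noncomputable abbrev barHomology (G : Type) [Group G] (m : ℕ) : Type :=
  ↥(barCycles G m) ⧸ barBoundaries G m

/-- Two braid generators with distant indices. -/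
def BraidFar (s t : ℕ) : Prop := s + 2 ≤ t ∨ t + 2 ≤ s

/-- Two braid generators with neighbouring indices. -/
def BraidAdj (s t : ℕ) : Prop := s + 1 = t ∨ t + 1 = s

lemma BraidFar.symm {s t : ℕ} (h : BraidFar s t) : BraidFar t s := Or.symm h

lemma BraidAdj.symm {s t : ℕ} (h : BraidAdj s t) : BraidAdj t s := Or.symm h

/-- Equality of positive braid words, in a form that encodes Garside's cancellation property:
equal words starting with `s` and `t` are both multiples of the least common multiple of
`s` and `t`. -/
inductive BraidRel : List ℕ → List ℕ → Prop
  | nil : BraidRel [] []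
  | cons (s : ℕ) {X Y : List ℕ} (h : BraidRel X Y) : BraidRel (s :: X) (s :: Y)
  | far {s t : ℕ} {X Y : List ℕ} (Z : List ℕ) (hst : BraidFar s t)
      (hX : BraidRel X (t :: Z)) (hY : BraidRel Y (s :: Z)) : BraidRel (s :: X) (t :: Y)
  | adj {s t : ℕ} {X Y : List ℕ} (Z : List ℕ) (hst : BraidAdj s t)
      (hX : BraidRel X (t :: s :: Z)) (hY : BraidRel Y (s :: t :: Z)) :
      BraidRel (s :: X) (t :: Y)

namespace BraidRel

lemma refl : ∀ X : List ℕ, BraidRel X X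
  | [] => nil
  | s :: X => cons s (refl X)

lemma symm {X Y : List ℕ} (h : BraidRel X Y) : BraidRel Y X := by
  induction h with
  | nil => exact nil
  | cons s _ ih => exact cons s ih
  | far Z hst hX hY _ _ => exact far Z hst.symm hY hX
  | adj Z hst hX hY _ _ => exact adj Z hst.symm hY hX

lemma length_eq {X Y : List ℕ} (h : BraidRel X Y) : X.length = Y.length := by
  induction h with
  | nil => rfl
  | cons s _ ih => simpa using ih
  | far Z hst hX hY ih₁ ih₂ => simp only [List.length_cons] at *; omega
  | adj Z hst hX hY ih₁ ih₂ => simp only [List.length_cons] at *; omega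

lemma swap {s t : ℕ} (h : BraidFar s t) (Z : List ℕ) : BraidRel (s :: t :: Z) (t :: s :: Z) :=
  far Z h (refl _) (refl _)

lemma braid {s t : ℕ} (h : BraidAdj s t) (Z : List ℕ) :
    BraidRel (s :: t :: s :: Z) (t :: s :: t :: Z) :=
  adj Z h (refl _) (refl _)

lemma cons_cons_iff {s t : ℕ} {X Y : List ℕ} (h : BraidRel (s :: X) (t :: Y)) :
    (s = t ∧ BraidRel X Y) ∨
    (BraidFar s t ∧ ∃ Z, BraidRel X (t :: Z) ∧ BraidRel Y (s :: Z)) ∨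
    (BraidAdj s t ∧ ∃ Z, BraidRel X (t :: s :: Z) ∧ BraidRel Y (s :: t :: Z)) := by
  cases h with
  | cons _ h => exact Or.inl ⟨rfl, h⟩
  | far Z hst hX hY => exact Or.inr (Or.inl ⟨hst, Z, hX, hY⟩)
  | adj Z hst hX hY => exact Or.inr (Or.inr ⟨hst, Z, hX, hY⟩)

lemma of_eq_head {s : ℕ} {X Y : List ℕ} (h : BraidRel (s :: X) (s :: Y)) : BraidRel X Y := by
  rcases cons_cons_iff h with ⟨_, h⟩ | ⟨hs, _⟩ | ⟨hs, _⟩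
  · exact h
  · unfold BraidFar at hs; omega
  · unfold BraidAdj at hs; omega

lemma of_far {s t : ℕ} {X Y : List ℕ} (hst : BraidFar s t) (h : BraidRel (s :: X) (t :: Y)) :
    ∃ Z, BraidRel X (t :: Z) ∧ BraidRel Y (s :: Z) := by
  rcases cons_cons_iff h with ⟨hs, _⟩ | ⟨_, h⟩ | ⟨hs, _⟩
  · unfold BraidFar at hst; omega
  · exact h
  · unfold BraidFar at hst; unfold BraidAdj at hs; omega

lemma of_adj {s t : ℕ} {X Y : List ℕ} (hst : BraidAdj s t) (h : BraidRel (s :: X) (t :: Y)) :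
    ∃ Z, BraidRel X (t :: s :: Z) ∧ BraidRel Y (s :: t :: Z) := by
  rcases cons_cons_iff h with ⟨hs, _⟩ | ⟨hs, _⟩ | ⟨_, h⟩
  · unfold BraidAdj at hst; omega
  · unfold BraidAdj at hst; unfold BraidFar at hs; omega
  · exact h

/-- Transitivity when both relations are between words of length at most `L`. -/
def TransUpTo (L : ℕ) : Prop :=
  ∀ X Y Z : List ℕ, X.length ≤ L → BraidRel X Y → BraidRel Y Z → BraidRel X Z

lemma TransUpTo.far_far {L : ℕ} (tr : TransUpTo L) {s r t : ℕ} {X U Y Z Z' : List ℕ}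
    (hL : X.length ≤ L) (hsr : BraidFar s r) (hrt : BraidFar r t)
    (hX : BraidRel X (r :: Z)) (hU : BraidRel U (s :: Z))
    (hU' : BraidRel U (t :: Z')) (hY : BraidRel Y (r :: Z')) : BraidRel (s :: X) (t :: Y) := by
  have lX := hX.length_eq
  have lU := hU.length_eq
  have lU' := hU'.length_eq
  have lY := hY.length_eq
  simp only [List.length_cons] at lX lU lU' lY
  have h := tr _ _ _ (by simp; omega) hU.symm hU'
  rcases cons_cons_iff h with ⟨rfl, hZZ⟩ | ⟨hst, W, hZ, hZ'⟩ | ⟨hst, W, hZ, hZ'⟩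
  · exact cons _ (tr _ _ _ hL (tr _ _ _ hL hX (cons r hZZ)) hY.symm)
  · refine far (r :: W) hst ?_ ?_
    · exact tr _ _ _ hL (tr _ _ _ hL hX (cons r hZ)) (swap hrt _)
    · exact tr _ _ _ (by omega) (tr _ _ _ (by omega) hY (cons r hZ')) (swap hsr.symm _)
  · refine adj (r :: W) hst ?_ ?_
    · exact tr _ _ _ hL (tr _ _ _ hL (tr _ _ _ hL hX (cons r hZ)) (swap hrt _))
        (cons t (swap hsr.symm _))
    · exact tr _ _ _ (by omega) (tr _ _ _ (by omega) (tr _ _ _ (by omega) hY (cons r hZ'))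
        (swap hsr.symm _)) (cons s (swap hrt _))

lemma TransUpTo.far_adj {L : ℕ} (tr : TransUpTo L) {s r t : ℕ} {X U Y Z Z' : List ℕ}
    (hL : X.length ≤ L) (hsr : BraidFar s r) (hrt : BraidAdj r t)
    (hX : BraidRel X (r :: Z)) (hU : BraidRel U (s :: Z))
    (hU' : BraidRel U (t :: r :: Z')) (hY : BraidRel Y (r :: t :: Z')) :
    BraidRel (s :: X) (t :: Y) := by
  have lX := hX.length_eq
  have lU := hU.length_eq
  have lU' := hU'.length_eq
  have lY := hY.length_eq
  simp only [List.length_cons] at lX lU lU' lY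
  have h := tr _ _ _ (by simp; omega) hU.symm hU'
  rcases cons_cons_iff h with ⟨rfl, hZZ⟩ | ⟨hst, W, hZ, hZ'⟩ | ⟨hst, W, hZ, hZ'⟩
  · unfold BraidFar at hsr; unfold BraidAdj at hrt; omega
  · obtain ⟨W', hZ', hW⟩ := of_far hsr.symm hZ'
    have lZ := hZ.length_eq
    have lZ' := hZ'.length_eq
    have lW := hW.length_eq
    simp only [List.length_cons] at lZ lZ' lW
    refine far (r :: t :: W') hst ?_ ?_
    · refine tr _ _ _ hL hX (tr _ _ _ (by simp; omega) (cons r hZ) ?_)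
      exact tr _ _ _ (by simp; omega) (cons r (cons t hW)) (braid hrt _)
    · refine tr _ _ _ (by omega) hY (tr _ _ _ (by simp; omega) (cons r (cons t hZ')) ?_)
      exact tr _ _ _ (by simp; omega) (cons r (swap hst.symm _)) (swap hsr.symm _)
  · obtain ⟨W', hZ', hW⟩ := of_far hsr.symm hZ'
    obtain ⟨V, hWV, hW'⟩ := of_adj hrt.symm hW
    have lZ := hZ.length_eq
    have lZ' := hZ'.length_eq
    have lW := hW.length_eq
    have lV := hWV.length_eq
    have lV' := hW'.length_eq
    simp only [List.length_cons] at lZ lZ' lW lV lV'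
    refine adj (r :: t :: s :: V) hst ?_ ?_
    · refine tr _ _ _ hL hX (tr _ _ _ (by simp; omega) (cons r hZ) ?_)
      refine tr _ _ _ (by simp; omega) (cons r (cons t (cons s hWV))) ?_
      refine tr _ _ _ (by simp; omega) (cons r (cons t (swap hsr _))) ?_
      refine tr _ _ _ (by simp; omega) (braid hrt _) ?_
      refine tr _ _ _ (by simp; omega) (cons t (cons r (braid hst.symm _))) ?_
      exact cons t (swap hsr.symm _)
    · refine tr _ _ _ (by omega) hY (tr _ _ _ (by simp; omega) (cons r (cons t hZ')) ?_)
      refine tr _ _ _ (by simp; omega) (cons r (cons t (cons s hW'))) ?_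
      refine tr _ _ _ (by simp; omega) (cons r (braid hst.symm _)) ?_
      refine tr _ _ _ (by simp; omega) (swap hsr.symm _) ?_
      refine tr _ _ _ (by simp; omega) (cons s (cons r (cons t (swap hsr _)))) ?_
      exact cons s (braid hrt _)

lemma TransUpTo.adj_adj {L : ℕ} (tr : TransUpTo L) {s r t : ℕ} {X U Y Z Z' : List ℕ}
    (hL : X.length ≤ L) (hsr : BraidAdj s r) (hrt : BraidAdj r t)
    (hX : BraidRel X (r :: s :: Z)) (hU : BraidRel U (s :: r :: Z))
    (hU' : BraidRel U (t :: r :: Z')) (hY : BraidRel Y (r :: t :: Z')) :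
    BraidRel (s :: X) (t :: Y) := by
  have lX := hX.length_eq
  have lU := hU.length_eq
  have lU' := hU'.length_eq
  have lY := hY.length_eq
  simp only [List.length_cons] at lX lU lU' lY
  have h := tr _ _ _ (by simp; omega) hU.symm hU'
  rcases cons_cons_iff h with ⟨rfl, hZZ⟩ | ⟨hst, W, hZ, hZ'⟩ | ⟨hst, W, hZ, hZ'⟩
  · exact cons _ (tr _ _ _ hL (tr _ _ _ hL hX (cons r (cons s (of_eq_head hZZ)))) hY.symm)
  · obtain ⟨A, hA, hWA⟩ := of_adj hrt hZ
    obtain ⟨B, hB, hWB⟩ := of_adj hsr.symm hZ'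
    have lA := hA.length_eq
    have lWA := hWA.length_eq
    have lB := hB.length_eq
    have lWB := hWB.length_eq
    simp only [List.length_cons] at lA lWA lB lWB
    have hAB : BraidRel (t :: A) (s :: B) :=
      of_eq_head (tr _ _ _ (by simp; omega) hWA.symm hWB)
    obtain ⟨E, hAE, hBE⟩ := of_far hst.symm hAB
    have lE := hAE.length_eq
    have lE' := hBE.length_eq
    simp only [List.length_cons] at lE lE'
    refine far (r :: t :: s :: r :: E) hst ?_ ?_
    · refine tr _ _ _ hL hX (tr _ _ _ (by simp; omega) (cons r (cons s hA)) ?_)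
      refine tr _ _ _ (by simp; omega) (cons r (cons s (cons t (cons r hAE)))) ?_
      refine tr _ _ _ (by simp; omega) (cons r (swap hst _)) ?_
      refine tr _ _ _ (by simp; omega) (cons r (cons t (braid hsr _))) ?_
      exact braid hrt _
    · refine tr _ _ _ (by omega) hY (tr _ _ _ (by simp; omega) (cons r (cons t hB)) ?_)
      refine tr _ _ _ (by simp; omega) (cons r (cons t (cons s (cons r hBE)))) ?_
      refine tr _ _ _ (by simp; omega) (cons r (swap hst.symm _)) ?_
      refine tr _ _ _ (by simp; omega) (cons r (cons s (braid hrt.symm _))) ?_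
      refine tr _ _ _ (by simp; omega) (braid hsr.symm _) ?_
      exact cons s (cons r (swap hst _))
  · unfold BraidAdj at hsr hrt hst; omega

lemma transUpTo (L : ℕ) : TransUpTo L := by
  induction L with
  | zero =>
    intro X Y Z hX h₁ h₂
    have l₁ := h₁.length_eq
    have l₂ := h₂.length_eq
    rw [List.length_eq_zero_iff.1 (by omega : X.length = 0),
      List.length_eq_zero_iff.1 (by omega : Z.length = 0)]
    exact nil
  | succ L tr =>
    intro X U Y hL h₁ h₂
    have l₁ := h₁.length_eq
    have l₂ := h₂.length_eq
    cases h₁ with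
    | nil => exact h₂
    | @cons s X U h =>
      simp only [List.length_cons] at hL l₁ l₂
      cases h₂ with
      | cons _ h' => exact cons s (tr _ _ _ (by omega) h h')
      | far Z hst hX hY => exact far Z hst (tr _ _ _ (by omega) h hX) hY
      | adj Z hst hX hY => exact adj Z hst (tr _ _ _ (by omega) h hX) hY
    | @far s r X U Z hsr hX hU =>
      simp only [List.length_cons] at hL l₁ l₂
      cases h₂ with
      | cons _ h' => exact far Z hsr hX (tr _ _ _ (by simp at l₂; omega) h'.symm hU)
      | far Z' hrt hU' hY => exact tr.far_far (by omega) hsr hrt hX hU hU' hY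
      | adj Z' hrt hU' hY => exact tr.far_adj (by omega) hsr hrt hX hU hU' hY
    | @adj s r X U Z hsr hX hU =>
      simp only [List.length_cons] at hL l₁ l₂
      cases h₂ with
      | cons _ h' => exact adj Z hsr hX (tr _ _ _ (by simp at l₂; omega) h'.symm hU)
      | far Z' hrt hU' hY =>
        exact (tr.far_adj (by simp at l₂; omega) hrt.symm hsr.symm hY hU' hU hX).symm
      | adj Z' hrt hU' hY => exact tr.adj_adj (by omega) hsr hrt hX hU hU' hY

lemma trans {X Y Z : List ℕ} (h₁ : BraidRel X Y) (h₂ : BraidRel Y Z) : BraidRel X Z :=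
  transUpTo X.length X Y Z le_rfl h₁ h₂

lemma append_left (W : List ℕ) {X Y : List ℕ} (h : BraidRel X Y) :
    BraidRel (W ++ X) (W ++ Y) := by
  induction W with
  | nil => exact h
  | cons s W ih => exact cons s ih

lemma append_right (W : List ℕ) {X Y : List ℕ} (h : BraidRel X Y) :
    BraidRel (X ++ W) (Y ++ W) := by
  induction h with
  | nil => exact refl W
  | cons s _ ih => exact cons s ih
  | far Z hst _ _ ih₁ ih₂ => exact far (Z ++ W) hst ih₁ ih₂
  | adj Z hst _ _ ih₁ ih₂ => exact adj (Z ++ W) hst ih₁ ih₂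

end BraidRel

/-- A family of elements satisfying the braid relations. -/
structure IsBraidFamily {A : Type*} [Monoid A] (f : ℕ → A) : Prop where
  comm : ∀ s t, s + 2 ≤ t → f s * f t = f t * f s
  braid : ∀ s, f s * f (s + 1) * f s = f (s + 1) * f s * f (s + 1)

namespace IsBraidFamily

variable {A : Type*} [Monoid A] {f : ℕ → A}

lemma far (hf : IsBraidFamily f) {s t : ℕ} (h : BraidFar s t) : f s * f t = f t * f s := by
  rcases h with h | h
  · exact hf.comm s t h
  · exact (hf.comm t s h).symm

lemma adj (hf : IsBraidFamily f) {s t : ℕ} (h : BraidAdj s t) :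
    f s * f t * f s = f t * f s * f t := by
  rcases h with rfl | rfl
  · exact hf.braid s
  · exact (hf.braid t).symm

lemma map {B : Type*} [Monoid B] (hf : IsBraidFamily f) (g : A →* B) :
    IsBraidFamily (fun i => g (f i)) where
  comm s t h := by simp only [← map_mul, hf.comm s t h]
  braid s := by simp only [← map_mul, hf.braid s]

lemma op (hf : IsBraidFamily f) : IsBraidFamily (fun i => MulOpposite.op (f i)) where
  comm s t h := by simp only [← MulOpposite.op_mul, hf.comm s t h]
  braid s := by simp only [← MulOpposite.op_mul, ← mul_assoc, hf.braid s]

lemma prod_eq (hf : IsBraidFamily f) {X Y : List ℕ} (h : BraidRel X Y) :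
    (X.map f).prod = (Y.map f).prod := by
  induction h with
  | nil => rfl
  | cons s _ ih => simp [ih]
  | far Z hst _ _ ih₁ ih₂ =>
    simp only [List.map_cons, List.prod_cons] at *
    rw [ih₁, ih₂, ← mul_assoc, ← mul_assoc, hf.far hst]
  | adj Z hst _ _ ih₁ ih₂ =>
    simp only [List.map_cons, List.prod_cons] at *
    rw [ih₁, ih₂]
    simp only [← mul_assoc]
    rw [hf.adj hst]

end IsBraidFamily

/-- The congruence on words defining positive braids on infinitely many strands. -/
def posBraidCon : Con (FreeMonoid ℕ) where
  r X Y := BraidRel X.toList Y.toList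
  iseqv := ⟨fun _ => BraidRel.refl _, BraidRel.symm, BraidRel.trans⟩
  mul' {w x y z} h₁ h₂ := by
    simp only [FreeMonoid.toList_mul]
    exact (h₁.append_right _).trans (h₂.append_left _)

/-- The monoid of positive braids on infinitely many strands. -/
def PosBraid : Type := posBraidCon.Quotient

namespace PosBraid

instance : Monoid PosBraid := inferInstanceAs (Monoid posBraidCon.Quotient)

/-- The positive braid represented by a word. -/
def ofWord : FreeMonoid ℕ →* PosBraid := posBraidCon.mk'

lemma ofWord_surjective : Function.Surjective ofWord := Con.mk'_surjective

lemma ofWord_eq_iff {X Y : FreeMonoid ℕ} :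
    ofWord X = ofWord Y ↔ BraidRel X.toList Y.toList := posBraidCon.eq

/-- The standard generators. -/
def σ (i : ℕ) : PosBraid := ofWord (FreeMonoid.of i)

lemma isBraidFamily_σ : IsBraidFamily σ where
  comm s t h := by
    simp only [σ, ← map_mul]
    exact ofWord_eq_iff.2 (BraidRel.swap (Or.inl h) [])
  braid s := by
    simp only [σ, ← map_mul]
    exact ofWord_eq_iff.2 (BraidRel.braid (Or.inl rfl) [])

/-- The homomorphism out of positive braids determined by a braid family. -/
def lift {A : Type*} [Monoid A] (f : ℕ → A) (hf : IsBraidFamily f) : PosBraid →* A :=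
  posBraidCon.lift (FreeMonoid.lift f) fun X Y h => by
    simpa [FreeMonoid.lift_apply, Con.ker_rel] using hf.prod_eq h

@[simp]
lemma lift_σ {A : Type*} [Monoid A] (f : ℕ → A) (hf : IsBraidFamily f) (i : ℕ) :
    lift f hf (σ i) = f i := by
  exact FreeMonoid.lift_eval_of f i

@[elab_as_elim]
lemma induction_left {p : PosBraid → Prop} (m : PosBraid) (one : p 1)
    (mul : ∀ i m, p m → p (σ i * m)) : p m := by
  obtain ⟨X, rfl⟩ := ofWord_surjective m
  induction X using FreeMonoid.recOn with
  | one => simpa using one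
  | of_mul i X ih => rw [map_mul]; exact mul i _ ih

@[elab_as_elim]
lemma induction_right {p : PosBraid → Prop} (m : PosBraid) (one : p 1)
    (mul : ∀ i m, p m → p (m * σ i)) : p m := by
  suffices ∀ m, (∀ x, p x → p (x * m)) by simpa using this m 1 one
  intro m
  induction m using induction_left with
  | one => intro x hx; simpa using hx
  | mul i m ih => intro x hx; rw [← mul_assoc]; exact ih _ (mul i x hx)

/-- The word length as a homomorphism. -/
def lenHom : PosBraid →* Multiplicative ℕ :=
  lift (fun _ => Multiplicative.ofAdd 1) ⟨fun _ _ _ => rfl, fun _ => rfl⟩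

/-- The word length of a positive braid. -/
def len (m : PosBraid) : ℕ := (lenHom m).toAdd

@[simp] lemma len_one : len 1 = 0 := by simp [len]

@[simp] lemma len_mul (x y : PosBraid) : len (x * y) = len x + len y := by simp [len]

@[simp] lemma len_σ (i : ℕ) : len (σ i) = 1 := by simp [len, lenHom]

/-- Reversal of positive braids. -/
def revHom : PosBraid →* PosBraidᵐᵒᵖ := lift _ isBraidFamily_σ.op

/-- Reversal of positive braids. -/
def rev (m : PosBraid) : PosBraid := (revHom m).unop

@[simp] lemma rev_one : rev 1 = 1 := by simp [rev]

@[simp] lemma rev_mul (x y : PosBraid) : rev (x * y) = rev y * rev x := by simp [rev]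

@[simp] lemma rev_σ (i : ℕ) : rev (σ i) = σ i := by simp [rev, revHom]

@[simp] lemma rev_rev (m : PosBraid) : rev (rev m) = m := by
  induction m using induction_left with
  | one => simp
  | mul i m ih => simp [ih]

lemma rev_injective : Function.Injective rev := Function.LeftInverse.injective rev_rev

lemma σ_mul_left_cancel {s : ℕ} {x y : PosBraid} (h : σ s * x = σ s * y) : x = y := by
  obtain ⟨X, rfl⟩ := ofWord_surjective x
  obtain ⟨Y, rfl⟩ := ofWord_surjective y
  simp only [σ, ← map_mul] at h
  exact ofWord_eq_iff.2 (BraidRel.of_eq_head (ofWord_eq_iff.1 h))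

instance : IsLeftCancelMul PosBraid where
  mul_left_cancel m x y h := by
    induction m using induction_left with
    | one => simpa using h
    | mul i m ih => exact ih (σ_mul_left_cancel (by simpa [mul_assoc] using h))

instance : IsRightCancelMul PosBraid where
  mul_right_cancel m x y h := by
    have h' := congrArg rev h
    simp only [rev_mul] at h'
    exact rev_injective (mul_left_cancel h')

lemma exists_of_far_left {s t : ℕ} {x y : PosBraid} (hst : BraidFar s t)
    (h : σ s * x = σ t * y) : ∃ z, x = σ t * z ∧ y = σ s * z := by
  obtain ⟨X, rfl⟩ := ofWord_surjective x
  obtain ⟨Y, rfl⟩ := ofWord_surjective y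
  simp only [σ, ← map_mul] at h
  obtain ⟨Z, h₁, h₂⟩ := BraidRel.of_far hst (ofWord_eq_iff.1 h)
  refine ⟨ofWord (FreeMonoid.ofList Z), ?_, ?_⟩ <;> simp only [σ, ← map_mul]
  · exact ofWord_eq_iff.2 h₁
  · exact ofWord_eq_iff.2 h₂

lemma exists_of_adj_left {s t : ℕ} {x y : PosBraid} (hst : BraidAdj s t)
    (h : σ s * x = σ t * y) : ∃ z, x = σ t * (σ s * z) ∧ y = σ s * (σ t * z) := by
  obtain ⟨X, rfl⟩ := ofWord_surjective x
  obtain ⟨Y, rfl⟩ := ofWord_surjective y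
  simp only [σ, ← map_mul] at h
  obtain ⟨Z, h₁, h₂⟩ := BraidRel.of_adj hst (ofWord_eq_iff.1 h)
  refine ⟨ofWord (FreeMonoid.ofList Z), ?_, ?_⟩ <;> simp only [σ, ← map_mul]
  · exact ofWord_eq_iff.2 h₁
  · exact ofWord_eq_iff.2 h₂

lemma exists_of_far {s t : ℕ} {x y : PosBraid} (hst : BraidFar s t)
    (h : x * σ s = y * σ t) : ∃ z, x = z * σ t ∧ y = z * σ s := by
  have h' := congrArg rev h
  simp only [rev_mul, rev_σ] at h'
  obtain ⟨z, h₁, h₂⟩ := exists_of_far_left hst h'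
  exact ⟨rev z, rev_injective (by simpa using h₁), rev_injective (by simpa using h₂)⟩

lemma exists_of_adj {s t : ℕ} {x y : PosBraid} (hst : BraidAdj s t)
    (h : x * σ s = y * σ t) : ∃ z, x = z * σ s * σ t ∧ y = z * σ t * σ s := by
  have h' := congrArg rev h
  simp only [rev_mul, rev_σ] at h'
  obtain ⟨z, h₁, h₂⟩ := exists_of_adj_left hst h'
  exact ⟨rev z, rev_injective (by simpa using h₁), rev_injective (by simpa using h₂)⟩

end PosBraid

section BraidProducts

variable {A : Type*} [Monoid A] (f : ℕ → A)

/-- The descending product `f (j + k - 1) ⋯ f (j + 1) f j`. -/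
def braidDown (j : ℕ) : ℕ → A
  | 0 => 1
  | k + 1 => f (j + k) * braidDown j k

/-- The longest `(a, b)`-shuffle, on strands `j, …, j + a + b - 1`. -/
def braidTop (j : ℕ) : ℕ → ℕ → A
  | 0, _ => 1
  | a + 1, b => braidTop j a b * braidDown f (j + a) b

/-- The half twist on strands `j, …, j + n - 1`. -/
def braidDelta : ℕ → ℕ → A
  | _, 0 => 1
  | j, n + 1 => braidDown f j n * braidDelta (j + 1) n

@[simp] lemma braidDown_zero (j : ℕ) : braidDown f j 0 = 1 := rfl

lemma braidDown_succ (j k : ℕ) : braidDown f j (k + 1) = f (j + k) * braidDown f j k := rfl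

lemma braidDown_add (j k l : ℕ) :
    braidDown f j (k + l) = braidDown f (j + k) l * braidDown f j k := by
  induction l with
  | zero => simp
  | succ l ih =>
    rw [← add_assoc, braidDown_succ, braidDown_succ, ih, mul_assoc, add_assoc]

@[simp] lemma braidDown_one (j : ℕ) : braidDown f j 1 = f j := by simp [braidDown]

lemma braidDown_succ' (j k : ℕ) : braidDown f j (k + 1) = braidDown f (j + 1) k * f j := by
  rw [add_comm k 1, braidDown_add, braidDown_one]

@[simp] lemma braidTop_zero_left (j b : ℕ) : braidTop f j 0 b = 1 := by simp [braidTop]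

lemma braidTop_succ (j a b : ℕ) :
    braidTop f j (a + 1) b = braidTop f j a b * braidDown f (j + a) b := by simp [braidTop]

@[simp] lemma braidTop_one (j b : ℕ) : braidTop f j 1 b = braidDown f j b := by
  simp [braidTop_succ]

lemma braidDown_mem (S : Submonoid A) (j k : ℕ) (h : ∀ i, j ≤ i → i < j + k → f i ∈ S) :
    braidDown f j k ∈ S := by
  induction k with
  | zero => exact S.one_mem
  | succ k ih =>
    exact S.mul_mem (h _ (by omega) (by omega)) (ih fun i h₁ h₂ => h i h₁ (by omega))

lemma braidDelta_mem (S : Submonoid A) (j n : ℕ) (h : ∀ i, j ≤ i → i + 1 < j + n → f i ∈ S) :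
    braidDelta f j n ∈ S := by
  induction n generalizing j with
  | zero => exact S.one_mem
  | succ n ih =>
    exact S.mul_mem (braidDown_mem f S _ _ fun i h₁ h₂ => h i h₁ (by omega))
      (ih _ fun i h₁ h₂ => h i (by omega) (by omega))

variable {f}

lemma IsBraidFamily.braidDown_mul (hf : IsBraidFamily f) {i j k : ℕ} (hji : j ≤ i) (hik : i + 1 < j + k) :
    braidDown f j k * f (i + 1) = f i * braidDown f j k := by
  induction k with
  | zero => omega
  | succ k ih =>
    rw [braidDown_succ, mul_assoc]
    by_cases h : i + 1 < j + k
    · rw [ih h, ← mul_assoc, ← mul_assoc, hf.comm i (j + k) (by omega)]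
    · obtain ⟨l, rfl⟩ : ∃ l, k = l + 1 := ⟨k - 1, by omega⟩
      obtain rfl : i = j + l := by omega
      have hc : braidDown f j l * f (j + l + 1) = f (j + l + 1) * braidDown f j l := by
        have := braidDown_mem f (Submonoid.centralizer {f (j + l + 1)}) j l (fun i h₁ h₂ => by
          simp only [Submonoid.mem_centralizer_iff, Set.mem_singleton_iff, forall_eq]
          exact (hf.comm i _ (by omega)).symm)
        simp only [Submonoid.mem_centralizer_iff, Set.mem_singleton_iff, forall_eq] at this
        exact this.symm
      rw [braidDown_succ, mul_assoc, hc, ← add_assoc]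
      simp only [← mul_assoc]
      rw [hf.braid]

lemma IsBraidFamily.braidDown_mul_braidDown (hf : IsBraidFamily f) {i j k l : ℕ} (hji : j ≤ i) (hik : i + l + 1 ≤ j + k) :
    braidDown f j k * braidDown f (i + 1) l = braidDown f i l * braidDown f j k := by
  induction l with
  | zero => simp
  | succ l ih =>
    rw [braidDown_succ, braidDown_succ, ← mul_assoc, add_right_comm,
      hf.braidDown_mul (by omega) (by omega), mul_assoc, ih (by omega), mul_assoc]

lemma IsBraidFamily.braidDown_mul_braidTop (hf : IsBraidFamily f) {j k a b : ℕ} (h : a + b ≤ k) :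
    braidDown f j k * braidTop f (j + 1) a b = braidTop f j a b * braidDown f j k := by
  induction a with
  | zero => simp
  | succ a ih =>
    rw [braidTop_succ, braidTop_succ, ← mul_assoc, ih (by omega), mul_assoc, mul_assoc,
      add_right_comm, hf.braidDown_mul_braidDown (by omega) (by omega)]

lemma IsBraidFamily.braidDown_mul_braidTop_eq (hf : IsBraidFamily f) (j a b : ℕ) :
    braidDown f j (a + b) * braidTop f (j + 1) a b =
      braidTop f j (a + 1) b * braidDown f j a := by
  rw [hf.braidDown_mul_braidTop le_rfl, braidDown_add, braidTop_succ, mul_assoc]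

lemma IsBraidFamily.braidTop_mul_braidDelta (hf : IsBraidFamily f) (j a b : ℕ) :
    braidTop f j a b * (braidDelta f j a * braidDelta f (j + a) b) = braidDelta f j (a + b) := by
  induction a generalizing j with
  | zero => simp [braidDelta]
  | succ a ih =>
    have h := hf.braidDown_mul_braidTop_eq j a b
    simp only [braidDelta, Nat.succ_add]
    rw [← ih (j + 1), ← mul_assoc (braidDown f j (a + b)), h, show j + 1 + a = j + (a + 1) by ring]
    simp only [mul_assoc]

end BraidProducts

section Shuffle

variable {R : Type*} [Semiring R] (f : ℕ → R)

/-- The sum of all `(a, b)`-shuffles, on strands `j, …, j + a + b - 1`. -/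
def braidShuffle (j : ℕ) : ℕ → ℕ → R
  | 0, _ => 1
  | _ + 1, 0 => 1
  | a + 1, b + 1 => braidShuffle j (a + 1) b + braidShuffle j a (b + 1) * braidDown f (j + a) (b + 1)

@[simp] lemma braidShuffle_zero_left (j b : ℕ) : braidShuffle f j 0 b = 1 := by
  simp [braidShuffle]

@[simp] lemma braidShuffle_zero_right (j a : ℕ) : braidShuffle f j a 0 = 1 := by
  cases a <;> simp [braidShuffle]

lemma braidShuffle_succ_succ (j a b : ℕ) : braidShuffle f j (a + 1) (b + 1) =
    braidShuffle f j (a + 1) b + braidShuffle f j a (b + 1) * braidDown f (j + a) (b + 1) := by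
  rw [braidShuffle]

lemma braidShuffle_mem (S : Subsemiring R) (j a b : ℕ)
    (h : ∀ i, j ≤ i → i + 1 < j + a + b → f i ∈ S) : braidShuffle f j a b ∈ S := by
  induction a generalizing b with
  | zero => rw [braidShuffle_zero_left]; exact S.one_mem
  | succ a iha =>
    induction b with
    | zero => rw [braidShuffle_zero_right]; exact S.one_mem
    | succ b ihb =>
      rw [braidShuffle_succ_succ]
      exact S.add_mem (ihb fun i h₁ h₂ => h i h₁ (by omega))
        (S.mul_mem (iha _ fun i h₁ h₂ => h i h₁ (by omega))
          (braidDown_mem f S.toSubmonoid _ _ fun i h₁ h₂ => h i (by omega) (by omega)))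

lemma map_braidDown {A B F : Type*} [Monoid A] [Monoid B] [FunLike F A B] [MonoidHomClass F A B]
    (g : F) (f : ℕ → A) (j k : ℕ) : g (braidDown f j k) = braidDown (fun i => g (f i)) j k := by
  induction k with
  | zero => simp
  | succ k ih => rw [braidDown_succ, braidDown_succ, map_mul, ih]

lemma map_braidShuffle {S : Type*} [Semiring S] (g : R →+* S) (j a b : ℕ) :
    g (braidShuffle f j a b) = braidShuffle (fun i => g (f i)) j a b := by
  induction a generalizing b with
  | zero => simp
  | succ a iha =>
    induction b with
    | zero => simp
    | succ b ihb =>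
      rw [braidShuffle_succ_succ, braidShuffle_succ_succ, map_add, map_mul, iha, ihb,
        map_braidDown]

variable {f}

lemma IsBraidFamily.braidDown_mul_braidShuffle (hf : IsBraidFamily f) {j k a b : ℕ} (h : a + b ≤ k) :
    braidDown f j k * braidShuffle f (j + 1) a b = braidShuffle f j a b * braidDown f j k := by
  induction a generalizing b with
  | zero => simp
  | succ a iha =>
    induction b with
    | zero => simp
    | succ b ihb =>
      rw [braidShuffle_succ_succ, braidShuffle_succ_succ, mul_add, add_mul, ihb (by omega),
        ← mul_assoc, iha (by omega), mul_assoc, mul_assoc, add_right_comm j 1 a,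
        hf.braidDown_mul_braidDown (by omega) (by omega)]

lemma IsBraidFamily.commute_of_le (hf : IsBraidFamily f) {x y : R} {i : ℕ}
    (hx : x ∈ Subsemiring.closure (f '' {k | k + 2 ≤ i}))
    (hy : y ∈ Subsemiring.closure (f '' {k | i ≤ k})) : x * y = y * x := by
  have h₁ : Subsemiring.closure (f '' {k | i ≤ k}) ≤
      Subsemiring.centralizer (f '' {k | k + 2 ≤ i}) := by
    rw [Subsemiring.closure_le]
    rintro _ ⟨k, hk, rfl⟩ _ ⟨l, hl, rfl⟩
    exact hf.comm _ _ (le_trans hl hk)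
  have h₂ : Subsemiring.closure (f '' {k | k + 2 ≤ i}) ≤ Subsemiring.centralizer {y} := by
    rw [Subsemiring.closure_le]
    rintro _ hk _ rfl
    exact (h₁ hy _ hk).symm
  exact (h₂ hx y rfl).symm

lemma IsBraidFamily.braidShuffle_commute (hf : IsBraidFamily f) {j a b : ℕ} {i : ℕ} (h : j + a + b ≤ i) {y : R}
    (hy : y ∈ Subsemiring.closure (f '' {k | i ≤ k})) :
    braidShuffle f j a b * y = y * braidShuffle f j a b :=
  hf.commute_of_le (braidShuffle_mem f _ _ _ _ fun k _ h₂ =>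
    Subsemiring.subset_closure ⟨k, by simp only [Set.mem_ofPred_eq]; omega, rfl⟩) hy

lemma braidDown_mem_closure {i j k : ℕ} (h : i ≤ j) :
    braidDown f j k ∈ Subsemiring.closure (f '' {k | i ≤ k}) :=
  braidDown_mem f (Subsemiring.closure _).toSubmonoid _ _ fun l h₁ _ =>
    Subsemiring.subset_closure ⟨l, by simp only [Set.mem_ofPred_eq]; omega, rfl⟩

/-- Coassociativity of shuffles. -/
theorem IsBraidFamily.braidShuffle_assoc (hf : IsBraidFamily f) (j a b c : ℕ) :
    braidShuffle f j (a + b) c * braidShuffle f j a b =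
      braidShuffle f j a (b + c) * braidShuffle f (j + a) b c := by
  induction hn : a + b + c using Nat.strong_induction_on generalizing a b c with
  | _ n ih =>
    match a, b, c with
    | 0, b, c => simp
    | a + 1, 0, c => simp
    | a + 1, b + 1, 0 => simp
    | a + 1, b + 1, c + 1 =>
      have h₁ : braidShuffle f j (a + b + 2) c * braidShuffle f j (a + 1) (b + 1) =
          braidShuffle f j (a + 1) (b + c + 1) * braidShuffle f (j + a + 1) (b + 1) c := by
        convert ih _ (by omega) (a + 1) (b + 1) c rfl using 2 <;> ring_nf
      have h₂ : braidShuffle f j (a + b + 1) (c + 1) * braidShuffle f j (a + 1) b =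
          braidShuffle f j (a + 1) (b + c + 1) * braidShuffle f (j + a + 1) b (c + 1) := by
        convert ih _ (by omega) (a + 1) b (c + 1) rfl using 2 <;> ring_nf
      have h₃ : braidShuffle f j (a + b + 1) (c + 1) * braidShuffle f j a (b + 1) =
          braidShuffle f j a (b + c + 2) * braidShuffle f (j + a) (b + 1) (c + 1) := by
        convert ih _ (by omega) a (b + 1) (c + 1) rfl using 2 <;> ring_nf
      have e₁ := hf.braidShuffle_commute (j := j) (a := a + 1) (b := b) (i := j + a + b + 1)
        (by omega) (braidDown_mem_closure (j := j + a + b + 1) (k := c + 1) le_rfl)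
      have e₂ := hf.braidShuffle_commute (j := j) (a := a) (b := b + 1) (i := j + a + b + 1)
        (by omega) (braidDown_mem_closure (j := j + a + b + 1) (k := c + 1) le_rfl)
      have e₃ : braidDown f (j + a) (b + c + 2) =
          braidDown f (j + a + b + 1) (c + 1) * braidDown f (j + a) (b + 1) := by
        convert braidDown_add f (j + a) (b + 1) (c + 1) using 2 <;> ring_nf
      have e₄ := hf.braidDown_mul_braidShuffle (j := j + a) (k := b + c + 2) (a := b + 1)
        (b := c + 1) (by omega)
      have s₁ : braidShuffle f j (a + b + 2) (c + 1) = braidShuffle f j (a + b + 2) c +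
          braidShuffle f j (a + b + 1) (c + 1) * braidDown f (j + a + b + 1) (c + 1) := by
        convert braidShuffle_succ_succ f j (a + b + 1) c using 3; ring_nf
      have s₂ := braidShuffle_succ_succ f j a b
      have s₃ : braidShuffle f j (a + 1) (b + c + 2) = braidShuffle f j (a + 1) (b + c + 1) +
          braidShuffle f j a (b + c + 2) * braidDown f (j + a) (b + c + 2) :=
        braidShuffle_succ_succ f j a (b + c + 1)
      have s₄ : braidShuffle f (j + a + 1) (b + 1) (c + 1) = braidShuffle f (j + a + 1) (b + 1) c +
          braidShuffle f (j + a + 1) b (c + 1) * braidDown f (j + a + b + 1) (c + 1) := by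
        convert braidShuffle_succ_succ f (j + a + 1) b c using 3; ring_nf
      rw [show a + 1 + (b + 1) = a + b + 2 by ring, show b + 1 + (c + 1) = b + c + 2 by ring,
        show j + (a + 1) = j + a + 1 by ring, s₁, add_mul, h₁, s₃, add_mul,
        mul_assoc _ (braidDown f (j + a) (b + c + 2)), e₄, ← mul_assoc _ _ (braidDown f _ _), ← h₃,
        e₃, s₄, mul_add, add_assoc (_ * _ : R)]
      congr 1
      rw [s₂, mul_add, mul_assoc _ _ (braidShuffle f j (a + 1) b), ← e₁, ← mul_assoc, h₂,
        mul_assoc, mul_assoc _ (braidDown f (j + a + b + 1) (c + 1)),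
        ← mul_assoc (braidDown f (j + a + b + 1) (c + 1)), ← e₂]
      simp only [mul_assoc]

end Shuffle

section Complex

open Finset

variable {R : Type*} [Ring R] (f : ℕ → R)

/-- The part of the boundary of the composition `(a + 1) :: w` that splits the first block, as a
combination of compositions; the list entry `a` stands for a block of size `a + 1`, and the first
block starts at strand `j`. -/
noncomputable def blockSplit (j : ℕ) : ℕ → List ℕ → List ℕ →₀ R
  | 0, _ => 0
  | a + 1, w => ∑ p ∈ antidiagonal a,
      Finsupp.single (p.1 :: p.2 :: w) (braidShuffle f j (p.1 + 1) (p.2 + 1))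

/-- The boundary of a composition whose first block starts at strand `j`. -/
noncomputable def blockBoundary : ℕ → List ℕ → List ℕ →₀ R
  | _, [] => 0
  | j, a :: w => blockSplit f j a w + (blockBoundary (j + a + 1) w).mapDomain (a :: ·)

/-- The boundary operator on the free left module on compositions. -/
noncomputable def blockD (j : ℕ) : (List ℕ →₀ R) →ₗ[R] (List ℕ →₀ R) :=
  Finsupp.linearCombination R (blockBoundary f j)

@[simp] lemma blockSplit_zero (j : ℕ) (w : List ℕ) : blockSplit f j 0 w = 0 := rfl

lemma blockSplit_succ (j a : ℕ) (w : List ℕ) : blockSplit f j (a + 1) w =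
    ∑ p ∈ antidiagonal a,
      Finsupp.single (p.1 :: p.2 :: w) (braidShuffle f j (p.1 + 1) (p.2 + 1)) := rfl

@[simp] lemma blockBoundary_nil (j : ℕ) : blockBoundary f j [] = 0 := rfl

lemma blockBoundary_cons (j a : ℕ) (w : List ℕ) : blockBoundary f j (a :: w) =
    blockSplit f j a w + (blockBoundary f (j + a + 1) w).mapDomain (a :: ·) := rfl

@[simp] lemma blockD_single (j : ℕ) (w : List ℕ) (r : R) :
    blockD f j (Finsupp.single w r) = r • blockBoundary f j w := by
  simp [blockD]

lemma blockD_cons (j a : ℕ) (v : List ℕ →₀ R) :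
    blockD f j (v.mapDomain (a :: ·)) = Finsupp.linearCombination R (blockSplit f j a) v +
      (blockD f (j + a + 1) v).mapDomain (a :: ·) := by
  induction v using Finsupp.induction_linear with
  | zero => simp
  | add v w hv hw => simp only [Finsupp.mapDomain_add, map_add, hv, hw]; abel
  | single w r => simp [Finsupp.mapDomain_single, blockBoundary_cons, Finsupp.mapDomain_smul]

lemma blockSplit_apply_mem (S : Subsemiring R) (j a : ℕ) (w w' : List ℕ)
    (h : ∀ i, j ≤ i → i < j + a → f i ∈ S) : blockSplit f j a w w' ∈ S := by
  cases a with
  | zero => exact S.zero_mem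
  | succ a =>
    rw [blockSplit_succ, Finsupp.finsetSum_apply]
    refine S.sum_mem fun p hp => ?_
    rw [HasAntidiagonal.mem_antidiagonal] at hp
    rw [Finsupp.single_apply]
    split_ifs
    · exact braidShuffle_mem f S _ _ _ fun i hi hi' => h i hi (by omega)
    · exact S.zero_mem

lemma blockBoundary_apply_mem (S : Subsemiring R) (j : ℕ) (w w' : List ℕ)
    (h : ∀ i, j ≤ i → i + 1 < j + w.sum + w.length → f i ∈ S) :
    blockBoundary f j w w' ∈ S := by
  induction w generalizing j w' with
  | nil => exact S.zero_mem
  | cons a w ih =>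
    rw [blockBoundary_cons, Finsupp.add_apply]
    simp only [List.sum_cons, List.length_cons] at h
    refine S.add_mem (blockSplit_apply_mem f S j a w w' fun i hi hi' => h i hi (by omega)) ?_
    by_cases hw : w' ∈ Set.range (List.cons a)
    · obtain ⟨v, rfl⟩ := hw
      rw [Finsupp.mapDomain_apply (List.cons_injective)]
      exact ih _ _ fun i hi hi' => h i (by omega) (by omega)
    · rw [Finsupp.mapDomain_of_notMem_range _ _ hw]
      exact S.zero_mem

lemma sum_antidiagonal_antidiagonal {A : Type*} [AddCommMonoid A] (n : ℕ) (F : ℕ → ℕ → ℕ → A) :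
    ∑ p ∈ antidiagonal n, ∑ q ∈ antidiagonal p.1, F q.1 q.2 p.2 =
      ∑ p ∈ antidiagonal n, ∑ q ∈ antidiagonal p.2, F p.1 q.1 q.2 := by
  rw [Finset.sum_sigma', Finset.sum_sigma']
  refine Finset.sum_nbij' (fun x => ⟨(x.2.1, x.2.2 + x.1.2), (x.2.2, x.1.2)⟩)
    (fun x => ⟨(x.1.1 + x.2.1, x.2.2), (x.1.1, x.2.1)⟩) ?_ ?_ ?_ ?_ ?_
  · rintro ⟨⟨a, b⟩, ⟨c, d⟩⟩ h
    simp only [mem_sigma, HasAntidiagonal.mem_antidiagonal, and_true] at h ⊢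
    omega
  · rintro ⟨⟨a, b⟩, ⟨c, d⟩⟩ h
    simp only [mem_sigma, HasAntidiagonal.mem_antidiagonal, and_true] at h ⊢
    omega
  · rintro ⟨⟨a, b⟩, ⟨c, d⟩⟩ h
    simp only [mem_sigma, HasAntidiagonal.mem_antidiagonal] at h ⊢
    obtain ⟨rfl, rfl⟩ := h
    rfl
  · rintro ⟨⟨a, b⟩, ⟨c, d⟩⟩ h
    simp only [mem_sigma, HasAntidiagonal.mem_antidiagonal] at h ⊢
    obtain ⟨rfl, rfl⟩ := h
    rfl
  · rintro ⟨⟨a, b⟩, ⟨c, d⟩⟩ h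
    rfl

variable {f} in
/-- Splitting a block twice, on the left or on the right, gives the same result. -/
lemma IsBraidFamily.sum_split_split (hf : IsBraidFamily f) (j a : ℕ) (w : List ℕ) :
    ∑ p ∈ antidiagonal a,
      braidShuffle f j (p.1 + 1) (p.2 + 1) • blockSplit f j p.1 (p.2 :: w) =
    ∑ p ∈ antidiagonal a, braidShuffle f j (p.1 + 1) (p.2 + 1) •
      (blockSplit f (j + p.1 + 1) p.2 w).mapDomain (p.1 :: ·) := by
  cases a with
  | zero => simp
  | succ a =>
    rw [Finset.Nat.sum_antidiagonal_succ, Finset.Nat.sum_antidiagonal_succ']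
    simp only [blockSplit_zero, smul_zero, zero_add, Finsupp.mapDomain_zero,
      blockSplit_succ, Finsupp.mapDomain_finsetSum, Finsupp.mapDomain_single, Finset.smul_sum,
      Finsupp.smul_single, smul_eq_mul]
    have := sum_antidiagonal_antidiagonal a fun x y z => Finsupp.single (x :: y :: z :: w)
      (braidShuffle f j (x + y + 2) (z + 1) * braidShuffle f j (x + 1) (y + 1))
    convert this using 1
    · refine Finset.sum_congr rfl fun p _ => Finset.sum_congr rfl fun q hq => ?_
      rw [← HasAntidiagonal.mem_antidiagonal.1 hq]
    · refine Finset.sum_congr rfl fun p _ => Finset.sum_congr rfl fun q hq => ?_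
      rw [← HasAntidiagonal.mem_antidiagonal.1 hq]
      congr 1
      rw [show p.1 + q.1 + 2 = p.1 + 1 + (q.1 + 1) by ring, hf.braidShuffle_assoc]
      congr 2
      ring

variable {f} in
theorem IsBraidFamily.blockD_blockBoundary [Module (ZMod 2) R] (hf : IsBraidFamily f)
    (j : ℕ) (w : List ℕ) : blockD f j (blockBoundary f j w) = 0 := by
  induction w generalizing j with
  | nil => simp
  | cons a w ih =>
    rw [blockBoundary_cons, map_add, blockD_cons, ih, Finsupp.mapDomain_zero, add_zero]
    cases a with
    | zero =>
      simp only [blockSplit_zero, map_zero, zero_add]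
      simp [Finsupp.linearCombination_apply]
    | succ a =>
      have key : Finsupp.linearCombination R (blockSplit f j (a + 1))
          (blockBoundary f (j + (a + 1) + 1) w) =
          ∑ p ∈ antidiagonal a, braidShuffle f j (p.1 + 1) (p.2 + 1) •
            ((blockBoundary f (j + (a + 1) + 1) w).mapDomain (fun v => p.1 :: p.2 :: v)) := by
        have h : ∀ v : List ℕ →₀ R, (∀ x, v x ∈
            Subsemiring.closure (f '' {k | j + (a + 1) + 1 ≤ k})) →
            Finsupp.linearCombination R (blockSplit f j (a + 1)) v =
            ∑ p ∈ antidiagonal a, braidShuffle f j (p.1 + 1) (p.2 + 1) •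
              (v.mapDomain (fun v => p.1 :: p.2 :: v)) := by
          intro v hv
          simp only [Finsupp.linearCombination_apply, Finsupp.sum, Finsupp.mapDomain,
            Finset.smul_sum, blockSplit_succ, Finsupp.smul_single, smul_eq_mul]
          rw [Finset.sum_comm]
          refine Finset.sum_congr rfl fun p hp => Finset.sum_congr rfl fun x _ => ?_
          have hp' := HasAntidiagonal.mem_antidiagonal.1 hp
          rw [hf.braidShuffle_commute (by omega) (hv x)]
        exact h _ fun x => blockBoundary_apply_mem f _ _ _ _ fun i hi _ =>
          Subsemiring.subset_closure ⟨i, hi, rfl⟩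
      rw [key, blockSplit_succ, map_sum]
      simp only [blockD_single, blockBoundary_cons, smul_add, Finsupp.mapDomain_add,
        Finset.sum_add_distrib]
      rw [hf.sum_split_split, ← add_assoc, ZModModule.add_self, zero_add]
      rw [← Finset.sum_add_distrib]
      refine Finset.sum_eq_zero fun p hp => ?_
      have hp' := HasAntidiagonal.mem_antidiagonal.1 hp
      rw [← Finsupp.mapDomain_comp, show j + p.1 + 1 + p.2 + 1 = j + (a + 1) + 1 by omega]
      exact ZModModule.add_self _

variable {f} in
theorem IsBraidFamily.blockD_blockD [Module (ZMod 2) R] (hf : IsBraidFamily f)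
    (j : ℕ) (v : List ℕ →₀ R) : blockD f j (blockD f j v) = 0 := by
  induction v using Finsupp.induction_linear with
  | zero => simp
  | add v w hv hw => rw [map_add, map_add, hv, hw, add_zero]
  | single w r => rw [blockD_single, map_smul, hf.blockD_blockBoundary, smul_zero]

lemma mapRange_blockBoundary {S : Type*} [Ring S] (g : R →+* S) (j : ℕ) (w : List ℕ) :
    (blockBoundary f j w).mapRange g (map_zero g) = blockBoundary (fun i => g (f i)) j w := by
  induction w generalizing j with
  | nil => simp
  | cons a w ih =>
    rw [blockBoundary_cons, blockBoundary_cons, Finsupp.mapRange_add (map_add g),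
      ← Finsupp.mapDomain_mapRange _ _ _ _ (map_add g), ih]
    congr 1
    cases a with
    | zero => simp
    | succ a =>
      rw [blockSplit_succ, blockSplit_succ]
      refine (map_sum (Finsupp.mapRange.addMonoidHom (g : R →+ S)) _ _).trans ?_
      refine Finset.sum_congr rfl fun p _ => ?_
      rw [← map_braidShuffle]
      exact Finsupp.mapRange_single (hf := map_zero g)

lemma mapRange_blockD {S : Type*} [Ring S] (g : R →+* S) (j : ℕ) (v : List ℕ →₀ R) :
    (blockD f j v).mapRange g (map_zero g) =
      blockD (fun i => g (f i)) j (v.mapRange g (map_zero g)) := by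
  induction v using Finsupp.induction_linear with
  | zero => simp
  | add v w hv hw => simp only [map_add, Finsupp.mapRange_add (map_add g), hv, hw]
  | single w r =>
    rw [blockD_single, Finsupp.mapRange_single, blockD_single, ← mapRange_blockBoundary]
    ext x
    simp

lemma blockBoundary_support (j : ℕ) (w w' : List ℕ) (h : blockBoundary f j w w' ≠ 0) :
    w'.sum + 1 = w.sum ∧ w'.length = w.length + 1 := by
  induction w generalizing j w' with
  | nil => simp at h
  | cons a w ih =>
    rw [blockBoundary_cons, Finsupp.add_apply] at h
    by_cases h₁ : blockSplit f j a w w' = 0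
    · rw [h₁, zero_add] at h
      have hw : w' ∈ Set.range (List.cons a) := by
        by_contra hw
        exact h (Finsupp.mapDomain_of_notMem_range _ _ hw)
      obtain ⟨v, rfl⟩ := hw
      rw [Finsupp.mapDomain_apply (List.cons_injective)] at h
      have := ih _ _ h
      simp only [List.sum_cons, List.length_cons]
      omega
    · cases a with
      | zero => simp at h₁
      | succ a =>
        rw [blockSplit_succ, Finsupp.finsetSum_apply] at h₁
        obtain ⟨p, hp, hp'⟩ := Finset.exists_ne_zero_of_sum_ne_zero h₁
        rw [Finsupp.single_apply] at hp'
        split_ifs at hp' with hw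
        · subst hw
          rw [HasAntidiagonal.mem_antidiagonal] at hp
          simp only [List.sum_cons, List.length_cons, and_true]
          omega
        · exact absurd rfl hp'

end Complex

/-- Algebraic discrete Morse theory: if `1 + dh + hd` lowers every noncritical generator with
respect to a well-founded relation, then the critical generators span the homology. -/
theorem mem_range_sup_span_of_homotopy {V X : Type*} [AddCommGroup V] [Module (ZMod 2) V]
    {d h : V →ₗ[ZMod 2] V} (hd : ∀ v, d (d v) = 0) {x : X → V}
    (hx : Submodule.span (ZMod 2) (Set.range x) = ⊤) {lt : X → X → Prop} (hlt : WellFounded lt)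
    {crit : Set X} (hcrit : ∀ i ∈ crit, d (x i) = 0)
    (hlow : ∀ i ∉ crit, x i + d (h (x i)) + h (d (x i)) ∈
      Submodule.span (ZMod 2) (x '' {k | lt k i})) {v : V} (hv : d v = 0) :
    v ∈ LinearMap.range d ⊔ Submodule.span (ZMod 2) (x '' crit) := by
  set S := LinearMap.range d ⊔ Submodule.span (ZMod 2) (x '' crit)
  let T : V →ₗ[ZMod 2] V := LinearMap.id + d ∘ₗ h + h ∘ₗ d
  have hT : ∀ v, T v = v + d (h v) + h (d v) := fun v => rfl
  have hrange : ∀ v, d v ∈ S := fun v => Submodule.mem_sup_left ⟨v, rfl⟩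
  have hTS : ∀ v ∈ S, T v ∈ S := by
    intro v hv
    obtain ⟨y, ⟨y, rfl⟩, z, hz, rfl⟩ := Submodule.mem_sup.1 hv
    rw [map_add]
    refine S.add_mem ?_ ?_
    · rw [hT, hd, map_zero, add_zero, ← map_add]
      exact hrange _
    · have hz0 : d z = 0 := by
        have : Submodule.span (ZMod 2) (x '' crit) ≤ LinearMap.ker d := by
          rw [Submodule.span_le]
          rintro _ ⟨i, hi, rfl⟩
          exact hcrit i hi
        exact this hz
      rw [hT, hz0, map_zero, add_zero]
      exact S.add_mem (Submodule.mem_sup_right hz) (hrange _)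
  have hTk : ∀ k v, (T ^ k) v ∈ S → (T ^ (k + 1)) v ∈ S := by
    intro k v hv
    rw [pow_succ', Module.End.mul_apply]
    exact hTS _ hv
  have hTadd : ∀ k l v, (T ^ k) v ∈ S → (T ^ (k + l)) v ∈ S := by
    intro k l v hv
    induction l with
    | zero => exact hv
    | succ l ih => exact hTk _ _ ih
  have hspan : ∀ s : Set X, (∀ i ∈ s, ∃ k, (T ^ k) (x i) ∈ S) →
      ∀ v ∈ Submodule.span (ZMod 2) (x '' s), ∃ k, (T ^ k) v ∈ S := by
    intro s hs v hv
    induction hv using Submodule.span_induction with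
    | mem z hz => obtain ⟨i, hi, rfl⟩ := hz; exact hs i hi
    | zero => exact ⟨0, by simp⟩
    | add y z _ _ hy hz =>
      obtain ⟨k, hk⟩ := hy
      obtain ⟨l, hl⟩ := hz
      refine ⟨k + l, ?_⟩
      rw [map_add]
      exact S.add_mem (hTadd k l y hk) (add_comm k l ▸ hTadd l k z hl)
    | smul c y _ hy =>
      obtain ⟨k, hk⟩ := hy
      exact ⟨k, by rw [map_smul]; exact S.smul_mem _ hk⟩
  have hgen : ∀ i, ∃ k, (T ^ k) (x i) ∈ S := by
    intro i
    induction i using hlt.induction with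
    | _ i ih =>
      by_cases hi : i ∈ crit
      · exact ⟨0, Submodule.mem_sup_right (Submodule.subset_span ⟨i, hi, rfl⟩)⟩
      · obtain ⟨k, hk⟩ := hspan _ ih _ (hlow i hi)
        exact ⟨k + 1, by rw [pow_succ, Module.End.mul_apply]; exact hk⟩
  obtain ⟨k, hk⟩ := hspan Set.univ (fun i _ => hgen i) v (by rw [Set.image_univ, hx]; trivial)
  have hcycle : ∀ k, d ((T ^ k) v) = 0 ∧ v + (T ^ k) v ∈ S := by
    intro k
    induction k with
    | zero =>
      rw [pow_zero, Module.End.one_apply, ZModModule.add_self]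
      exact ⟨hv, S.zero_mem⟩
    | succ k ih =>
      rw [pow_succ', Module.End.mul_apply, hT, ih.1, map_zero, add_zero, map_add, hd, ih.1]
      exact ⟨add_zero _, by rw [← add_assoc]; exact S.add_mem ih.2 (hrange _)⟩
  have := S.add_mem (hcycle k).2 hk
  rwa [add_assoc, ZModModule.add_self, add_zero] at this

namespace PosBraid

/-- The positive braids in the letters `σ k` with `i ≤ k`. -/
def above (i : ℕ) : Submonoid PosBraid := Submonoid.closure (σ '' {k | i ≤ k})

lemma σ_mem_above {i k : ℕ} (h : i ≤ k) : σ k ∈ above i := Submonoid.subset_closure ⟨k, h, rfl⟩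

lemma braidDown_mem_above {i j k : ℕ} (h : i ≤ j) : braidDown σ j k ∈ above i :=
  braidDown_mem _ _ _ _ fun _ h₁ _ => σ_mem_above (h.trans h₁)

lemma braidDelta_mem_above {i j n : ℕ} (h : i ≤ j) : braidDelta σ j n ∈ above i :=
  braidDelta_mem _ _ _ _ fun _ h₁ _ => σ_mem_above (h.trans h₁)

lemma σ_mul_of_mem_above {s i : ℕ} (hs : s + 2 ≤ i) {y : PosBraid} (hy : y ∈ above i) :
    σ s * y = y * σ s := by
  have : above i ≤ Submonoid.centralizer {σ s} := by
    rw [above, Submonoid.closure_le]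
    rintro _ ⟨k, hk, rfl⟩ _ rfl
    exact isBraidFamily_σ.comm _ _ (le_trans hs hk)
  exact this hy _ rfl

lemma braidDown_mul_of_mem_above {j k i : ℕ} (hs : j + k + 1 ≤ i) {y : PosBraid}
    (hy : y ∈ above i) : braidDown σ j k * y = y * braidDown σ j k := by
  have := braidDown_mem σ (Submonoid.centralizer {y}) j k fun l _ h₂ => by
    rintro _ rfl
    exact (σ_mul_of_mem_above (by omega) hy).symm
  exact (this y rfl).symm

lemma eq_mul_σ_of_mul_mem_above {s i : ℕ} (hs : s + 2 ≤ i) {y : PosBraid} (hy : y ∈ above i)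
    {m z : PosBraid} (h : m * y = z * σ s) : ∃ u, m = u * σ s := by
  induction hy using Submonoid.closure_induction_right generalizing z with
  | one => exact ⟨z, by rwa [mul_one] at h⟩
  | mul_right y _ t ht ih =>
    obtain ⟨t, ht, rfl⟩ := ht
    rw [← mul_assoc] at h
    obtain ⟨u, hu, -⟩ := exists_of_far (Or.inr (le_trans hs ht)) h
    exact ih hu

lemma eq_mul_braidDown_of_mul_mem_above {j k i : ℕ} (hs : j + k + 1 ≤ i) {y : PosBraid}
    (hy : y ∈ above i) {m z : PosBraid} (h : m * y = z * braidDown σ j k) :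
    ∃ u, m = u * braidDown σ j k := by
  induction k generalizing j m with
  | zero => exact ⟨m, by simp⟩
  | succ k ih =>
    rw [braidDown_succ', ← mul_assoc] at h
    obtain ⟨u, rfl⟩ := eq_mul_σ_of_mul_mem_above (by omega) hy h
    rw [mul_assoc, σ_mul_of_mem_above (by omega) hy, ← mul_assoc] at h
    obtain ⟨v, rfl⟩ := ih (by omega) (mul_right_cancel h)
    exact ⟨v, by rw [braidDown_succ', mul_assoc]⟩

lemma eq_mul_braidDown_of_mul_braidDown {j k : ℕ} {m z : PosBraid}
    (h : m * braidDown σ (j + 1) k = z * σ j) : ∃ u, m = u * braidDown σ j (k + 1) := by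
  induction k generalizing j m z with
  | zero => exact ⟨z, by simpa using h⟩
  | succ k ih =>
    rw [braidDown_succ', ← mul_assoc] at h
    obtain ⟨u, hu, -⟩ := exists_of_adj (Or.inr rfl) h
    obtain ⟨v, rfl⟩ := eq_mul_σ_of_mul_mem_above (i := j + 2) le_rfl (braidDown_mem_above le_rfl) hu
    rw [mul_assoc, σ_mul_of_mem_above (i := j + 2) le_rfl (braidDown_mem_above le_rfl),
      ← mul_assoc] at hu
    obtain ⟨x, rfl⟩ := ih (mul_right_cancel hu)
    exact ⟨x, by rw [braidDown_succ' _ j (k + 1), mul_assoc]⟩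

lemma exists_braidDelta_eq_mul_σ (j n : ℕ) : ∃ u, braidDelta σ j (n + 2) = u * σ j := by
  refine ⟨braidTop σ j 2 n * braidDelta σ (j + 2) n, ?_⟩
  have h := isBraidFamily_σ.braidTop_mul_braidDelta j 2 n
  rw [add_comm n 2, ← h, mul_assoc,
    ← σ_mul_of_mem_above (i := j + 2) le_rfl (braidDelta_mem_above le_rfl)]
  simp [braidDelta]

lemma eq_mul_braidDown_of_mul_braidTop {j a b : ℕ} {m z : PosBraid}
    (h : m * braidTop σ (j + 1) (a + 1) b = z * braidDown σ j (a + 1)) :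
    ∃ u, m = u * braidDown σ j (a + 1 + b) := by
  obtain ⟨u, hu⟩ := exists_braidDelta_eq_mul_σ j a
  have h₁ : m * braidDelta σ (j + 1) (a + 1 + b) =
      (z * u * braidDelta σ (j + 1 + (a + 1)) b) * σ j := by
    rw [← isBraidFamily_σ.braidTop_mul_braidDelta, ← mul_assoc, h,
      mul_assoc _ _ (σ j), ← σ_mul_of_mem_above (i := j + 2) le_rfl
        (braidDelta_mem_above (by omega)), mul_assoc z u, ← mul_assoc u, ← hu, mul_assoc,
      ← mul_assoc (braidDown _ _ _)]
    rfl
  rw [show a + 1 + b = a + b + 1 by ring] at h₁ ⊢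
  rw [braidDelta, ← mul_assoc] at h₁
  obtain ⟨v, hv⟩ := eq_mul_σ_of_mul_mem_above (i := j + 2) le_rfl
    (braidDelta_mem_above le_rfl) h₁
  exact eq_mul_braidDown_of_mul_braidDown hv

lemma len_braidDown (j k : ℕ) : len (braidDown σ j k) = k := by
  induction k with
  | zero => simp
  | succ k ih => rw [braidDown_succ, len_mul, ih, len_σ, add_comm]

lemma len_braidTop (j a b : ℕ) : len (braidTop σ j a b) = a * b := by
  induction a with
  | zero => simp
  | succ k ih => rw [braidTop_succ, len_mul, ih, len_braidDown, add_mul, one_mul]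

end PosBraid

namespace PosBraid

open MonoidAlgebra Finset

/-- The mod 2 monoid algebra of positive braids. -/
abbrev Alg : Type := MonoidAlgebra (ZMod 2) PosBraid

/-- The generators of the monoid algebra. -/
noncomputable def gen (i : ℕ) : Alg := of (ZMod 2) PosBraid (σ i)

lemma isBraidFamily_gen : IsBraidFamily gen := isBraidFamily_σ.map (of (ZMod 2) PosBraid)

/-- Span of the positive braids in a given set. -/
noncomputable def spanOf (s : Set PosBraid) : Submodule (ZMod 2) Alg :=
  Submodule.span (ZMod 2) (of (ZMod 2) PosBraid '' s)

lemma of_mem_spanOf {s : Set PosBraid} {m : PosBraid} (h : m ∈ s) :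
    of (ZMod 2) PosBraid m ∈ spanOf s := Submodule.subset_span ⟨m, h, rfl⟩

lemma spanOf_mono {s t : Set PosBraid} (h : s ⊆ t) : spanOf s ≤ spanOf t :=
  Submodule.span_mono (Set.image_mono h)

lemma mul_mem_spanOf {s t u : Set PosBraid} (h : ∀ x ∈ s, ∀ y ∈ t, x * y ∈ u) {a b : Alg}
    (ha : a ∈ spanOf s) (hb : b ∈ spanOf t) : a * b ∈ spanOf u := by
  induction ha using Submodule.span_induction with
  | zero => rw [zero_mul]; exact Submodule.zero_mem _
  | add x y _ _ hx hy => rw [add_mul]; exact Submodule.add_mem _ hx hy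
  | smul c x _ hx => rw [smul_mul_assoc]; exact Submodule.smul_mem _ _ hx
  | mem x hx =>
    obtain ⟨x, hx, rfl⟩ := hx
    induction hb using Submodule.span_induction with
    | zero => rw [mul_zero]; exact Submodule.zero_mem _
    | add x y _ _ hx hy => rw [mul_add]; exact Submodule.add_mem _ hx hy
    | smul c x _ hx => rw [mul_smul_comm]; exact Submodule.smul_mem _ _ hx
    | mem y hy =>
      obtain ⟨y, hy, rfl⟩ := hy
      rw [← map_mul]
      exact of_mem_spanOf (h x hx y hy)

/-- The span of a submonoid of positive braids is a subsemiring. -/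
noncomputable def spanSubsemiring (M : Submonoid PosBraid) : Subsemiring Alg where
  carrier := spanOf M
  mul_mem' ha hb := mul_mem_spanOf (fun _ hx _ hy => mul_mem hx hy) ha hb
  one_mem' := by
    rw [← map_one (of (ZMod 2) PosBraid)]
    exact of_mem_spanOf (one_mem _)
  add_mem' ha hb := Submodule.add_mem _ ha hb
  zero_mem' := Submodule.zero_mem _

lemma mem_spanOf_of_mem_closure {i : ℕ} {c : Alg}
    (hc : c ∈ Subsemiring.closure (gen '' {k | i ≤ k})) : c ∈ spanOf (above i) := by
  have : Subsemiring.closure (gen '' {k | i ≤ k}) ≤ spanSubsemiring (above i) := by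
    rw [Subsemiring.closure_le]
    rintro _ ⟨k, hk, rfl⟩
    exact of_mem_spanOf (σ_mem_above hk)
  exact this hc

/-- Span of the positive braids of length less than `L`. -/
noncomputable def spanLT (L : ℕ) : Submodule (ZMod 2) Alg := spanOf {m | len m < L}

lemma mul_of_mem_spanLT {L : ℕ} {a : Alg} (ha : a ∈ spanLT L) (m : PosBraid) :
    a * of (ZMod 2) PosBraid m ∈ spanLT (L + len m) :=
  mul_mem_spanOf (t := {m}) (fun x hx y hy => by
    simp only [Set.mem_singleton_iff, Set.mem_ofPred_eq, len_mul] at hx hy ⊢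
    subst hy; omega) ha (of_mem_spanOf rfl)

lemma braidDown_gen (j k : ℕ) : braidDown gen j k = of (ZMod 2) PosBraid (braidDown σ j k) :=
  (map_braidDown (of (ZMod 2) PosBraid) σ j k).symm

lemma spanLT_mono {K L : ℕ} (h : K ≤ L) : spanLT K ≤ spanLT L :=
  spanOf_mono fun _ hm => lt_of_lt_of_le hm h

lemma mem_spanLT_of_add_braidTop_mem {j a b : ℕ} {r : Alg}
    (h : r + of (ZMod 2) PosBraid (braidTop σ j a b) ∈ spanLT (a * b)) :
    r ∈ spanLT (a * b + 1) := by
  have h₁ := Submodule.add_mem _ (spanLT_mono (Nat.le_succ _) h)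
    (of_mem_spanOf (s := {m | len m < a * b + 1}) (m := braidTop σ j a b) (by
      simp [len_braidTop]))
  rwa [add_assoc, ZModModule.add_self, add_zero] at h₁

lemma braidShuffle_add_braidTop_mem (j a b : ℕ) :
    braidShuffle gen j a b + of (ZMod 2) PosBraid (braidTop σ j a b) ∈ spanLT (a * b) := by
  induction a generalizing b with
  | zero =>
    rw [braidShuffle_zero_left, braidTop_zero_left, map_one, ZModModule.add_self]
    exact Submodule.zero_mem _
  | succ a iha =>
    induction b with
    | zero =>
      have : ∀ a, braidTop σ j a 0 = 1 := by
        intro a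
        induction a with
        | zero => simp
        | succ a ih => rw [braidTop_succ, ih, braidDown_zero, mul_one]
      rw [braidShuffle_zero_right, this, map_one, ZModModule.add_self]
      exact Submodule.zero_mem _
    | succ b ihb =>
      rw [braidShuffle_succ_succ, braidTop_succ, map_mul, braidDown_gen, add_assoc, ← add_mul]
      refine Submodule.add_mem _ (spanLT_mono ?_ (mem_spanLT_of_add_braidTop_mem ihb))
        (spanLT_mono ?_ (mul_of_mem_spanLT (iha (b + 1)) _))
      · rw [mul_add_one]; omega
      · rw [len_braidDown, add_one_mul]

/-- The generator of the complex given by a positive braid and a composition. -/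
noncomputable def cell (m : PosBraid) (w : List ℕ) : List ℕ →₀ Alg :=
  Finsupp.single w (of (ZMod 2) PosBraid m)

/-- Prepending a block, as a linear map. -/
noncomputable def consMap (a : ℕ) : (List ℕ →₀ Alg) →ₗ[ZMod 2] (List ℕ →₀ Alg) :=
  Finsupp.lmapDomain Alg (ZMod 2) (a :: ·)

@[simp] lemma consMap_cell (a : ℕ) (m : PosBraid) (w : List ℕ) :
    consMap a (cell m w) = cell m (a :: w) := by
  simp [consMap, cell]

lemma consMap_apply (a : ℕ) (v : List ℕ →₀ Alg) : consMap a v = v.mapDomain (a :: ·) := rfl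

lemma smul_cell (m m' : PosBraid) (w : List ℕ) :
    of (ZMod 2) PosBraid m • cell m' w = cell (m * m') w := by
  simp [cell]

lemma smul_consMap (a : ℕ) (r : Alg) (v : List ℕ →₀ Alg) :
    r • consMap a v = consMap a (r • v) := by
  simp [consMap_apply, Finsupp.mapDomain_smul]

lemma single_mem_span {s : Set PosBraid} {r : Alg} (hr : r ∈ spanOf s) (w : List ℕ) :
    Finsupp.single w r ∈ Submodule.span (ZMod 2) {v | ∃ m ∈ s, v = cell m w} := by
  induction hr using Submodule.span_induction with
  | zero => rw [Finsupp.single_zero]; exact Submodule.zero_mem _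
  | add x y _ _ hx hy => rw [Finsupp.single_add]; exact Submodule.add_mem _ hx hy
  | smul c x _ hx => rw [← Finsupp.smul_single]; exact Submodule.smul_mem _ _ hx
  | mem x hx =>
    obtain ⟨x, hx, rfl⟩ := hx
    exact Submodule.subset_span ⟨x, hx, rfl⟩

lemma mem_span_of_forall_mem {s : Set PosBraid} {u : List ℕ →₀ Alg}
    (hu : ∀ w, u w ∈ spanOf s) :
    u ∈ Submodule.span (ZMod 2) {v | ∃ m ∈ s, ∃ w, v = cell m w} := by
  rw [← Finsupp.sum_single u]
  refine Submodule.sum_mem _ fun w _ => Submodule.span_mono ?_ (single_mem_span (hu w) w)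
  rintro _ ⟨m, hm, rfl⟩
  exact ⟨m, hm, w, rfl⟩

lemma span_range_cell :
    Submodule.span (ZMod 2) (Set.range fun p : PosBraid × List ℕ => cell p.1 p.2) = ⊤ := by
  rw [eq_top_iff]
  intro u _
  refine Submodule.span_mono ?_ (mem_span_of_forall_mem (s := Set.univ) fun w => ?_)
  · rintro _ ⟨m, -, w, rfl⟩
    exact ⟨(m, w), rfl⟩
  · induction u w using MonoidAlgebra.induction_linear with
    | zero => exact Submodule.zero_mem _
    | add x y hx hy => exact Submodule.add_mem _ hx hy
    | single m r =>
      have := Submodule.smul_mem _ r (of_mem_spanOf (s := Set.univ) (m := m) trivial)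
      simpa using this

/-- The triangular numbers. -/
def triangle : ℕ → ℕ
  | 0 => 0
  | a + 1 => triangle a + (a + 1)

lemma triangle_add (a b : ℕ) :
    triangle (a + b + 1) = triangle a + triangle b + (a + 1) * (b + 1) := by
  induction b with
  | zero => simp [triangle]
  | succ b ih =>
    rw [← add_assoc, triangle, ih, triangle]
    ring

/-- The length of the product of half twists of the blocks of a composition. -/
def weight (w : List ℕ) : ℕ := (w.map triangle).sum

@[simp] lemma weight_cons (a : ℕ) (w : List ℕ) : weight (a :: w) = triangle a + weight w := by
  simp [weight]

/-- The filtration of the complex by total length. -/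
noncomputable def fil (N : ℕ) : Submodule (ZMod 2) (List ℕ →₀ Alg) :=
  Submodule.span (ZMod 2)
    ((fun p : PosBraid × List ℕ => cell p.1 p.2) '' {p | len p.1 + weight p.2 < N})

lemma cell_mem_fil {N : ℕ} {m : PosBraid} {w : List ℕ} (h : len m + weight w < N) :
    cell m w ∈ fil N := Submodule.subset_span ⟨(m, w), h, rfl⟩

lemma fil_le {N : ℕ} {S : Submodule (ZMod 2) (List ℕ →₀ Alg)}
    (h : ∀ m w, len m + weight w < N → cell m w ∈ S) : fil N ≤ S := by
  rw [fil, Submodule.span_le]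
  rintro _ ⟨⟨m, w⟩, hp, rfl⟩
  exact h m w hp

lemma single_mul_mem_fil {L N : ℕ} {m : PosBraid} {r : Alg} {w : List ℕ} (hr : r ∈ spanLT L)
    (h : len m + L + weight w ≤ N) :
    Finsupp.single w (of (ZMod 2) PosBraid m * r) ∈ fil N := by
  refine Submodule.span_le.2 ?_ (single_mem_span (s := {x | len x < len m + L}) (mul_mem_spanOf
    (s := {m}) (fun x hx y hy => ?_) (of_mem_spanOf rfl) hr) w)
  · rintro _ ⟨x, hx, rfl⟩
    simp only [Set.mem_ofPred_eq] at hx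
    exact cell_mem_fil (by omega)
  · simp only [Set.mem_singleton_iff, Set.mem_ofPred_eq, len_mul] at hx hy ⊢
    subst hx; omega

open Classical in
/-- The value of the contracting homotopy on generators. -/
noncomputable def htpyVec : ℕ → PosBraid → List ℕ → List ℕ →₀ Alg
  | j, m, 0 :: b :: w =>
    if h : ∃ z, m = z * braidDown σ j (b + 1) then cell h.choose ((b + 1) :: w)
    else consMap 0 (htpyVec (j + 1) m (b :: w))
  | _, _, _ => 0

/-- The contracting homotopy. -/
noncomputable def htpy (j : ℕ) : (List ℕ →₀ Alg) →ₗ[ZMod 2] (List ℕ →₀ Alg) :=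
  Finsupp.lsum (ZMod 2) fun w => Finsupp.linearCombination (ZMod 2) (fun m => htpyVec j m w) ∘ₗ
    (MonoidAlgebra.coeffLinearEquiv (ZMod 2)).toLinearMap

lemma htpy_cell (j : ℕ) (m : PosBraid) (w : List ℕ) : htpy j (cell m w) = htpyVec j m w := by
  simp [htpy, cell]

lemma htpy_cell_succ (j a : ℕ) (m : PosBraid) (w : List ℕ) : htpy j (cell m ((a + 1) :: w)) = 0 := by
  rw [htpy_cell]
  simp [htpyVec]

lemma htpy_cell_of_mul (j b : ℕ) (m : PosBraid) (w : List ℕ) :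
    htpy j (cell (m * braidDown σ j (b + 1)) (0 :: b :: w)) = cell m ((b + 1) :: w) := by
  have h : ∃ z, m * braidDown σ j (b + 1) = z * braidDown σ j (b + 1) := ⟨m, rfl⟩
  rw [htpy_cell, htpyVec, dif_pos h, mul_right_cancel h.choose_spec.symm]

lemma htpy_cell_of_not {j b : ℕ} {m : PosBraid} {w : List ℕ}
    (h : ¬ ∃ z, m = z * braidDown σ j (b + 1)) :
    htpy j (cell m (0 :: b :: w)) = consMap 0 (htpy (j + 1) (cell m (b :: w))) := by
  rw [htpy_cell, htpyVec, dif_neg h, htpy_cell]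

lemma consMap_mem_fil {N : ℕ} {v : List ℕ →₀ Alg} (hv : v ∈ fil N) : consMap 0 v ∈ fil N := by
  have : fil N ≤ (fil N).comap (consMap 0) := fil_le fun m w h => by
    rw [Submodule.mem_comap, consMap_cell]
    exact cell_mem_fil (by rw [weight_cons, triangle]; omega)
  exact this hv

lemma htpy_mem_fil {j N : ℕ} {v : List ℕ →₀ Alg} (hv : v ∈ fil N) : htpy j v ∈ fil N := by
  suffices h : ∀ w j m, len m + weight w < N → htpy j (cell m w) ∈ fil N by
    have : fil N ≤ (fil N).comap (htpy j) := fil_le fun m w hm => h w j m hm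
    exact this hv
  intro w
  induction w with
  | nil => intro j m _; simp [htpy_cell, htpyVec]
  | cons a w ih =>
    intro j m hm
    match a, w with
    | a + 1, w => rw [htpy_cell_succ]; exact Submodule.zero_mem _
    | 0, [] => simp [htpy_cell, htpyVec]
    | 0, b :: w =>
      by_cases h : ∃ z, m = z * braidDown σ j (b + 1)
      · obtain ⟨z, rfl⟩ := h
        rw [htpy_cell_of_mul]
        refine cell_mem_fil ?_
        simp only [len_mul, len_braidDown, weight_cons, triangle] at hm ⊢
        omega
      · rw [htpy_cell_of_not h]
        refine consMap_mem_fil (ih _ _ ?_)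
        simp only [weight_cons, triangle] at hm ⊢
        omega

end PosBraid

namespace PosBraid

open MonoidAlgebra Finset

/-- The boundary operator of positive braids, as a linear map over `ZMod 2`. -/
noncomputable def bdry (j : ℕ) : (List ℕ →₀ Alg) →ₗ[ZMod 2] (List ℕ →₀ Alg) :=
  (blockD gen j).restrictScalars (ZMod 2)

lemma bdry_cell (j : ℕ) (m : PosBraid) (w : List ℕ) :
    bdry j (cell m w) = of (ZMod 2) PosBraid m • blockBoundary gen j w := by
  rw [cell, bdry, LinearMap.restrictScalars_apply, blockD_single]

lemma bdry_consMap_zero (j : ℕ) (v : List ℕ →₀ Alg) :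
    bdry j (consMap 0 v) = consMap 0 (bdry (j + 1) v) := by
  rw [bdry, LinearMap.restrictScalars_apply, consMap_apply, blockD_cons]
  have : blockSplit gen j 0 = 0 := by ext; simp
  simp [this, consMap_apply, bdry]

lemma bdry_cell_cons (j a : ℕ) (m : PosBraid) (w : List ℕ) :
    bdry j (cell m (a :: w)) = of (ZMod 2) PosBraid m • blockSplit gen j a w +
      consMap a (of (ZMod 2) PosBraid m • blockBoundary gen (j + a + 1) w) := by
  rw [bdry_cell, blockBoundary_cons, smul_add, ← smul_consMap, consMap_apply]

lemma smul_blockSplit_succ (j a : ℕ) (m : PosBraid) (w : List ℕ) :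
    of (ZMod 2) PosBraid m • blockSplit gen j (a + 1) w = ∑ p ∈ antidiagonal a,
      Finsupp.single (p.1 :: p.2 :: w)
        (of (ZMod 2) PosBraid m * braidShuffle gen j (p.1 + 1) (p.2 + 1)) := by
  rw [blockSplit_succ, Finset.smul_sum]
  simp

lemma single_mul_braidShuffle_add_cell_mem {j a b : ℕ} {m : PosBraid} {w : List ℕ} :
    Finsupp.single w (of (ZMod 2) PosBraid m * braidShuffle gen j a b) +
      cell (m * braidTop σ j a b) w ∈ fil (len m + a * b + weight w) := by
  rw [cell, map_mul, ← Finsupp.single_add, ← mul_add]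
  exact single_mul_mem_fil (braidShuffle_add_braidTop_mem j a b) le_rfl

/-- Left multiplication by a positive braid. -/
noncomputable def mulMap (m : PosBraid) : (List ℕ →₀ Alg) →ₗ[ZMod 2] (List ℕ →₀ Alg) :=
  DistribSMul.toLinearMap (ZMod 2) _ (of (ZMod 2) PosBraid m)

lemma mulMap_apply (m : PosBraid) (v : List ℕ →₀ Alg) :
    mulMap m v = of (ZMod 2) PosBraid m • v := rfl

@[simp] lemma mulMap_cell (m m' : PosBraid) (w : List ℕ) :
    mulMap m (cell m' w) = cell (m * m') w := smul_cell m m' w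

/-- A linear map that vanishes on all generators in high letters vanishes on boundaries in high
letters. -/
lemma map_blockBoundary_eq_zero {V : Type*} [AddCommGroup V] [Module (ZMod 2) V]
    (L : (List ℕ →₀ Alg) →ₗ[ZMod 2] V) {i : ℕ} {w : List ℕ}
    (h : ∀ y ∈ above i, ∀ w', L (cell y w') = 0) : L (blockBoundary gen i w) = 0 := by
  have hu : ∀ w', blockBoundary gen i w w' ∈ spanOf (above i) := fun w' =>
    mem_spanOf_of_mem_closure (blockBoundary_apply_mem gen _ _ _ _ fun k hk _ =>
      Subsemiring.subset_closure ⟨k, hk, rfl⟩)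
  have hle : Submodule.span (ZMod 2) {v | ∃ m ∈ above i, ∃ w, v = cell m w} ≤ LinearMap.ker L := by
    rw [Submodule.span_le]
    rintro _ ⟨y, hy, w', rfl⟩
    exact h y hy w'
  exact hle (mem_span_of_forall_mem hu)

/-- The critical generators: all blocks have size one, and the braid is not right divisible by
the generators acting on these blocks. -/
def critical (j : ℕ) : Set (PosBraid × List ℕ) :=
  {p | (∀ a ∈ p.2, a = 0) ∧ ∀ i, j ≤ i → i + 1 < j + p.2.length → ¬ ∃ z, p.1 = z * σ i}

lemma bdry_of_critical {j : ℕ} {p : PosBraid × List ℕ} (hp : p ∈ critical j) :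
    bdry j (cell p.1 p.2) = 0 := by
  obtain ⟨m, w⟩ := p
  have h₀ : ∀ a ∈ w, a = 0 := hp.1
  rw [bdry_cell]
  have : blockBoundary gen j w = 0 := by
    clear hp
    induction w generalizing j with
    | nil => simp
    | cons a w ih =>
      obtain rfl : a = 0 := h₀ a (by simp)
      rw [blockBoundary_cons, ih fun a ha => h₀ a (by simp [ha])]
      simp
  rw [this, smul_zero]

theorem cell_add_htpy_mem_of_succ (j a : ℕ) (m : PosBraid) (w : List ℕ) :
    cell m ((a + 1) :: w) + bdry j (htpy j (cell m ((a + 1) :: w))) +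
      htpy j (bdry j (cell m ((a + 1) :: w))) ∈ fil (len m + weight ((a + 1) :: w)) := by
  have hz : ∀ b, htpy j ∘ₗ consMap (b + 1) = 0 := by
    intro b
    refine LinearMap.ext_on_range span_range_cell fun p => ?_
    simp [htpy_cell_succ]
  have hz' : ∀ b v, htpy j (consMap (b + 1) v) = 0 := fun b v => LinearMap.congr_fun (hz b) v
  have hs : ∀ b w r, htpy j (Finsupp.single ((b + 1) :: w) r) = 0 := by
    intro b w r
    have := hz' b (Finsupp.single w r)
    rwa [consMap_apply, Finsupp.mapDomain_single] at this
  rw [htpy_cell_succ, map_zero, add_zero, bdry_cell_cons, map_add, hz', add_zero,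
    smul_blockSplit_succ, map_sum, Finset.sum_eq_single (0, a)]
  · have h := htpy_mem_fil (j := j) (single_mul_braidShuffle_add_cell_mem (j := j) (a := 1)
      (b := a + 1) (m := m) (w := 0 :: a :: w))
    rw [map_add, braidTop_one, htpy_cell_of_mul, add_comm (htpy _ _)] at h
    convert h using 2
    simp only [weight_cons, triangle]
    ring
  · rintro ⟨b, c⟩ hp hne
    cases b with
    | zero =>
      simp only [HasAntidiagonal.mem_antidiagonal, zero_add] at hp
      subst hp; exact absurd rfl hne
    | succ b => exact hs _ _ _
  · intro h
    simp at h

theorem cell_add_htpy_mem_of_mul (j b : ℕ) (m : PosBraid) (w : List ℕ) :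
    cell (m * braidDown σ j (b + 1)) (0 :: b :: w) +
      bdry j (htpy j (cell (m * braidDown σ j (b + 1)) (0 :: b :: w))) +
      htpy j (bdry j (cell (m * braidDown σ j (b + 1)) (0 :: b :: w))) ∈
      fil (len (m * braidDown σ j (b + 1)) + weight (0 :: b :: w)) := by
  set N := len (m * braidDown σ j (b + 1)) + weight (0 :: b :: w) with hN
  have tail : consMap (b + 1) (of (ZMod 2) PosBraid m • blockBoundary gen (j + (b + 1) + 1) w) +
      htpy j (consMap 0 (consMap b (of (ZMod 2) PosBraid (m * braidDown σ j (b + 1)) •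
        blockBoundary gen (j + (b + 1) + 1) w))) = 0 := by
    rw [← mulMap_apply, ← mulMap_apply]
    refine map_blockBoundary_eq_zero (consMap (b + 1) ∘ₗ mulMap m + htpy j ∘ₗ consMap 0 ∘ₗ
      consMap b ∘ₗ mulMap (m * braidDown σ j (b + 1))) fun y hy w' => ?_
    simp only [LinearMap.add_apply, LinearMap.comp_apply, mulMap_cell, consMap_cell]
    rw [mul_assoc, braidDown_mul_of_mem_above le_rfl hy, ← mul_assoc, htpy_cell_of_mul,
      ZModModule.add_self]
  have head : cell (m * braidDown σ j (b + 1)) (0 :: b :: w) +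
      Finsupp.single (0 :: b :: w)
        (of (ZMod 2) PosBraid m * braidShuffle gen j (0 + 1) (b + 1)) ∈ fil N := by
    have h := single_mul_braidShuffle_add_cell_mem (j := j) (a := 1)
      (b := b + 1) (m := m) (w := 0 :: b :: w)
    rw [braidTop_one, add_comm (Finsupp.single _ _)] at h
    convert h using 2
    rw [hN, len_mul, len_braidDown]
    ring
  have split : cell (m * braidDown σ j (b + 1)) (0 :: b :: w) +
      of (ZMod 2) PosBraid m • blockSplit gen j (b + 1) w +
      htpy j (consMap 0 (of (ZMod 2) PosBraid (m * braidDown σ j (b + 1)) •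
        blockSplit gen (j + 1) b w)) ∈ fil N := by
    cases b with
    | zero =>
      rw [smul_blockSplit_succ, blockSplit_zero, smul_zero, map_zero, map_zero, add_zero]
      simpa only [Finset.Nat.antidiagonal_zero, Finset.sum_singleton] using head
    | succ b =>
      rw [smul_blockSplit_succ, smul_blockSplit_succ, Finset.Nat.sum_antidiagonal_succ, map_sum,
        map_sum, ← add_assoc, add_assoc _ (Finset.sum _ _), ← Finset.sum_add_distrib]
      refine Submodule.add_mem _ head (Submodule.sum_mem _ fun q hq => ?_)
      rw [HasAntidiagonal.mem_antidiagonal] at hq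
      have h₁ := single_mul_braidShuffle_add_cell_mem (j := j) (a := q.1 + 1 + 1)
        (b := q.2 + 1) (m := m) (w := (q.1 + 1) :: q.2 :: w)
      have h₂ := htpy_mem_fil (j := j) (single_mul_braidShuffle_add_cell_mem (j := j + 1)
        (a := q.1 + 1) (b := q.2 + 1) (m := m * braidDown σ j (b + 1 + 1))
        (w := 0 :: q.1 :: q.2 :: w))
      have e : m * braidDown σ j (b + 1 + 1) * braidTop σ (j + 1) (q.1 + 1) (q.2 + 1) =
          m * braidTop σ j (q.1 + 1 + 1) (q.2 + 1) * braidDown σ j (q.1 + 1) := by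
        rw [show b + 1 + 1 = q.1 + 1 + (q.2 + 1) by omega, mul_assoc,
          isBraidFamily_σ.braidDown_mul_braidTop_eq, mul_assoc]
      rw [map_add, e, htpy_cell_of_mul] at h₂
      have t₁ : len m + (q.1 + 1 + 1) * (q.2 + 1) + weight ((q.1 + 1) :: q.2 :: w) = N := by
        have := triangle_add (q.1 + 1) q.2
        rw [hN, len_mul, len_braidDown]
        simp only [weight_cons, triangle] at this ⊢
        rw [← hq]
        rw [show q.1 + 1 + q.2 = q.1 + q.2 + 1 by ring, triangle] at this
        omega
      have t₂ : len (m * braidDown σ j (b + 1 + 1)) + (q.1 + 1) * (q.2 + 1) +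
          weight (0 :: q.1 :: q.2 :: w) = N := by
        have := triangle_add q.1 q.2
        rw [hN, len_mul, len_braidDown]
        simp only [weight_cons]
        rw [← hq]
        omega
      rw [t₁] at h₁
      rw [t₂] at h₂
      have h₃ := Submodule.add_mem _ h₁ h₂
      rw [add_add_add_comm, ZModModule.add_self, add_zero] at h₃
      convert h₃ using 3
      rw [consMap_apply, Finsupp.mapDomain_single]
  rw [htpy_cell_of_mul, bdry_cell_cons, ← consMap_cell 0, bdry_consMap_zero, bdry_cell_cons,
    map_add, map_add, show j + 1 + b + 1 = j + (b + 1) + 1 by ring]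
  rw [← consMap_cell 0] at split
  convert split using 1
  rw [← add_zero (_ + _ + htpy _ _), ← tail]
  abel

theorem cell_add_htpy_mem_of_not {j b : ℕ} {m : PosBraid} {w : List ℕ}
    (hm : ¬ ∃ z, m = z * braidDown σ j (b + 1))
    (ih : cell m (b :: w) + bdry (j + 1) (htpy (j + 1) (cell m (b :: w))) +
      htpy (j + 1) (bdry (j + 1) (cell m (b :: w))) ∈ fil (len m + weight (b :: w))) :
    cell m (0 :: b :: w) + bdry j (htpy j (cell m (0 :: b :: w))) +
      htpy j (bdry j (cell m (0 :: b :: w))) ∈ fil (len m + weight (0 :: b :: w)) := by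
  obtain ⟨L, hL⟩ : ∃ L : (List ℕ →₀ Alg) →ₗ[ZMod 2] (List ℕ →₀ Alg),
      ∀ v, L v = htpy j (consMap 0 v) + consMap 0 (htpy (j + 1) v) :=
    ⟨htpy j ∘ₗ consMap 0 + consMap 0 ∘ₗ htpy (j + 1), fun v => rfl⟩
  have hLfil : ∀ {N v}, v ∈ fil N → L v ∈ fil N := by
    intro N v hv
    rw [hL]
    exact Submodule.add_mem _ (htpy_mem_fil (consMap_mem_fil hv))
      (consMap_mem_fil (htpy_mem_fil hv))
  have hLcell : ∀ {m a w}, (¬ ∃ z, m = z * braidDown σ j (a + 1)) → L (cell m (a :: w)) = 0 := by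
    intro m a w h
    rw [hL, consMap_cell, htpy_cell_of_not h, ZModModule.add_self]
  have key : L (bdry (j + 1) (cell m (b :: w))) ∈ fil (len m + weight (b :: w)) := by
    rw [bdry_cell_cons, map_add]
    refine Submodule.add_mem _ ?_ ?_
    · cases b with
      | zero => simp
      | succ b =>
        rw [smul_blockSplit_succ, map_sum]
        refine Submodule.sum_mem _ fun q hq => ?_
        rw [HasAntidiagonal.mem_antidiagonal] at hq
        have h := hLfil (single_mul_braidShuffle_add_cell_mem (j := j + 1) (a := q.1 + 1)
          (b := q.2 + 1) (m := m) (w := q.1 :: q.2 :: w))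
        rw [map_add, hLcell, add_zero] at h
        · convert h using 2
          have := triangle_add q.1 q.2
          simp only [weight_cons]
          rw [← hq]
          omega
        · rintro ⟨z, hz⟩
          obtain ⟨u, hu⟩ := eq_mul_braidDown_of_mul_braidTop hz
          exact hm ⟨u, by rw [hu, ← hq]; congr 2; ring⟩
    · have : L (consMap b (mulMap m (blockBoundary gen (j + 1 + b + 1) w))) = 0 := by
        refine map_blockBoundary_eq_zero (L ∘ₗ consMap b ∘ₗ mulMap m) fun y hy w' => ?_
        rw [LinearMap.comp_apply, LinearMap.comp_apply, mulMap_cell, consMap_cell, hLcell]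
        rintro ⟨z, hz⟩
        exact hm (eq_mul_braidDown_of_mul_mem_above (by omega) hy hz)
      rw [← mulMap_apply, this]
      exact Submodule.zero_mem _
  have h := Submodule.add_mem _ (consMap_mem_fil ih) key
  rw [hL, map_add, map_add, ← bdry_consMap_zero, consMap_cell, ← htpy_cell_of_not hm,
    ← bdry_consMap_zero, consMap_cell] at h
  have e : weight (0 :: b :: w) = weight (b :: w) := by simp [triangle]
  rw [e]
  convert h using 1
  rw [add_assoc, add_assoc, add_assoc, add_comm (htpy j (bdry _ _)), ← add_assoc (consMap 0 _),
    ZModModule.add_self, zero_add]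

theorem cell_add_htpy_mem (j : ℕ) (m : PosBraid) (w : List ℕ) (h : (m, w) ∉ critical j) :
    cell m w + bdry j (htpy j (cell m w)) + htpy j (bdry j (cell m w)) ∈
      fil (len m + weight w) := by
  induction w generalizing j with
  | nil => exact absurd ⟨by simp, by intros; simp at *; omega⟩ h
  | cons a w ih =>
    match a, w with
    | a + 1, w => exact cell_add_htpy_mem_of_succ j a m w
    | 0, [] => exact absurd ⟨by simp, by intros; simp at *; omega⟩ h
    | 0, b :: w =>
      by_cases hm : ∃ z, m = z * braidDown σ j (b + 1)
      · obtain ⟨z, rfl⟩ := hm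
        exact cell_add_htpy_mem_of_mul j b z w
      · refine cell_add_htpy_mem_of_not hm (ih (j + 1) fun hc => h ⟨?_, ?_⟩)
        · intro a ha
          rcases List.mem_cons.1 ha with rfl | ha
          · rfl
          · exact hc.1 a ha
        · intro i hi hi' hz
          rcases hi.eq_or_lt with rfl | hi
          · obtain rfl : b = 0 := hc.1 b (by simp)
            exact hm (by simpa using hz)
          · refine hc.2 i hi ?_ hz
            simp only [List.length_cons] at hi' ⊢
            omega

theorem mem_range_bdry_sup_span_critical {j : ℕ} {v : List ℕ →₀ Alg} (hv : bdry j v = 0) :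
    v ∈ LinearMap.range (bdry j) ⊔ Submodule.span (ZMod 2)
      ((fun p : PosBraid × List ℕ => cell p.1 p.2) '' critical j) :=
  mem_range_sup_span_of_homotopy (h := htpy j)
    (fun v => isBraidFamily_gen.blockD_blockD j v) span_range_cell
    (lt := fun p q => len p.1 + weight p.2 < len q.1 + weight q.2) (measure _).wf
    (fun _ hp => bdry_of_critical hp) (fun p hp => cell_add_htpy_mem j p.1 p.2 hp) hv

end PosBraid

namespace PosBraid

/-- Positive braids in the first `k` generators. -/
def below (k : ℕ) : Submonoid PosBraid := Submonoid.closure (σ '' {i | i < k})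

lemma σ_mem_below {i k : ℕ} (h : i < k) : σ i ∈ below k := Submonoid.subset_closure ⟨i, h, rfl⟩

lemma braidDown_pow_mul_σ {i k : ℕ} (h : i < k) :
    braidDown σ 0 k ^ i * σ i = σ 0 * braidDown σ 0 k ^ i := by
  induction i with
  | zero => simp
  | succ i ih =>
    rw [pow_succ, mul_assoc, isBraidFamily_σ.braidDown_mul (Nat.zero_le _) (by omega), ← mul_assoc,
      ih (by omega), mul_assoc]

lemma braidDown_pow_mul_σ_last {i k : ℕ} :
    braidDown σ 0 (i + k + 1) ^ k * σ (i + k) = σ i * braidDown σ 0 (i + k + 1) ^ k := by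
  have : ∀ l ≤ k, braidDown σ 0 (i + k + 1) ^ l * σ (i + l) =
      σ i * braidDown σ 0 (i + k + 1) ^ l := by
    intro l
    induction l with
    | zero => simp
    | succ l ih =>
      intro hl
      rw [pow_succ, mul_assoc, ← add_assoc,
        isBraidFamily_σ.braidDown_mul (Nat.zero_le _) (by omega), ← mul_assoc,
        ih (by omega), mul_assoc]
  exact this k le_rfl

lemma braidDown_sq_mul_σ_zero (k : ℕ) :
    braidDown σ 0 (k + 1) ^ 2 * σ 0 = σ k * braidDown σ 0 (k + 1) ^ 2 := by
  have h : braidDown σ 0 (k + 1) * braidDown σ 0 (k + 1) =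
      braidDown σ 0 k * braidDown σ 0 (k + 1) * σ 0 := by
    have := isBraidFamily_σ.braidDown_mul_braidDown (i := 0) (j := 0) (k := k + 1) (l := k)
      le_rfl (by omega)
    rw [← this]
    conv_lhs => rw [braidDown_succ' σ 0 k]
    rw [braidDown_succ' σ 0 k]
    simp only [mul_assoc]
  have e : braidDown σ 0 (k + 1) = σ k * braidDown σ 0 k := by rw [braidDown_succ, zero_add]
  rw [sq]
  conv_rhs => rw [h, ← mul_assoc, ← mul_assoc, ← e]

lemma braidDown_pow_commute {i k : ℕ} (h : i < k) :
    Commute (braidDown σ 0 k ^ (k + 1)) (σ i) := by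
  obtain ⟨l, rfl⟩ : ∃ l, k = i + l + 1 := ⟨k - i - 1, by omega⟩
  have e : i + l + 1 + 1 = l + (2 + i) := by ring
  rw [commute_iff_eq, e, pow_add, pow_add, mul_assoc, mul_assoc, braidDown_pow_mul_σ h,
    ← mul_assoc (_ ^ 2), braidDown_sq_mul_σ_zero, mul_assoc (σ (i + l)), ← mul_assoc,
    braidDown_pow_mul_σ_last]
  simp only [mul_assoc]

/-- A central element of the monoid of positive braids in the first `k` generators. -/
def twist (k : ℕ) : PosBraid := (braidDown σ 0 k ^ (k + 1)) ^ 2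

lemma twist_commute {i k : ℕ} (h : i < k) : Commute (twist k) (σ i) :=
  (braidDown_pow_commute h).pow_left 2

lemma braidDown_mem_below (k : ℕ) : braidDown σ 0 k ∈ below k :=
  braidDown_mem _ _ _ _ fun _ _ h => σ_mem_below (by omega)

lemma twist_mem_below (k : ℕ) : twist k ∈ below k :=
  pow_mem (pow_mem (braidDown_mem_below k) _) _

lemma exists_mul_σ_eq_twist {i k : ℕ} (h : i < k) : ∃ e ∈ below k, e * σ i = twist k := by
  obtain ⟨l, rfl⟩ : ∃ l, k = i + l + 1 := ⟨k - i - 1, by omega⟩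
  have hd := braidDown_mem_below (i + l + 1)
  have hr : braidDown σ 0 (i + l + 1) = braidDown σ 1 (i + l) * σ 0 := by
    rw [braidDown_succ']
  set d := braidDown σ 0 (i + l + 1) with hdd
  have hm : braidDown σ 1 (i + l) ∈ below (i + l + 1) :=
    braidDown_mem _ _ _ _ fun _ _ h => σ_mem_below (by omega)
  refine ⟨d ^ (i + l + l + 3) * braidDown σ 1 (i + l) * d ^ i,
    mul_mem (mul_mem (pow_mem hd _) hm) (pow_mem hd _), ?_⟩
  rw [mul_assoc, hdd, braidDown_pow_mul_σ h, ← hdd, ← mul_assoc, mul_assoc (d ^ _), ← hr,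
    ← pow_succ, ← pow_add, twist, ← pow_mul, ← hdd]
  congr 1
  ring

lemma exists_mul_eq_twist_pow (m : PosBraid) :
    ∃ K, ∀ k ≥ K, ∃ N c, c * m = twist k ^ N := by
  induction m using induction_right with
  | one => exact ⟨0, fun k _ => ⟨0, 1, by simp⟩⟩
  | mul i m ih =>
    obtain ⟨K, hK⟩ := ih
    refine ⟨max K (i + 1), fun k hk => ?_⟩
    have hi : i < k := lt_of_lt_of_le (Nat.lt_succ_self i) ((le_max_right _ _).trans hk)
    obtain ⟨N, c, hc⟩ := hK k ((le_max_left _ _).trans hk)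
    obtain ⟨e, -, he⟩ := exists_mul_σ_eq_twist hi
    refine ⟨N + 1, e * c, ?_⟩
    rw [mul_assoc, ← mul_assoc c, hc, (twist_commute hi).pow_left N, ← mul_assoc, he, pow_succ']

lemma exists_mul_eq_mul (a b : PosBraid) : ∃ c d, c * a = d * b := by
  obtain ⟨K, hK⟩ := exists_mul_eq_twist_pow a
  obtain ⟨L, hL⟩ := exists_mul_eq_twist_pow b
  obtain ⟨N, c, hc⟩ := hK (max K L) (le_max_left _ _)
  obtain ⟨M, d, hd⟩ := hL (max K L) (le_max_right _ _)
  exact ⟨twist (max K L) ^ M * c, twist (max K L) ^ N * d, by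
    rw [mul_assoc, mul_assoc, hc, hd, ← pow_add, ← pow_add, add_comm]⟩

noncomputable instance : OreLocalization.OreSet (⊤ : Submonoid PosBraid) where
  ore_right_cancel r₁ r₂ s h := ⟨1, by rw [mul_right_cancel h]⟩
  oreNum r s := (exists_mul_eq_mul r s).choose_spec.choose
  oreDenom r s := ⟨(exists_mul_eq_mul r s).choose, Submonoid.mem_top _⟩
  ore_eq r s := (exists_mul_eq_mul r s).choose_spec.choose_spec

/-- The group of fractions of positive braids. -/
abbrev Frac : Type := (OreLocalization (⊤ : Submonoid PosBraid) PosBraid)ˣ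

/-- The embedding of positive braids in their group of fractions. -/
noncomputable def toFrac : PosBraid →* Frac where
  toFun m := OreLocalization.numeratorUnit ⟨m, Submonoid.mem_top m⟩
  map_one' := Units.ext (map_one OreLocalization.numeratorHom)
  map_mul' a b := Units.ext (map_mul OreLocalization.numeratorHom a b)

lemma toFrac_injective : Function.Injective toFrac := by
  intro a b h
  have h' : OreLocalization.oreDiv a (1 : (⊤ : Submonoid PosBraid)) =
    OreLocalization.oreDiv b 1 := congrArg Units.val h
  rw [OreLocalization.oreDiv_eq_iff] at h'
  obtain ⟨u, v, h₁, h₂⟩ := h'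
  have h₃ : (u : PosBraid) = v := by simpa using h₂
  rw [Submonoid.smul_def, h₃] at h₁
  exact (mul_left_cancel h₁).symm

end PosBraid

section GroupComplex

open MonoidAlgebra PosBraid

/-- A family of group elements whose first `n - 1` members satisfy the braid relations and generate
the group, and which maps to the standard generators in the group of fractions of positive
braids. -/
structure IsBraidGenerators {G : Type*} [Group G] (n : ℕ) (s : ℕ → G) : Prop where
  comm : ∀ i j, i + 2 ≤ j → j + 1 < n → s i * s j = s j * s i
  braid : ∀ i, i + 2 < n → s i * s (i + 1) * s i = s (i + 1) * s i * s (i + 1)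
  closure_eq_top : Subgroup.closure (s '' {i | i + 1 < n}) = ⊤
  exists_hom : ∃ κ : G →* Frac, ∀ i, i + 1 < n → κ (s i) = toFrac (σ i)

/-- The generators in the group algebra, extended by zero. -/
noncomputable def groupGen {G : Type*} [Group G] (n : ℕ) (s : ℕ → G) (i : ℕ) :
    MonoidAlgebra (ZMod 2) G :=
  if i + 1 < n then of (ZMod 2) G (s i) else 0

lemma blockD_filter {R : Type*} [Ring R] (f : ℕ → R) (j : ℕ) {p q : List ℕ → Prop}
    [DecidablePred p] [DecidablePred q]
    (h : ∀ w w', w'.sum + 1 = w.sum → w'.length = w.length + 1 → (q w ↔ p w'))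
    (v : List ℕ →₀ R) : (blockD f j v).filter p = blockD f j (v.filter q) := by
  induction v using Finsupp.induction_linear with
  | zero => rw [map_zero, Finsupp.filter_zero, Finsupp.filter_zero, map_zero]
  | add v w hv hw => simp only [map_add, Finsupp.filter_add, hv, hw]
  | single w r =>
    rw [blockD_single]
    by_cases hw : q w
    · rw [Finsupp.filter_single_of_pos _ hw, blockD_single, Finsupp.filter_eq_self_iff]
      intro w' hw'
      obtain ⟨h₁, h₂⟩ := blockBoundary_support f j w w' fun h0 => hw' (by simp [h0])
      exact (h w w' h₁ h₂).1 hw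
    · rw [Finsupp.filter_single_of_neg _ hw, map_zero, Finsupp.filter_eq_zero_iff]
      intro w' hw'
      by_contra h0
      obtain ⟨h₁, h₂⟩ := blockBoundary_support f j w w' fun h0' => h0 (by simp [h0'])
      exact hw ((h w w' h₁ h₂).2 hw')

lemma List.eq_replicate_of_sum_eq_zero {w : List ℕ} (h : w.sum = 0) :
    w = List.replicate w.length 0 :=
  List.eq_replicate_iff.2 ⟨rfl, fun _ ha => List.sum_eq_zero_iff.1 h _ ha⟩

namespace IsBraidGenerators

variable {G : Type*} [Group G] {n : ℕ} {s : ℕ → G}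

lemma isBraidFamily_groupGen (hs : IsBraidGenerators n s) : IsBraidFamily (groupGen n s) where
  comm i j h := by
    unfold groupGen
    by_cases hj : j + 1 < n
    · rw [if_pos hj, if_pos (by omega), ← map_mul, ← map_mul, hs.comm i j h hj]
    · rw [if_neg hj, mul_zero, zero_mul]
  braid i := by
    unfold groupGen
    by_cases hj : i + 1 + 1 < n
    · rw [if_pos hj, if_pos (by omega)]
      simp only [← map_mul]
      rw [hs.braid i hj]
    · rw [if_neg hj, mul_zero, zero_mul, zero_mul]

/-- The homomorphism from the monoid algebra of positive braids to the group algebra. -/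
noncomputable def algMap (hs : IsBraidGenerators n s) : Alg →ₐ[ZMod 2] MonoidAlgebra (ZMod 2) G :=
  MonoidAlgebra.lift (ZMod 2) _ _ (PosBraid.lift _ hs.isBraidFamily_groupGen)

lemma algMap_of_σ (hs : IsBraidGenerators n s) (i : ℕ) :
    hs.algMap (of (ZMod 2) PosBraid (σ i)) = groupGen n s i := by
  simp [algMap]

lemma algMap_gen (hs : IsBraidGenerators n s) : (fun i => hs.algMap (gen i)) = groupGen n s :=
  funext hs.algMap_of_σ

lemma eq_zero_of_algMap_eq_zero (hs : IsBraidGenerators n s) {c : Alg}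
    (hc : c ∈ spanOf (below (n - 1))) (h : hs.algMap c = 0) : c = 0 := by
  obtain ⟨κ, hκ⟩ := hs.exists_hom
  have key : ∀ c ∈ spanOf (below (n - 1)),
      mapDomainAlgHom (ZMod 2) (ZMod 2) κ (hs.algMap c) =
        mapDomainAlgHom (ZMod 2) (ZMod 2) toFrac c := by
    intro c hc
    induction hc using Submodule.span_induction with
    | zero => simp
    | add x y _ _ hx hy => rw [map_add, map_add, map_add, hx, hy]
    | smul a x _ hx => rw [map_smul, map_smul, map_smul, hx]
    | mem x hx =>
      obtain ⟨m, hm, rfl⟩ := hx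
      replace hm : m ∈ below (n - 1) := hm
      induction hm using Submonoid.closure_induction with
      | one => simp only [map_one]
      | mul x y _ _ hx hy => simp only [map_mul, hx, hy]
      | mem x hx =>
        obtain ⟨i, hi, rfl⟩ := hx
        have hi : i < n - 1 := hi
        rw [algMap_of_σ, groupGen, if_pos (by omega)]
        simp [hκ i (by omega)]
  have h' := key c hc
  rw [h, map_zero] at h'
  exact mapDomain_injective toFrac_injective (by simpa using h'.symm)

lemma exists_algMap_of_eq (hs : IsBraidGenerators n s) {m : PosBraid} (hm : m ∈ below (n - 1)) :
    ∃ g, hs.algMap (of (ZMod 2) PosBraid m) = of (ZMod 2) G g := by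
  induction hm using Submonoid.closure_induction with
  | one => exact ⟨1, by simp only [map_one]⟩
  | mul x y _ _ hx hy =>
    obtain ⟨g, hg⟩ := hx
    obtain ⟨k, hk⟩ := hy
    exact ⟨g * k, by simp only [map_mul, hg, hk]⟩
  | mem x hx =>
    obtain ⟨i, hi, rfl⟩ := hx
    have hi : i < n - 1 := hi
    exact ⟨s i, by rw [algMap_of_σ, groupGen, if_pos (by omega)]⟩

/-- The image of the central twist in the group algebra. -/
noncomputable def groupTwist (hs : IsBraidGenerators n s) : MonoidAlgebra (ZMod 2) G :=
  hs.algMap (of (ZMod 2) PosBraid (twist (n - 1)))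

lemma exists_groupTwist_pow_mul_of (hs : IsBraidGenerators n s) (g : G) :
    ∃ N, ∃ m ∈ below (n - 1), hs.groupTwist ^ N * of (ZMod 2) G g =
      hs.algMap (of (ZMod 2) PosBraid m) := by
  have hg : g ∈ Subgroup.closure (s '' {i | i + 1 < n}) := hs.closure_eq_top ▸ Subgroup.mem_top g
  induction hg using Subgroup.closure_induction_right with
  | one => exact ⟨0, 1, one_mem _, by simp only [map_one, pow_zero, mul_one]⟩
  | mul_right x _ y hy ih =>
    obtain ⟨i, hi, rfl⟩ := hy
    have hi : i + 1 < n := hi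
    obtain ⟨N, m, hm, h⟩ := ih
    refine ⟨N, m * σ i, mul_mem hm (σ_mem_below (by omega)), ?_⟩
    rw [map_mul, map_mul, map_mul, ← mul_assoc, h, algMap_of_σ, groupGen, if_pos hi]
  | mul_inv_cancel x _ y hy ih =>
    obtain ⟨i, hi, rfl⟩ := hy
    have hi : i + 1 < n := hi
    obtain ⟨N, m, hm, h⟩ := ih
    obtain ⟨e, he, he'⟩ := exists_mul_σ_eq_twist (i := i) (k := n - 1) (by omega)
    refine ⟨N + 1, m * e, mul_mem hm he, ?_⟩
    have ht : hs.groupTwist * of (ZMod 2) G (s i)⁻¹ = hs.algMap (of (ZMod 2) PosBraid e) := by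
      rw [groupTwist, ← he', map_mul, map_mul, algMap_of_σ, groupGen, if_pos hi, mul_assoc,
        ← map_mul, mul_inv_cancel, map_one, mul_one]
    have hc : Commute hs.groupTwist (of (ZMod 2) G x) := by
      have hx : x ∈ Subgroup.closure (s '' {i | i + 1 < n}) :=
        hs.closure_eq_top ▸ Subgroup.mem_top x
      obtain ⟨t, ht⟩ := hs.exists_algMap_of_eq (twist_mem_below (n - 1))
      have hle : Subgroup.closure (s '' {i | i + 1 < n}) ≤ Subgroup.centralizer {t} := by
        rw [Subgroup.closure_le]
        rintro _ ⟨k, hk, rfl⟩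
        have hk : k + 1 < n := hk
        rw [SetLike.mem_coe, Subgroup.mem_centralizer_singleton_iff]
        have := congrArg hs.algMap (congrArg (of (ZMod 2) PosBraid)
          (twist_commute (i := k) (k := n - 1) (by omega)).eq)
        rw [map_mul, map_mul, map_mul, map_mul, ht, algMap_of_σ, groupGen, if_pos hk, ← map_mul,
          ← map_mul] at this
        exact (of_injective this).symm
      have := Subgroup.mem_centralizer_singleton_iff.1 (hle hx)
      rw [groupTwist, ht, commute_iff_eq, ← map_mul, ← map_mul, this]
    rw [pow_succ, map_mul, ← mul_assoc, mul_assoc _ hs.groupTwist, hc.eq, ← mul_assoc, h,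
      mul_assoc, ht, map_mul, map_mul]

lemma exists_groupTwist_pow_mul (hs : IsBraidGenerators n s) (c : MonoidAlgebra (ZMod 2) G) :
    ∃ N₀, ∀ N ≥ N₀, ∃ d ∈ spanOf (below (n - 1)), hs.algMap d = hs.groupTwist ^ N * c := by
  induction c using MonoidAlgebra.induction_linear with
  | zero => exact ⟨0, fun N _ => ⟨0, Submodule.zero_mem _, by simp⟩⟩
  | add x y hx hy =>
    obtain ⟨N₁, h₁⟩ := hx
    obtain ⟨N₂, h₂⟩ := hy
    refine ⟨max N₁ N₂, fun N hN => ?_⟩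
    obtain ⟨d, hd, hd'⟩ := h₁ N ((le_max_left _ _).trans hN)
    obtain ⟨e, he, he'⟩ := h₂ N ((le_max_right _ _).trans hN)
    exact ⟨d + e, Submodule.add_mem _ hd he, by rw [map_add, hd', he', mul_add]⟩
  | single g r =>
    obtain ⟨N₀, m, hm, h⟩ := hs.exists_groupTwist_pow_mul_of g
    refine ⟨N₀, fun N hN => ⟨r • of (ZMod 2) PosBraid (twist (n - 1) ^ (N - N₀) * m),
      Submodule.smul_mem _ _ (of_mem_spanOf (mul_mem (pow_mem (twist_mem_below _) _) hm)), ?_⟩⟩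
    have : MonoidAlgebra.single g r = r • of (ZMod 2) G g := by simp
    rw [this, map_smul, mul_smul_comm, map_mul, map_mul, ← h, map_pow, map_pow, ← mul_assoc,
      groupTwist, ← pow_add, Nat.sub_add_cancel hN]

end IsBraidGenerators

namespace IsBraidGenerators

variable {G : Type*} [Group G] {n : ℕ} {s : ℕ → G}

lemma exists_mapRange_algMap (hs : IsBraidGenerators n s)
    (z : List ℕ →₀ MonoidAlgebra (ZMod 2) G) :
    ∃ N, ∃ z' : List ℕ →₀ Alg, (∀ w, z' w ∈ spanOf (below (n - 1))) ∧ (∀ w, z w = 0 → z' w = 0) ∧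
      z'.mapRange hs.algMap (map_zero _) = hs.groupTwist ^ N • z := by
  choose N₀ hN₀ using hs.exists_groupTwist_pow_mul
  let N := z.support.sup fun w => N₀ (z w)
  have h : ∀ w, ∃ c ∈ spanOf (below (n - 1)), hs.algMap c = hs.groupTwist ^ N * z w ∧
      (z w = 0 → c = 0) := by
    intro w
    by_cases hw : z w = 0
    · exact ⟨0, Submodule.zero_mem _, by rw [hw, map_zero, mul_zero], fun _ => rfl⟩
    · obtain ⟨c, hc, hc'⟩ := hN₀ (z w) N
        (Finset.le_sup (f := fun w => N₀ (z w)) (Finsupp.mem_support_iff.2 hw))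
      exact ⟨c, hc, hc', fun h => absurd h hw⟩
  choose c hc hc' hc₀ using h
  refine ⟨N, Finsupp.onFinset z.support c fun w hw => Finsupp.mem_support_iff.2 fun h =>
    hw (hc₀ w h), hc, hc₀, ?_⟩
  ext w : 1
  simp [hc']

lemma blockD_eq_zero_of_mapRange (hs : IsBraidGenerators n s) {z : List ℕ →₀ Alg}
    (hz : ∀ w, z w ∈ spanOf (below (n - 1))) (hn : ∀ w, z w ≠ 0 → w.sum + w.length = n)
    (h : blockD (groupGen n s) 0 (z.mapRange hs.algMap (map_zero _)) = 0) : bdry 0 z = 0 := by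
  have hmem : ∀ w', blockD gen 0 z w' ∈ spanSubsemiring (below (n - 1)) := by
    intro w'
    rw [blockD, Finsupp.linearCombination_apply, Finsupp.sum, Finsupp.finsetSum_apply]
    refine Subsemiring.sum_mem _ fun w hw => ?_
    rw [Finsupp.smul_apply, smul_eq_mul]
    refine mul_mem (hz w) (blockBoundary_apply_mem gen _ _ _ _ fun i _ hi => ?_)
    have := hn w (Finsupp.mem_support_iff.1 hw)
    exact of_mem_spanOf (σ_mem_below (by omega))
  ext w' : 1
  refine hs.eq_zero_of_algMap_eq_zero (hmem w') ?_
  have h' := mapRange_blockD gen (hs.algMap : Alg →+* MonoidAlgebra (ZMod 2) G) 0 z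
  rw [show (fun i => (hs.algMap : Alg →+* MonoidAlgebra (ZMod 2) G) (gen i)) = groupGen n s from
    hs.algMap_gen] at h'
  exact (DFunLike.congr_fun h' w').trans (DFunLike.congr_fun h w')

theorem exists_eq_blockD_add_single (hs : IsBraidGenerators n s)
    {z : List ℕ →₀ MonoidAlgebra (ZMod 2) G} (hn : ∀ w, z w ≠ 0 → w.sum + w.length = n)
    (hz : blockD (groupGen n s) 0 z = 0) :
    ∃ y c, z = blockD (groupGen n s) 0 y + Finsupp.single (List.replicate n 0) c := by
  obtain ⟨N, z', hz', hz'', h⟩ := hs.exists_mapRange_algMap z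
  obtain ⟨t, ht⟩ := hs.exists_algMap_of_eq (twist_mem_below (n - 1))
  have hb : bdry 0 z' = 0 := hs.blockD_eq_zero_of_mapRange hz'
    (fun w hw => hn w fun h => hw (hz'' w h)) (by rw [h, map_smul, hz, smul_zero])
  obtain ⟨_, ⟨y, rfl⟩, k, hk, hyk⟩ := Submodule.mem_sup.1 (mem_range_bdry_sup_span_critical hb)
  let P : List ℕ → Prop := fun w => w.sum + w.length = n
  have hk' : ∃ c, (k.mapRange hs.algMap (map_zero _)).filter P =
      Finsupp.single (List.replicate n 0) c := by
    clear hyk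
    induction hk using Submodule.span_induction with
    | zero => exact ⟨0, by rw [Finsupp.mapRange_zero, Finsupp.filter_zero, Finsupp.single_zero]⟩
    | add x y _ _ hx hy =>
      obtain ⟨c, hc⟩ := hx
      obtain ⟨d, hd⟩ := hy
      exact ⟨c + d, by rw [Finsupp.mapRange_add (map_add _), Finsupp.filter_add, hc, hd,
        Finsupp.single_add]⟩
    | smul a x _ hx =>
      obtain ⟨c, hc⟩ := hx
      exact ⟨a • c, by rw [Finsupp.mapRange_smul a _ (map_smul hs.algMap a), Finsupp.filter_smul,
        hc, Finsupp.smul_single]⟩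
    | mem x hx =>
      obtain ⟨⟨m, w⟩, hmw, rfl⟩ := hx
      simp only [cell, Finsupp.mapRange_single]
      by_cases hw : P w
      · rw [Finsupp.filter_single_of_pos _ hw]
        have h0 : w.sum = 0 := List.sum_eq_zero hmw.1
        have hw' : w.length = n := by simpa [P, h0] using hw
        refine ⟨hs.algMap (of (ZMod 2) PosBraid m), ?_⟩
        rw [List.eq_replicate_of_sum_eq_zero h0, hw']
      · exact ⟨0, by rw [Finsupp.filter_single_of_neg _ hw, Finsupp.single_zero]⟩
  obtain ⟨c, hc⟩ := hk'
  have hfz : z.filter P = z := (Finsupp.filter_eq_self_iff _ _).2 hn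
  have hyk' := congrArg (fun v : List ℕ →₀ Alg =>
    (v.mapRange hs.algMap (map_zero _)).filter P) hyk
  simp only [Finsupp.mapRange_add (map_add hs.algMap), Finsupp.filter_add, hc, h,
    Finsupp.filter_smul, hfz] at hyk'
  have hd := mapRange_blockD gen (hs.algMap : Alg →+* MonoidAlgebra (ZMod 2) G) 0 y
  rw [show (fun i => (hs.algMap : Alg →+* MonoidAlgebra (ZMod 2) G) (gen i)) = groupGen n s from
    hs.algMap_gen] at hd
  have hd' : (bdry 0 y).mapRange hs.algMap (map_zero _) = blockD (groupGen n s) 0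
    (y.mapRange hs.algMap (map_zero _)) := hd
  rw [hd', blockD_filter (q := P) _ _ (fun w w' h₁ h₂ => by simp only [P]; omega)] at hyk'
  let u := of (ZMod 2) G ((t ^ N)⁻¹)
  have hu : u * hs.groupTwist ^ N = 1 := by
    rw [groupTwist, ht, ← map_pow, ← map_mul, inv_mul_cancel, map_one]
  refine ⟨u • (y.mapRange hs.algMap (map_zero _)).filter P, u * c, ?_⟩
  rw [map_smul, ← smul_eq_mul, ← Finsupp.smul_single, ← smul_add, hyk', smul_smul, hu, one_smul]

/-- Exactness of the complex of compositions of `n` in positive degrees. -/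
theorem exists_blockD_eq (hs : IsBraidGenerators n s) {k : ℕ} (hk : 1 ≤ k)
    {z : List ℕ →₀ MonoidAlgebra (ZMod 2) G}
    (hn : ∀ w, z w ≠ 0 → w.sum = k ∧ w.sum + w.length = n)
    (hz : blockD (groupGen n s) 0 z = 0) :
    ∃ y : List ℕ →₀ MonoidAlgebra (ZMod 2) G,
      (∀ w, y w ≠ 0 → w.sum = k + 1 ∧ w.sum + w.length = n) ∧ blockD (groupGen n s) 0 y = z := by
  obtain ⟨y, c, h⟩ := hs.exists_eq_blockD_add_single (fun w hw => (hn w hw).2) hz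
  let P : List ℕ → Prop := fun w => w.sum = k ∧ w.sum + w.length = n
  let Q : List ℕ → Prop := fun w => w.sum = k + 1 ∧ w.sum + w.length = n
  refine ⟨y.filter Q, fun w hw => ?_, ?_⟩
  · by_contra hQ
    exact hw (Finsupp.filter_apply_neg Q y hQ)
  · have hfz : z.filter P = z := (Finsupp.filter_eq_self_iff _ _).2 hn
    rw [← hfz, h, Finsupp.filter_add, Finsupp.filter_single_of_neg, add_zero,
      blockD_filter (q := Q) _ _ (fun w w' h₁ h₂ => by simp only [P, Q]; omega)]
    simp only [P, List.sum_replicate, smul_zero]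
    omega

lemma blockBoundary_replicate {R : Type*} [Ring R] (f : ℕ → R) (j a b : ℕ) :
    blockBoundary f j (List.replicate a 0 ++ 1 :: List.replicate b 0) =
      Finsupp.single (List.replicate (a + b + 2) 0) (1 + f (j + a)) := by
  induction a generalizing j with
  | zero =>
    have h0 : ∀ b j, blockBoundary f j (List.replicate b 0) = 0 := by
      intro b
      induction b with
      | zero => simp
      | succ b ih => intro j; simp [List.replicate_succ, blockBoundary_cons, ih]
    rw [List.replicate_zero, List.nil_append, blockBoundary_cons, h0, Finsupp.mapDomain_zero,
      add_zero, blockSplit_succ, Finset.Nat.antidiagonal_zero, Finset.sum_singleton]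
    simp [List.replicate_succ, braidShuffle_succ_succ, braidDown_succ]
  | succ a ih =>
    rw [List.replicate_succ, List.cons_append, blockBoundary_cons, blockSplit_zero, zero_add, ih,
      Finsupp.mapDomain_single, show a + 1 + b + 2 = a + b + 2 + 1 by ring,
      List.replicate_succ (n := a + b + 2), show j + 0 + 1 + a = j + (a + 1) by ring]

lemma exists_blockD_eq_single_of_add_one (hs : IsBraidGenerators n s) (g : G) :
    ∃ y : List ℕ →₀ MonoidAlgebra (ZMod 2) G,
      (∀ w, y w ≠ 0 → w.sum = 1 ∧ w.sum + w.length = n) ∧ blockD (groupGen n s) 0 y =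
        Finsupp.single (List.replicate n 0) (of (ZMod 2) G g + 1) := by
  have hg : g ∈ Subgroup.closure (s '' {i | i + 1 < n}) := hs.closure_eq_top ▸ Subgroup.mem_top g
  have hsi : ∀ i, i + 1 < n → ∃ y : List ℕ →₀ MonoidAlgebra (ZMod 2) G,
      (∀ w, y w ≠ 0 → w.sum = 1 ∧ w.sum + w.length = n) ∧ blockD (groupGen n s) 0 y =
        Finsupp.single (List.replicate n 0) (of (ZMod 2) G (s i) + 1) := by
    intro i hi
    refine ⟨Finsupp.single (List.replicate i 0 ++ 1 :: List.replicate (n - i - 2) 0) 1, ?_, ?_⟩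
    · intro w hw
      obtain rfl := (Finsupp.single_apply_ne_zero.1 hw).1
      simp only [List.sum_append, List.sum_cons, List.sum_replicate, List.length_append,
        List.length_cons, List.length_replicate, smul_zero]
      omega
    · rw [blockD_single, one_smul, blockBoundary_replicate, show i + (n - i - 2) + 2 = n by omega,
        zero_add, groupGen, if_pos hi, add_comm]
  have step : ∀ x y : G, ∀ u v : List ℕ →₀ MonoidAlgebra (ZMod 2) G,
      blockD (groupGen n s) 0 u = Finsupp.single (List.replicate n 0) (of (ZMod 2) G x + 1) →
      blockD (groupGen n s) 0 v = Finsupp.single (List.replicate n 0) (of (ZMod 2) G y + 1) →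
      blockD (groupGen n s) 0 (of (ZMod 2) G x • v + u) =
        Finsupp.single (List.replicate n 0) (of (ZMod 2) G (x * y) + 1) := by
    intro x y u v hu hv
    rw [map_add, map_smul, hu, hv, Finsupp.smul_single, ← Finsupp.single_add, smul_eq_mul,
      mul_add, mul_one, ← map_mul]
    congr 1
    rw [add_assoc, ← add_assoc (of _ _ x), ZModModule.add_self, zero_add]
  have supp : ∀ x : G, ∀ u v : List ℕ →₀ MonoidAlgebra (ZMod 2) G,
      (∀ w, u w ≠ 0 → w.sum = 1 ∧ w.sum + w.length = n) →
      (∀ w, v w ≠ 0 → w.sum = 1 ∧ w.sum + w.length = n) →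
      ∀ w, (of (ZMod 2) G x • v + u) w ≠ 0 → w.sum = 1 ∧ w.sum + w.length = n := by
    intro x u v hu hv w hw
    by_cases h : u w = 0
    · refine hv w fun h' => hw ?_
      rw [Finsupp.add_apply, Finsupp.smul_apply, h, h', smul_zero, add_zero]
    · exact hu w h
  induction hg using Subgroup.closure_induction_right with
  | one => exact ⟨0, by simp, by rw [map_zero, map_one, ZModModule.add_self, Finsupp.single_zero]⟩
  | mul_right x _ y hy ih =>
    obtain ⟨i, hi, rfl⟩ := hy
    obtain ⟨u, hu, hu'⟩ := ih
    obtain ⟨v, hv, hv'⟩ := hsi i hi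
    exact ⟨_, supp x u v hu hv, step x _ u v hu' hv'⟩
  | mul_inv_cancel x _ y hy ih =>
    obtain ⟨i, hi, rfl⟩ := hy
    obtain ⟨u, hu, hu'⟩ := ih
    obtain ⟨v, hv, hv'⟩ := hsi i hi
    refine ⟨_, supp x u (of (ZMod 2) G (s i)⁻¹ • v + 0) hu (supp _ _ _ (by simp) hv),
      step x _ u _ hu' ?_⟩
    rw [add_zero, map_smul, hv', Finsupp.smul_single, smul_eq_mul, mul_add, mul_one, ← map_mul,
      inv_mul_cancel, map_one, add_comm]

/-- Exactness of the complex of compositions of `n` in degree zero. -/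
theorem exists_blockD_eq_single (hs : IsBraidGenerators n s) (c : MonoidAlgebra (ZMod 2) G) :
    ∃ y : List ℕ →₀ MonoidAlgebra (ZMod 2) G,
      (∀ w, y w ≠ 0 → w.sum = 1 ∧ w.sum + w.length = n) ∧ blockD (groupGen n s) 0 y =
        Finsupp.single (List.replicate n 0)
          (c + algebraMap _ _ (MonoidAlgebra.lift (ZMod 2) (ZMod 2) G 1 c)) := by
  induction c using MonoidAlgebra.induction_linear with
  | zero => exact ⟨0, by simp, by simp⟩
  | add x y hx hy =>
    obtain ⟨u, hu, hu'⟩ := hx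
    obtain ⟨v, hv, hv'⟩ := hy
    refine ⟨u + v, fun w hw => ?_, ?_⟩
    · by_cases h : u w = 0
      · exact hv w fun h' => hw (by rw [Finsupp.add_apply, h, h', add_zero])
      · exact hu w h
    · rw [map_add, hu', hv', ← Finsupp.single_add, map_add, map_add]
      congr 1
      abel
  | single g r =>
    obtain ⟨y, hy, hy'⟩ := hs.exists_blockD_eq_single_of_add_one g
    refine ⟨r • y, fun w hw => hy w fun h => hw (by rw [Finsupp.smul_apply, h, smul_zero]), ?_⟩
    have e : MonoidAlgebra.single g r = r • of (ZMod 2) G g := by simp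
    rw [← algebraMap_smul (MonoidAlgebra (ZMod 2) G) r y, map_smul, hy', Finsupp.smul_single,
      algebraMap_smul, smul_add, e, map_smul, MonoidAlgebra.lift_of, MonoidHom.one_apply,
      smul_eq_mul, mul_one, Algebra.algebraMap_eq_smul_one]

end IsBraidGenerators

end GroupComplex

section Presentation

open PosBraid

namespace BraidGroup

/-- The standard generators of the braid group. -/
def ofFin {n : ℕ} (i : Fin (n - 1)) : BraidGroup n :=
  (PresentedGroup.of i : PresentedGroup (artinRels (CoxeterMatrix.Aₙ (n - 1))))

/-- The standard generators of the braid group, extended by the identity. -/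
def gen (n i : ℕ) : BraidGroup n := if h : i < n - 1 then ofFin ⟨i, h⟩ else 1

lemma gen_of_lt {n i : ℕ} (h : i < n - 1) : gen n i = ofFin ⟨i, h⟩ := dif_pos h

lemma braidWord_two {B : Type*} (s t : B) :
    braidWord s t 2 = FreeGroup.of s * FreeGroup.of t := by
  simp [braidWord, List.range_succ]

lemma braidWord_three {B : Type*} (s t : B) :
    braidWord s t 3 = FreeGroup.of s * FreeGroup.of t * FreeGroup.of s := by
  simp [braidWord, List.range_succ, mul_assoc]

lemma lift_braidWord {G : Type*} [Group G] (n : ℕ) (f : ℕ → G)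
    (hc : ∀ i j, i + 2 ≤ j → j < n - 1 → f i * f j = f j * f i)
    (hb : ∀ i, i + 1 < n - 1 → f i * f (i + 1) * f i = f (i + 1) * f i * f (i + 1))
    (r : FreeGroup (Fin (n - 1))) (hr : r ∈ artinRels (CoxeterMatrix.Aₙ (n - 1))) :
    FreeGroup.lift (fun i : Fin (n - 1) => f i) r = 1 := by
  obtain ⟨s, t, hst, -, rfl⟩ := hr
  have hM : (CoxeterMatrix.Aₙ (n - 1)) s t =
    if s = t then 1 else (if (t : ℕ) + 1 = s ∨ (s : ℕ) + 1 = t then 3 else 2) := rfl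
  rw [hM, if_neg hst, map_mul, map_inv, mul_inv_eq_one]
  have hst' : (s : ℕ) ≠ t := fun h => hst (Fin.ext h)
  have hs := s.2
  have ht := t.2
  split_ifs with h
  · rw [braidWord_three, braidWord_three]
    simp only [map_mul, FreeGroup.lift_apply_of]
    rcases h with h | h
    · rw [← h]; exact (hb t (by omega)).symm
    · rw [← h]; exact hb s (by omega)
  · rw [braidWord_two, braidWord_two]
    simp only [map_mul, FreeGroup.lift_apply_of]
    rcases lt_or_gt_of_ne hst' with h' | h'
    · exact hc _ _ (by omega) ht
    · exact (hc _ _ (by omega) hs).symm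

lemma braidWord_eq {n : ℕ} (s t : Fin (n - 1)) (hst : s ≠ t) (k : ℕ)
    (hk : (CoxeterMatrix.Aₙ (n - 1)) s t = k) (hk0 : k ≠ 0) :
    PresentedGroup.mk (artinRels (CoxeterMatrix.Aₙ (n - 1))) (braidWord s t k) =
      PresentedGroup.mk (artinRels (CoxeterMatrix.Aₙ (n - 1))) (braidWord t s k) := by
  rw [← mul_inv_eq_one, ← map_inv, ← map_mul]
  exact PresentedGroup.one_of_mem ⟨s, t, hst, by rw [hk]; exact hk0, by rw [hk]⟩

theorem isBraidGenerators_gen (n : ℕ) : IsBraidGenerators n (gen n) where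
  comm i j hij hj := by
    have h := braidWord_eq (n := n) ⟨i, by omega⟩ ⟨j, by omega⟩ (by simp; omega) 2
      (by
        change (if _ = _ then 1 else (if _ then 3 else 2)) = 2
        rw [if_neg (by simp; omega), if_neg (by simp; omega)]) two_ne_zero
    rw [braidWord_two, braidWord_two, map_mul, map_mul] at h
    rw [gen_of_lt (i := i) (by omega), gen_of_lt (by omega)]
    exact h
  braid i hi := by
    have h := braidWord_eq (n := n) ⟨i, by omega⟩ ⟨i + 1, by omega⟩ (by simp) 3
      (by
        change (if _ = _ then 1 else (if _ then 3 else 2)) = 3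
        rw [if_neg (by simp), if_pos (by simp)]) three_ne_zero
    rw [braidWord_three, braidWord_three, map_mul, map_mul, map_mul, map_mul] at h
    rw [gen_of_lt (i := i) (by omega), gen_of_lt (by omega)]
    exact h
  closure_eq_top := by
    rw [eq_top_iff]
    refine (PresentedGroup.closure_range_of
      (artinRels (CoxeterMatrix.Aₙ (n - 1)))).symm.le.trans (Subgroup.closure_mono ?_)
    rintro _ ⟨i, rfl⟩
    refine ⟨i, ?_, ?_⟩
    · have := i.2
      simp only [Set.mem_ofPred_eq]
      omega
    · exact gen_of_lt i.2
  exists_hom := by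
    refine ⟨PresentedGroup.toGroup (lift_braidWord n (fun i => toFrac (σ i)) ?_ ?_), ?_⟩
    · intro i j h _
      simp only [← map_mul, isBraidFamily_σ.comm i j h]
    · intro i _
      simp only [← map_mul, isBraidFamily_σ.braid i]
    · intro i hi
      rw [gen_of_lt (by omega)]
      exact PresentedGroup.toGroup.of _

end BraidGroup

end Presentation

section Binomial

open Finset

lemma braidShuffle_eq_choose {R : Type*} [Semiring R] {f : ℕ → R} (j a b : ℕ)
    (h : ∀ i, j ≤ i → i + 1 < j + a + b → f i = 1) :
    braidShuffle f j a b = ((a + b).choose a : R) := by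
  induction a generalizing b with
  | zero => simp
  | succ a iha =>
    induction b with
    | zero => simp
    | succ b ihb =>
      have hd : braidDown f (j + a) (b + 1) = 1 := Submonoid.mem_bot.1
        (braidDown_mem f ⊥ _ _ fun i h₁ h₂ => Submonoid.mem_bot.2 (h i (by omega) (by omega)))
      rw [braidShuffle_succ_succ, ihb fun i h₁ h₂ => h i h₁ (by omega),
        iha _ fun i h₁ h₂ => h i h₁ (by omega), hd, mul_one, ← Nat.cast_add,
        show a + 1 + (b + 1) = (a + b + 1) + 1 by ring, Nat.choose_succ_succ,
        show a + 1 + b = a + b + 1 by ring, show a + (b + 1) = a + b + 1 by ring, add_comm]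

lemma two_pow_add_choose {k B B' : ℕ} (hB : B < 2 ^ k) :
    ((2 ^ k + B).choose (2 ^ k + B') : ZMod 2) = (B.choose B' : ZMod 2) := by
  rw [Nat.add_choose_eq, Nat.cast_sum, Finset.sum_eq_single (2 ^ k, B')]
  · simp
  · rintro ⟨x, y⟩ hxy hne
    rw [HasAntidiagonal.mem_antidiagonal] at hxy
    simp only at hxy ⊢
    rcases lt_or_ge B y with hy | hy
    · simp [Nat.choose_eq_zero_of_lt hy]
    · have hx : x ≠ 2 ^ k := by
        rintro rfl
        exact hne (by ext <;> simp <;> omega)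
      have hx0 : x ≠ 0 := by omega
      have := (Nat.prime_two.dvd_choose_pow hx0 hx)
      rw [Nat.cast_mul, (ZMod.natCast_eq_zero_iff _ 2).2 this, zero_mul]
  · exact fun h => absurd (HasAntidiagonal.mem_antidiagonal.2 (by rfl)) h

/-- The mod 2 reduction of the splitting part of the boundary of a composition. -/
noncomputable def binSplit (a : ℕ) (w : List ℕ) : List ℕ →₀ ZMod 2 :=
  ∑ i ∈ range a, Finsupp.single (i :: (a - 1 - i) :: w) ((a + 1).choose (i + 1) : ZMod 2)

/-- The boundary of a composition, with trivial mod 2 coefficients. -/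
noncomputable def binBoundary : List ℕ → List ℕ →₀ ZMod 2
  | [] => 0
  | a :: w => binSplit a w + (binBoundary w).mapDomain (a :: ·)

lemma blockSplit_eq_binSplit {f : ℕ → ZMod 2} (j a : ℕ) (w : List ℕ)
    (h : ∀ i, j ≤ i → i < j + a → f i = 1) : blockSplit f j a w = binSplit a w := by
  cases a with
  | zero => simp [binSplit]
  | succ a =>
    rw [blockSplit_succ, binSplit, Finset.Nat.sum_antidiagonal_eq_sum_range_succ_mk]
    refine Finset.sum_congr rfl fun i hi => ?_
    rw [Finset.mem_range] at hi
    rw [braidShuffle_eq_choose _ _ _ fun i h₁ h₂ => h i h₁ (by simp at h₂; omega)]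
    simp only [Nat.add_sub_cancel]
    rw [show i + 1 + (a - i + 1) = a + 1 + 1 by omega]

lemma blockBoundary_eq_binBoundary {f : ℕ → ZMod 2} (j : ℕ) (w : List ℕ)
    (h : ∀ i, j ≤ i → i + 1 < j + w.sum + w.length → f i = 1) :
    blockBoundary f j w = binBoundary w := by
  induction w generalizing j with
  | nil => rfl
  | cons a w ih =>
    simp only [List.sum_cons, List.length_cons] at h
    rw [blockBoundary_cons, binBoundary, ih _ fun i h₁ h₂ => h i (by omega) (by omega),
      blockSplit_eq_binSplit j a w fun i h₁ h₂ => h i h₁ (by omega)]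

/-- The boundary operator on compositions, with trivial mod 2 coefficients. -/
noncomputable def binD : (List ℕ →₀ ZMod 2) →ₗ[ZMod 2] (List ℕ →₀ ZMod 2) :=
  Finsupp.linearCombination (ZMod 2) binBoundary

@[simp] lemma binD_single (w : List ℕ) (r : ZMod 2) :
    binD (Finsupp.single w r) = r • binBoundary w := by
  simp [binD]

lemma binD_eq_blockD : binD = blockD (fun _ => (1 : ZMod 2)) 0 := by
  ext1 w
  ext1
  simp [blockBoundary_eq_binBoundary]

lemma binD_binD (v : List ℕ →₀ ZMod 2) : binD (binD v) = 0 := by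
  rw [binD_eq_blockD]
  refine IsBraidFamily.blockD_blockD ?_ 0 v
  constructor <;> (intros; simp)

end Binomial

section Keys

open Finset

/-- The exponents of the binary expansion of a natural number, in decreasing order. -/
def binaryExponents (A : ℕ) : List ℕ :=
  if h : A = 0 then [] else Nat.log 2 A :: binaryExponents (A - 2 ^ Nat.log 2 A)
termination_by A
decreasing_by exact Nat.sub_lt (Nat.pos_of_ne_zero h) (by positivity)

/-- The key by which compositions are compared lexicographically. -/
def blockKey (w : List ℕ) : List ℕ := w.flatMap fun a => binaryExponents (a + 1)

/-- A block whose size `a + 1` is a power of two. -/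
def IsTwoPow (a : ℕ) : Prop := 2 ^ Nat.log 2 (a + 1) = a + 1

instance : DecidablePred IsTwoPow := fun _ => inferInstanceAs (Decidable (_ = _))

lemma isTwoPow_of_eq {a k : ℕ} (h : a + 1 = 2 ^ k) : IsTwoPow a := by
  rw [IsTwoPow, h, Nat.log_pow (by norm_num)]

lemma blockKey_cons (a : ℕ) (w : List ℕ) :
    blockKey (a :: w) = binaryExponents (a + 1) ++ blockKey w := rfl

lemma binaryExponents_zero : binaryExponents 0 = [] := by rw [binaryExponents]; simp

lemma binaryExponents_succ (a : ℕ) : binaryExponents (a + 1) =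
    Nat.log 2 (a + 1) :: binaryExponents (a + 1 - 2 ^ Nat.log 2 (a + 1)) := by
  rw [binaryExponents]; simp

lemma blockKey_lt_of_log_lt {a b : ℕ} (h : Nat.log 2 (a + 1) < Nat.log 2 (b + 1))
    (w w' : List ℕ) : blockKey (a :: w) < blockKey (b :: w') := by
  rw [blockKey_cons, blockKey_cons, binaryExponents_succ, binaryExponents_succ,
    List.cons_append, List.cons_append]
  exact List.cons_lt_cons_iff.2 (Or.inl h)

lemma IsTwoPow.blockKey_cons {a : ℕ} (ha : IsTwoPow a) (w : List ℕ) :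
    blockKey (a :: w) = Nat.log 2 (a + 1) :: blockKey w := by
  rw [_root_.blockKey_cons, binaryExponents_succ, ha, Nat.sub_self, binaryExponents_zero]
  rfl

lemma IsTwoPow.blockKey_add_cons {a c : ℕ} (ha : IsTwoPow a) (hc : c < a) (w : List ℕ) :
    blockKey ((a + c + 1) :: w) = Nat.log 2 (a + 1) :: blockKey (c :: w) := by
  have hlog : Nat.log 2 (a + c + 1 + 1) = Nat.log 2 (a + 1) := by
    rw [Nat.log_eq_iff (Or.inr ⟨by norm_num, by omega⟩), pow_succ, ha]
    omega
  rw [_root_.blockKey_cons, binaryExponents_succ, hlog, ha,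
    show a + c + 1 + 1 - (a + 1) = c + 1 by omega]
  rfl

lemma IsTwoPow.log_lt {a c : ℕ} (ha : IsTwoPow a) (hc : c < a) :
    Nat.log 2 (c + 1) < Nat.log 2 (a + 1) := by
  apply Nat.log_lt_of_lt_pow (by omega)
  rw [ha]; omega

/-- The span of the compositions whose key is below a given one. -/
def lowSpan (κ : List ℕ) : Submodule (ZMod 2) (List ℕ →₀ ZMod 2) :=
  Finsupp.supported _ _ {w | blockKey w < κ}

lemma single_mem_lowSpan {κ w : List ℕ} (h : blockKey w < κ) (r : ZMod 2) :
    Finsupp.single w r ∈ lowSpan κ := Finsupp.single_mem_supported _ _ h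

lemma mapDomain_mem_lowSpan {κ κ' : List ℕ} {v : List ℕ →₀ ZMod 2} (g : List ℕ → List ℕ)
    (hg : ∀ w, blockKey w < κ → blockKey (g w) < κ') (hv : v ∈ lowSpan κ) :
    v.mapDomain g ∈ lowSpan κ' := by
  classical
  intro w hw
  obtain ⟨u, hu, rfl⟩ := Finset.mem_image.1 (Finsupp.mapDomain_support hw)
  exact hg u (hv hu)

lemma mapDomain_mem_lowSpan' {κ' : List ℕ} (v : List ℕ →₀ ZMod 2) (g : List ℕ → List ℕ)
    (hg : ∀ w, blockKey (g w) < κ') : v.mapDomain g ∈ lowSpan κ' := by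
  classical
  intro w hw
  obtain ⟨u, hu, rfl⟩ := Finset.mem_image.1 (Finsupp.mapDomain_support hw)
  exact hg u

/-- The homotopy on compositions merging the first descending pair `2 ^ k, b` with `b < 2 ^ k`. -/
noncomputable def mergeHomotopy : List ℕ → List ℕ →₀ ZMod 2
  | [] => 0
  | [_] => 0
  | a :: b :: w => if IsTwoPow a then
      if b < a then Finsupp.single ((a + b + 1) :: w) 1
      else (mergeHomotopy (b :: w)).mapDomain (a :: ·)
    else 0

/-- The linear extension of `mergeHomotopy`. -/
noncomputable def mergeH : (List ℕ →₀ ZMod 2) →ₗ[ZMod 2] (List ℕ →₀ ZMod 2) :=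
  Finsupp.linearCombination (ZMod 2) mergeHomotopy

@[simp] lemma mergeH_single (w : List ℕ) (r : ZMod 2) :
    mergeH (Finsupp.single w r) = r • mergeHomotopy w := by
  simp [mergeH]

lemma mergeHomotopy_cons_of_not {a : ℕ} (ha : ¬ IsTwoPow a) (w : List ℕ) :
    mergeHomotopy (a :: w) = 0 := by
  cases w <;> simp [mergeHomotopy, ha]

lemma mergeHomotopy_of_lt {a b : ℕ} (ha : IsTwoPow a) (hb : b < a) (w : List ℕ) :
    mergeHomotopy (a :: b :: w) = Finsupp.single ((a + b + 1) :: w) 1 := by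
  rw [mergeHomotopy, if_pos ha, if_pos hb]

lemma mergeHomotopy_of_le {a b : ℕ} (ha : IsTwoPow a) (hb : a ≤ b) (w : List ℕ) :
    mergeHomotopy (a :: b :: w) = (mergeHomotopy (b :: w)).mapDomain (a :: ·) := by
  rw [mergeHomotopy, if_pos ha, if_neg (not_lt.2 hb)]

lemma mergeH_mapDomain_of_not {a : ℕ} (ha : ¬ IsTwoPow a) (v : List ℕ →₀ ZMod 2) :
    mergeH (v.mapDomain (a :: ·)) = 0 := by
  induction v using Finsupp.induction_linear with
  | zero => simp
  | add v w hv hw => rw [Finsupp.mapDomain_add, map_add, hv, hw, add_zero]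
  | single w r => simp [Finsupp.mapDomain_single, mergeHomotopy_cons_of_not ha]

lemma mergeH_mapDomain_of_lt {a b : ℕ} (ha : IsTwoPow a) (hb : b < a) (v : List ℕ →₀ ZMod 2) :
    mergeH ((v.mapDomain (b :: ·)).mapDomain (a :: ·)) = v.mapDomain ((a + b + 1) :: ·) := by
  induction v using Finsupp.induction_linear with
  | zero => simp
  | add v w hv hw => simp only [Finsupp.mapDomain_add, map_add, hv, hw]
  | single w r => simp [Finsupp.mapDomain_single, mergeHomotopy_of_lt ha hb]

lemma mergeH_mapDomain_of_le {a b : ℕ} (ha : IsTwoPow a) (hb : a ≤ b) (v : List ℕ →₀ ZMod 2) :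
    mergeH ((v.mapDomain (b :: ·)).mapDomain (a :: ·)) =
      (mergeH (v.mapDomain (b :: ·))).mapDomain (a :: ·) := by
  induction v using Finsupp.induction_linear with
  | zero => simp
  | add v w hv hw => simp only [Finsupp.mapDomain_add, map_add, hv, hw]
  | single w r =>
    simp [Finsupp.mapDomain_single, mergeHomotopy_of_le ha hb, Finsupp.mapDomain_smul]

lemma IsTwoPow.binSplit_eq_zero {a : ℕ} (ha : IsTwoPow a) (w : List ℕ) : binSplit a w = 0 := by
  refine Finset.sum_eq_zero fun i hi => ?_
  rw [Finset.mem_range] at hi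
  have : (2 : ℕ) ∣ (2 ^ Nat.log 2 (a + 1)).choose (i + 1) :=
    Nat.prime_two.dvd_choose_pow (by omega) (by rw [ha]; omega)
  rw [ha] at this
  rw [(ZMod.natCast_eq_zero_iff _ 2).2 this, Finsupp.single_zero]

lemma IsTwoPow.binD_mapDomain {a : ℕ} (ha : IsTwoPow a) (v : List ℕ →₀ ZMod 2) :
    binD (v.mapDomain (a :: ·)) = (binD v).mapDomain (a :: ·) := by
  induction v using Finsupp.induction_linear with
  | zero => simp
  | add v w hv hw => simp only [Finsupp.mapDomain_add, map_add, hv, hw]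
  | single w r =>
    simp [Finsupp.mapDomain_single, binBoundary, ha.binSplit_eq_zero, Finsupp.mapDomain_smul]

lemma mergeHomotopy_mem_lowSpan {i j b : ℕ} (hij : IsTwoPow i → i ≤ j)
    (hb : Nat.log 2 (i + 1) < Nat.log 2 (b + 1)) (w w' : List ℕ) :
    mergeHomotopy (i :: j :: w) ∈ lowSpan (blockKey (b :: w')) := by
  by_cases hi : IsTwoPow i
  · rw [mergeHomotopy_of_le hi (hij hi)]
    exact mapDomain_mem_lowSpan' _ _ fun u => blockKey_lt_of_log_lt hb _ _
  · rw [mergeHomotopy_cons_of_not hi]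
    exact Submodule.zero_mem _

lemma binBoundary_cons (a : ℕ) (w : List ℕ) :
    binBoundary (a :: w) = binSplit a w + (binBoundary w).mapDomain (a :: ·) := rfl

lemma two_mul_le_of_isTwoPow {i A : ℕ} (hi : IsTwoPow i)
    (h : Nat.log 2 (i + 1) < Nat.log 2 (A + 1)) : 2 * (i + 1) ≤ 2 ^ Nat.log 2 (A + 1) := by
  rw [← hi, ← pow_succ']
  exact Nat.pow_le_pow_right (by norm_num) h

/-- Compositions into powers of two, in increasing order. -/
def IsSortedTwoPow (w : List ℕ) : Prop := (∀ a ∈ w, IsTwoPow a) ∧ w.IsChain (· ≤ ·)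

lemma homotopy_of_not_isTwoPow {a : ℕ} (ha : ¬ IsTwoPow a) (w : List ℕ) :
    Finsupp.single (a :: w) 1 + binD (mergeHomotopy (a :: w)) + mergeH (binBoundary (a :: w)) ∈
      lowSpan (blockKey (a :: w)) := by
  rw [mergeHomotopy_cons_of_not ha, map_zero, add_zero, binBoundary_cons, map_add,
    mergeH_mapDomain_of_not ha, add_zero, binSplit, map_sum]
  set k := Nat.log 2 (a + 1) with hk
  have h1 : 2 ^ k ≤ a + 1 := Nat.pow_log_le_self 2 (by omega)
  have h2 : a + 1 < 2 ^ (k + 1) := Nat.lt_pow_succ_log_self (by norm_num) _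
  have h3 : 2 ^ k ≠ a + 1 := ha
  have h4 : 1 ≤ 2 ^ k := Nat.one_le_two_pow
  rw [pow_succ] at h2
  have hp : IsTwoPow (2 ^ k - 1) := isTwoPow_of_eq (k := k) (by omega)
  have hmem : 2 ^ k - 1 ∈ range a := by rw [Finset.mem_range]; omega
  rw [← Finset.add_sum_erase _ _ hmem, ← add_assoc]
  have hc : ((a + 1).choose (2 ^ k - 1 + 1) : ZMod 2) = 1 := by
    have := two_pow_add_choose (k := k) (B := a + 1 - 2 ^ k) (B' := 0) (by omega)
    rw [show 2 ^ k + (a + 1 - 2 ^ k) = a + 1 by omega] at this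
    rw [Nat.sub_add_cancel h4]
    simpa using this
  have hm : mergeH (Finsupp.single ((2 ^ k - 1) :: (a - 1 - (2 ^ k - 1)) :: w)
      ((a + 1).choose (2 ^ k - 1 + 1) : ZMod 2)) = Finsupp.single (a :: w) 1 := by
    rw [mergeH_single, hc, one_smul, mergeHomotopy_of_lt hp (by omega)]
    congr 2
    omega
  rw [hm, ZModModule.add_self, zero_add]
  refine Submodule.sum_mem _ fun i hi => ?_
  rw [Finset.mem_erase, Finset.mem_range] at hi
  rw [mergeH_single]
  refine Submodule.smul_mem _ _ ?_
  by_cases hpi : IsTwoPow i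
  · have hlog : Nat.log 2 (i + 1) < Nat.log 2 (a + 1) := by
      refine lt_of_le_of_ne (Nat.log_mono_right (by omega)) fun h => hi.1 ?_
      have := hpi
      rw [IsTwoPow, h, ← hk] at this
      omega
    have := two_mul_le_of_isTwoPow hpi hlog
    rw [← hk] at this
    exact mergeHomotopy_mem_lowSpan (fun _ => by omega) hlog _ _
  · rw [mergeHomotopy_cons_of_not hpi]
    exact Submodule.zero_mem _

lemma homotopy_of_lt {a b : ℕ} (ha : IsTwoPow a) (hb : b < a) (w : List ℕ) :
    Finsupp.single (a :: b :: w) 1 + binD (mergeHomotopy (a :: b :: w)) +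
      mergeH (binBoundary (a :: b :: w)) ∈ lowSpan (blockKey (a :: b :: w)) := by
  rw [mergeHomotopy_of_lt ha hb, binD_single, one_smul, binBoundary_cons (a + b + 1),
    binBoundary_cons a, binBoundary_cons b, ha.binSplit_eq_zero, zero_add, Finsupp.mapDomain_add,
    map_add, mergeH_mapDomain_of_lt ha hb]
  have hs : mergeH ((binSplit b w).mapDomain (a :: ·)) =
      ∑ i ∈ range b, Finsupp.single ((a + 1 + i) :: (b - 1 - i) :: w)
        ((b + 1).choose (i + 1) : ZMod 2) := by
    rw [binSplit, Finsupp.mapDomain_finsetSum, map_sum]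
    refine Finset.sum_congr rfl fun i hi => ?_
    rw [Finset.mem_range] at hi
    rw [Finsupp.mapDomain_single, mergeH_single, mergeHomotopy_of_lt ha (by omega),
      Finsupp.smul_single, smul_eq_mul, mul_one, show a + i + 1 = a + 1 + i by ring]
  have hch : ∀ i, ((a + b + 1 + 1).choose (a + 1 + i) : ZMod 2) = ((b + 1).choose i : ZMod 2) := by
    intro i
    have := two_pow_add_choose (k := Nat.log 2 (a + 1)) (B := b + 1) (B' := i)
      (by rw [ha]; omega)
    rw [ha] at this
    rw [← this, show a + b + 1 + 1 = a + 1 + (b + 1) by ring]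
  have ht : binSplit (a + b + 1) w = ∑ i ∈ range a, Finsupp.single (i :: (a + b - i) :: w)
        ((a + b + 1 + 1).choose (i + 1) : ZMod 2) + Finsupp.single (a :: b :: w) 1 +
      ∑ i ∈ range b, Finsupp.single ((a + 1 + i) :: (b - 1 - i) :: w)
        ((b + 1).choose (i + 1) : ZMod 2) := by
    rw [binSplit, show a + b + 1 = (a + 1) + b by ring, Finset.sum_range_add,
      Finset.sum_range_succ]
    congr 1
    · congr 1
      · refine Finset.sum_congr rfl fun i hi => ?_
        rw [show a + 1 + b - 1 - i = a + b - i by omega, show a + 1 + b = a + b + 1 by ring]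
      · rw [show a + 1 + b - 1 - a = b by omega, show a + 1 + b = a + b + 1 by ring]
        have := hch 0
        simp only [add_zero, Nat.choose_zero_right, Nat.cast_one] at this
        rw [this]
    · refine Finset.sum_congr rfl fun i hi => ?_
      rw [← hch, show a + 1 + b - 1 - (a + 1 + i) = b - 1 - i by omega,
        show a + 1 + b = a + b + 1 by ring, add_assoc (a + 1) i 1]
  rw [hs, ht]
  set S := ∑ i ∈ range b, Finsupp.single ((a + 1 + i) :: (b - 1 - i) :: w)
        ((b + 1).choose (i + 1) : ZMod 2)
  set T := (binBoundary w).mapDomain ((a + b + 1) :: ·)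
  set L := ∑ i ∈ range a, Finsupp.single (i :: (a + b - i) :: w)
        ((a + b + 1 + 1).choose (i + 1) : ZMod 2) with hL
  have : Finsupp.single (a :: b :: w) 1 + (L + Finsupp.single (a :: b :: w) 1 + S + T) + (S + T) =
      L + (Finsupp.single (a :: b :: w) (1 : ZMod 2) + Finsupp.single (a :: b :: w) 1) + (S + S)
        + (T + T) := by abel
  rw [this, ZModModule.add_self, ZModModule.add_self, ZModModule.add_self, add_zero, add_zero,
    add_zero, hL]
  refine Submodule.sum_mem _ fun i hi => single_mem_lowSpan ?_ _
  exact blockKey_lt_of_log_lt (ha.log_lt (Finset.mem_range.1 hi)) _ _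

lemma homotopy_of_le {a b : ℕ} (ha : IsTwoPow a) (hb : a ≤ b) (w : List ℕ)
    (h : Finsupp.single (b :: w) 1 + binD (mergeHomotopy (b :: w)) + mergeH (binBoundary (b :: w)) ∈
      lowSpan (blockKey (b :: w))) :
    Finsupp.single (a :: b :: w) 1 + binD (mergeHomotopy (a :: b :: w)) +
      mergeH (binBoundary (a :: b :: w)) ∈ lowSpan (blockKey (a :: b :: w)) := by
  have hcons : ∀ {v}, v ∈ lowSpan (blockKey (b :: w)) →
      v.mapDomain (a :: ·) ∈ lowSpan (blockKey (a :: b :: w)) := by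
    refine fun {v} => mapDomain_mem_lowSpan _ fun u hu => ?_
    rw [ha.blockKey_cons, ha.blockKey_cons]
    exact List.cons_lt_cons_iff.2 (Or.inr ⟨rfl, hu⟩)
  have hd : mergeH ((binSplit b w).mapDomain (a :: ·)) +
      (mergeH (binSplit b w)).mapDomain (a :: ·) ∈ lowSpan (blockKey (a :: b :: w)) := by
    rw [binSplit, Finsupp.mapDomain_finsetSum, map_sum, map_sum, Finsupp.mapDomain_finsetSum,
      ← Finset.sum_add_distrib]
    refine Submodule.sum_mem _ fun i hi => ?_
    rw [Finsupp.mapDomain_single, mergeH_single, mergeH_single, Finsupp.mapDomain_smul, ← smul_add]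
    refine Submodule.smul_mem _ _ ?_
    rcases lt_or_ge i a with hia | hia
    · have hlog := ha.log_lt hia
      have hlog' : Nat.log 2 (i + 1) < Nat.log 2 (b + 1) :=
        hlog.trans_le (Nat.log_mono_right (by omega))
      refine Submodule.add_mem _ ?_ (hcons (mergeHomotopy_mem_lowSpan (fun hi' => ?_) hlog' _ _))
      · rw [mergeHomotopy_of_lt ha hia]
        refine single_mem_lowSpan ?_ _
        rw [ha.blockKey_add_cons hia, ha.blockKey_cons]
        exact List.cons_lt_cons_iff.2 (Or.inr ⟨rfl, blockKey_lt_of_log_lt hlog' _ _⟩)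
      · have := two_mul_le_of_isTwoPow hi' hlog
        rw [ha] at this
        omega
    · rw [mergeHomotopy_of_le ha hia, ZModModule.add_self]
      exact Submodule.zero_mem _
  have := Submodule.add_mem _ (hcons h) hd
  rw [mergeHomotopy_of_le ha hb, ha.binD_mapDomain, binBoundary_cons a, ha.binSplit_eq_zero,
    zero_add, binBoundary_cons, Finsupp.mapDomain_add, map_add, mergeH_mapDomain_of_le ha hb]
  convert this using 1
  rw [Finsupp.mapDomain_add, Finsupp.mapDomain_add, Finsupp.mapDomain_single, binBoundary_cons,
    map_add, Finsupp.mapDomain_add]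
  set A := (mergeH (binSplit b w)).mapDomain (a :: ·)
  set B := mergeH ((binSplit b w).mapDomain (a :: ·))
  set C := (mergeH ((binBoundary w).mapDomain (b :: ·))).mapDomain (a :: ·)
  set D := (binD (mergeHomotopy (b :: w))).mapDomain (a :: ·)
  have : Finsupp.single (a :: b :: w) 1 + D + (A + C) + (B + A) =
      Finsupp.single (a :: b :: w) (1 : ZMod 2) + D + (B + C) + (A + A) := by abel
  rw [this, ZModModule.add_self, add_zero]

theorem homotopy_mem_lowSpan {w : List ℕ} (hw : ¬ IsSortedTwoPow w) :
    Finsupp.single w 1 + binD (mergeHomotopy w) + mergeH (binBoundary w) ∈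
      lowSpan (blockKey w) := by
  induction w with
  | nil => exact absurd ⟨by simp, by simp⟩ hw
  | cons a w ih =>
    by_cases ha : IsTwoPow a
    · cases w with
      | nil => exact absurd ⟨by simpa, by simp⟩ hw
      | cons b w =>
        rcases lt_or_ge b a with hb | hb
        · exact homotopy_of_lt ha hb w
        · refine homotopy_of_le ha hb w (ih fun h => hw ⟨?_, ?_⟩)
          · simpa using ⟨ha, by simpa using h.1⟩
          · exact List.isChain_cons_cons.2 ⟨hb, h.2⟩
    · exact homotopy_of_not_isTwoPow ha w

end Keys

section BinHomology

open Finset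

/-- The compositions of `n` into `n - m` blocks. -/
def blockSet (n m : ℕ) : Set (List ℕ) := {w | w.sum = m ∧ w.sum + w.length = n}

lemma finite_sum_add_length (n : ℕ) : {w : List ℕ | w.sum + w.length = n}.Finite := by
  refine Set.Finite.subset ((List.finite_length_le (Fin (n + 1)) n).image (List.map Fin.val)) ?_
  intro w hw
  rw [Set.mem_ofPred_eq] at hw
  have hlt : ∀ a ∈ w, a < n + 1 := fun a ha => by
    have := List.single_le_sum (fun _ _ => Nat.zero_le _) a ha
    omega
  refine ⟨w.attach.map fun a => ⟨a.1, hlt a.1 a.2⟩, ?_, ?_⟩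
  · simp only [Set.mem_ofPred_eq, List.length_map, List.length_attach]; omega
  · simp

/-- The order on compositions along which the homotopy decreases. -/
def blockLT (p q : List ℕ) : Prop :=
  blockKey p < blockKey q ∧ p.sum + p.length = q.sum + q.length

lemma wellFounded_blockLT : WellFounded blockLT := by
  rw [wellFounded_iff_isEmpty_descending_chain]
  refine ⟨fun ⟨c, hc⟩ => ?_⟩
  have hanti : StrictAnti fun k => blockKey (c k) := strictAnti_nat_of_succ_lt fun k => (hc k).1
  have hinj : Function.Injective c := fun i j h => hanti.injective (congrArg blockKey h)
  refine Set.infinite_of_injective_forall_mem hinj (fun k => ?_)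
    (finite_sum_add_length ((c 0).sum + (c 0).length))
  induction k with
  | zero => rfl
  | succ k ih => exact (hc k).2.trans ih

lemma mergeHomotopy_support {w w' : List ℕ} (h : mergeHomotopy w w' ≠ 0) :
    w'.sum = w.sum + 1 ∧ w'.sum + w'.length = w.sum + w.length := by
  induction w generalizing w' with
  | nil => simp [mergeHomotopy] at h
  | cons a w ih =>
    cases w with
    | nil => simp [mergeHomotopy] at h
    | cons b w =>
      by_cases ha : IsTwoPow a
      · rcases lt_or_ge b a with hb | hb
        · rw [mergeHomotopy_of_lt ha hb, Finsupp.single_apply] at h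
          have : (a + b + 1) :: w = w' := by by_contra h'; simp [h'] at h
          subst this
          simp only [List.sum_cons, List.length_cons]
          omega
        · rw [mergeHomotopy_of_le ha hb] at h
          by_cases hw : w' ∈ Set.range (List.cons a)
          · obtain ⟨v, rfl⟩ := hw
            rw [Finsupp.mapDomain_apply (List.cons_injective)] at h
            have := ih h
            simp only [List.sum_cons, List.length_cons] at this ⊢
            omega
          · exact absurd (Finsupp.mapDomain_of_notMem_range _ _ hw) h
      · simp [mergeHomotopy_cons_of_not ha] at h

lemma IsSortedTwoPow.binBoundary_eq_zero {w : List ℕ} (hw : ∀ a ∈ w, IsTwoPow a) :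
    binBoundary w = 0 := by
  induction w with
  | nil => rfl
  | cons a w ih =>
    rw [binBoundary_cons, IsTwoPow.binSplit_eq_zero (hw a (by simp)),
      ih fun b hb => hw b (by simp [hb])]
    simp

/-- The underlying multiset of a composition into powers of two. -/
noncomputable def twoPowMultiset (w : List ℕ) : Multiset ℕ →₀ ZMod 2 :=
  if ∀ a ∈ w, IsTwoPow a then Finsupp.single (w : Multiset ℕ) 1 else 0

lemma twoPowMultiset_perm {w w' : List ℕ} (h : w.Perm w') :
    twoPowMultiset w = twoPowMultiset w' := by
  rw [twoPowMultiset, twoPowMultiset, Multiset.coe_eq_coe.2 h]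
  simp only [h.mem_iff]

/-- The linear extension of `twoPowMultiset`. -/
noncomputable def twoPowMap : (List ℕ →₀ ZMod 2) →ₗ[ZMod 2] (Multiset ℕ →₀ ZMod 2) :=
  Finsupp.linearCombination (ZMod 2) twoPowMultiset

@[simp] lemma twoPowMap_single (w : List ℕ) (r : ZMod 2) :
    twoPowMap (Finsupp.single w r) = r • twoPowMultiset w := by
  simp [twoPowMap]

lemma twoPowMap_binSplit (a : ℕ) (w : List ℕ) : twoPowMap (binSplit a w) = 0 := by
  rw [binSplit, map_sum]
  refine Finset.sum_involution (fun i _ => a - 1 - i) (fun i hi => ?_) (fun i hi h₁ h₂ => h₁ ?_)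
    (fun i hi => ?_) (fun i hi => ?_)
  all_goals rw [Finset.mem_range] at hi
  · rw [twoPowMap_single, twoPowMap_single, show a - 1 - (a - 1 - i) = i by omega,
      twoPowMultiset_perm (List.Perm.swap _ _ _),
      Nat.choose_symm_of_eq_add (show a + 1 = (i + 1) + (a - 1 - i + 1) by omega)]
    exact ZModModule.add_self _
  · have : 2 ∣ (a + 1).choose (i + 1) := by
      rw [show a + 1 = 2 * (i + 1) by omega]
      exact Nat.two_dvd_centralBinom_succ i
    rw [(ZMod.natCast_eq_zero_iff _ 2).2 this, Finsupp.single_zero, map_zero]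
  · rw [Finset.mem_range]; omega
  · omega

lemma twoPowMap_mapDomain (a : ℕ) (v : List ℕ →₀ ZMod 2) : twoPowMap (v.mapDomain (a :: ·)) =
    if IsTwoPow a then (twoPowMap v).mapDomain (a ::ₘ ·) else 0 := by
  induction v using Finsupp.induction_linear with
  | zero => simp
  | add v w hv hw => rw [Finsupp.mapDomain_add, map_add, hv, hw]; split_ifs <;> simp [Finsupp.mapDomain_add]
  | single w r =>
    rw [Finsupp.mapDomain_single, twoPowMap_single, twoPowMap_single]
    by_cases ha : IsTwoPow a
    · rw [if_pos ha, Finsupp.mapDomain_smul, twoPowMultiset, twoPowMultiset]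
      simp only [List.mem_cons, forall_eq_or_imp, ha, true_and]
      split_ifs <;> simp [Finsupp.mapDomain_single]
    · simp [twoPowMultiset, ha]

lemma twoPowMap_binBoundary (w : List ℕ) : twoPowMap (binBoundary w) = 0 := by
  induction w with
  | nil => simp [binBoundary]
  | cons a w ih => simp [binBoundary_cons, twoPowMap_binSplit, twoPowMap_mapDomain, ih]

lemma twoPowMap_binD (v : List ℕ →₀ ZMod 2) : twoPowMap (binD v) = 0 := by
  induction v using Finsupp.induction_linear with
  | zero => simp
  | add v w hv hw => rw [map_add, map_add, hv, hw, add_zero]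
  | single w r => simp [twoPowMap_binBoundary]

lemma IsSortedTwoPow.eq_of_perm {w w' : List ℕ} (hw : IsSortedTwoPow w) (hw' : IsSortedTwoPow w')
    (h : w.Perm w') : w = w' :=
  h.eq_of_pairwise (fun _ _ _ _ => le_antisymm) hw.2.pairwise hw'.2.pairwise

lemma eq_zero_of_twoPowMap_eq_zero {v : List ℕ →₀ ZMod 2}
    (hv : v ∈ Finsupp.supported (ZMod 2) (ZMod 2) {w | IsSortedTwoPow w})
    (h : twoPowMap v = 0) : v = 0 := by
  ext w
  by_contra hw
  have hws : IsSortedTwoPow w := hv (Finsupp.mem_support_iff.2 hw)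
  have h' := DFunLike.congr_fun h (w : Multiset ℕ)
  rw [twoPowMap, Finsupp.linearCombination_apply, Finsupp.sum, Finsupp.finsetSum_apply,
    Finset.sum_eq_single w] at h'
  · apply hw
    simpa [twoPowMultiset, if_pos hws.1] using h'
  · intro u hu hne
    have hus : IsSortedTwoPow u := hv hu
    rw [twoPowMultiset, if_pos hus.1, Finsupp.smul_apply, Finsupp.single_apply, if_neg, smul_zero]
    exact fun h => hne (hus.eq_of_perm hws (Multiset.coe_eq_coe.1 h))
  · intro h
    simp [Finsupp.notMem_support_iff.1 h]

end BinHomology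

section BinHomology

open Finset

lemma Finsupp.linearCombination_mem_of_supported {R X M : Type*} [Ring R] [AddCommGroup M]
    [Module R M] {φ : X → M} {s : Set X} {N : Submodule R M} (h : ∀ x ∈ s, φ x ∈ N) {v : X →₀ R}
    (hv : v ∈ Finsupp.supported R R s) : Finsupp.linearCombination R φ v ∈ N := by
  rw [Finsupp.linearCombination_apply]
  exact Submodule.sum_mem _ fun x hx => Submodule.smul_mem _ _ (h x (hv hx))

lemma homotopy_mem_span {w : List ℕ} (hw : ¬ IsSortedTwoPow w) :
    Finsupp.single w 1 + binD (mergeHomotopy w) + mergeH (binBoundary w) ∈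
      Submodule.span (ZMod 2) ((fun u => Finsupp.single u 1) '' {u | blockLT u w}) := by
  have hB : ∀ u ∈ {u : List ℕ | u.sum + u.length = w.sum + w.length}, binBoundary u ∈
      Finsupp.supported (ZMod 2) (ZMod 2) {u : List ℕ | u.sum + u.length = w.sum + w.length} := by
    intro u hu u' hu'
    rw [Finset.mem_coe, Finsupp.mem_support_iff,
      ← blockBoundary_eq_binBoundary (f := fun _ => 1) 0 u (by simp)] at hu'
    have := blockBoundary_support _ _ _ _ hu'
    rw [Set.mem_ofPred_eq] at hu ⊢
    omega
  have hM : ∀ u ∈ {u : List ℕ | u.sum + u.length = w.sum + w.length}, mergeHomotopy u ∈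
      Finsupp.supported (ZMod 2) (ZMod 2) {u : List ℕ | u.sum + u.length = w.sum + w.length} := by
    intro u hu u' hu'
    exact (mergeHomotopy_support (Finsupp.mem_support_iff.1 hu')).2.trans hu
  have h := homotopy_mem_lowSpan hw
  have h' : Finsupp.single w 1 + binD (mergeHomotopy w) + mergeH (binBoundary w) ∈
      Finsupp.supported (ZMod 2) (ZMod 2) {u : List ℕ | u.sum + u.length = w.sum + w.length} := by
    refine Submodule.add_mem _ (Submodule.add_mem _ (Finsupp.single_mem_supported _ _ rfl) ?_) ?_
    · exact Finsupp.linearCombination_mem_of_supported hB (hM w rfl)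
    · exact Finsupp.linearCombination_mem_of_supported hM (hB w rfl)
  rw [← Finsupp.supported_eq_span_single]
  exact fun u hu => ⟨h hu, h' hu⟩

theorem exists_eq_binD_add {n m : ℕ} {v : List ℕ →₀ ZMod 2}
    (hv : v ∈ Finsupp.supported (ZMod 2) (ZMod 2) (blockSet n m)) (h : binD v = 0) :
    ∃ y ∈ Finsupp.supported (ZMod 2) (ZMod 2) (blockSet n (m + 1)),
      ∃ c ∈ Finsupp.supported (ZMod 2) (ZMod 2) (blockSet n m ∩ {w | IsSortedTwoPow w}),
        v = binD y + c := by
  classical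
  have := mem_range_sup_span_of_homotopy (h := mergeH) binD_binD
    (x := fun w : List ℕ => Finsupp.single w (1 : ZMod 2))
    (by rw [← Set.image_univ, ← Finsupp.supported_eq_span_single, Finsupp.supported_univ])
    wellFounded_blockLT (crit := {w | IsSortedTwoPow w})
    (fun w hw => by simp [IsSortedTwoPow.binBoundary_eq_zero hw.1])
    (fun w hw => by simpa using homotopy_mem_span hw) h
  rw [← Finsupp.supported_eq_span_single] at this
  obtain ⟨_, ⟨y, rfl⟩, c, hc, rfl⟩ := Submodule.mem_sup.1 this
  refine ⟨y.filter (· ∈ blockSet n (m + 1)), fun w hw => ?_, c.filter (· ∈ blockSet n m),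
    fun w hw => ?_, ?_⟩
  · rw [Finset.mem_coe, Finsupp.support_filter, Finset.mem_filter] at hw
    exact hw.2
  · rw [Finset.mem_coe, Finsupp.support_filter, Finset.mem_filter] at hw
    exact ⟨hw.2, hc hw.1⟩
  · rw [binD_eq_blockD, ← blockD_filter (p := (· ∈ blockSet n m)), ← Finsupp.filter_add,
      ← binD_eq_blockD]
    · rw [eq_comm, Finsupp.filter_eq_self_iff]
      exact fun w hw => hv (Finsupp.mem_support_iff.2 hw)
    · rintro w w' h₁ h₂
      constructor <;> rintro ⟨h₃, h₄⟩ <;> constructor <;> omega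

theorem eq_zero_of_eq_binD {c y : List ℕ →₀ ZMod 2}
    (hc : c ∈ Finsupp.supported (ZMod 2) (ZMod 2) {w | IsSortedTwoPow w}) (h : c = binD y) :
    c = 0 :=
  eq_zero_of_twoPowMap_eq_zero hc (by rw [h, twoPowMap_binD])

section GradedHomology

variable {X : Type*} (A : ℕ → Set X) (d : (X →₀ ZMod 2) →ₗ[ZMod 2] (X →₀ ZMod 2)) (m : ℕ)

/-- Cycles supported on the basis elements of degree `m`. -/
noncomputable def gradedCycles : Submodule (ZMod 2) (X →₀ ZMod 2) :=
  Finsupp.supported (ZMod 2) (ZMod 2) (A m) ⊓ LinearMap.ker d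

/-- Boundaries of chains supported on the basis elements of degree `m + 1`. -/
noncomputable def gradedBoundaries : Submodule (ZMod 2) (gradedCycles A d m) :=
  ((Finsupp.supported (ZMod 2) (ZMod 2) (A (m + 1))).map d).comap (gradedCycles A d m).subtype

/-- The homology in degree `m` of a complex with a graded basis. -/
abbrev GradedHomology : Type _ :=
  gradedCycles A d m ⧸ gradedBoundaries A d m

end GradedHomology

lemma exists_nonempty_linearEquiv_gradedHomology (n m : ℕ) :
    Nonempty (GradedHomology (blockSet n) binD m ≃ₗ[ZMod 2]
      ((blockSet n m ∩ {w | IsSortedTwoPow w} : Set (List ℕ)) →₀ ZMod 2)) := by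
  have hle : Finsupp.supported (ZMod 2) (ZMod 2) (blockSet n m ∩ {w | IsSortedTwoPow w}) ≤
      gradedCycles (blockSet n) binD m := by
    intro c hc
    refine ⟨fun w hw => (hc hw).1, LinearMap.mem_ker.2 (Submodule.mem_bot (ZMod 2) |>.1 ?_)⟩
    refine Finsupp.linearCombination_mem_of_supported (fun w hw => ?_) hc
    exact Submodule.mem_bot _ |>.2 (IsSortedTwoPow.binBoundary_eq_zero hw.2.1)
  refine ⟨(LinearEquiv.ofBijective (Submodule.mkQ _ ∘ₗ Submodule.inclusion hle) ⟨?_, ?_⟩).symm ≪≫ₗ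
    Finsupp.supportedEquivFinsupp _⟩
  · refine (injective_iff_map_eq_zero _).2 fun c hc => ?_
    rw [LinearMap.comp_apply, Submodule.mkQ_apply, Submodule.Quotient.mk_eq_zero] at hc
    obtain ⟨y, -, hy⟩ := hc
    exact Subtype.ext (eq_zero_of_eq_binD (fun w hw => (c.2 hw).2) hy.symm)
  · intro z
    obtain ⟨⟨v, hv⟩, rfl⟩ := Submodule.mkQ_surjective _ z
    obtain ⟨y, hy, c, hc, h⟩ := exists_eq_binD_add hv.1 hv.2
    refine ⟨⟨c, hc⟩, ?_⟩
    rw [LinearMap.comp_apply, Submodule.mkQ_apply, Submodule.mkQ_apply, Submodule.Quotient.eq]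
    refine ⟨y, hy, ?_⟩
    change binD y = c - v
    rw [h, ZModModule.sub_eq_add, add_left_comm, ZModModule.add_self, add_zero]

end BinHomology

section Exponents

lemma IsTwoPow.two_pow_log_sub_one {a : ℕ} (ha : IsTwoPow a) : 2 ^ Nat.log 2 (a + 1) - 1 = a := by
  rw [ha, Nat.add_sub_cancel]

lemma log_two_pow_sub_one_add_one (i : ℕ) : Nat.log 2 (2 ^ i - 1 + 1) = i := by
  rw [Nat.sub_add_cancel Nat.one_le_two_pow, Nat.log_pow (by norm_num)]

/-- Sorted compositions into powers of two correspond to finitely supported multiplicities. -/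
noncomputable def sortedTwoPowEquiv : {w : List ℕ // IsSortedTwoPow w} ≃ (ℕ →₀ ℕ) where
  toFun w := Multiset.toFinsupp ((w.1 : Multiset ℕ).map fun a => Nat.log 2 (a + 1))
  invFun f := ⟨((Finsupp.toMultiset f).map fun i => 2 ^ i - 1).sort (· ≤ ·), by
    constructor
    · intro a ha
      rw [Multiset.mem_sort, Multiset.mem_map] at ha
      obtain ⟨i, -, rfl⟩ := ha
      exact isTwoPow_of_eq (k := i) (Nat.sub_add_cancel Nat.one_le_two_pow)
    · exact (Multiset.pairwise_sort _ _).isChain⟩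
  left_inv w := by
    obtain ⟨w, hw⟩ := w
    apply Subtype.ext
    have : ((w : Multiset ℕ).map fun a => Nat.log 2 (a + 1)).map (fun i => 2 ^ i - 1) = w := by
      rw [Multiset.map_map]
      conv_rhs => rw [← Multiset.map_id (w : Multiset ℕ)]
      exact Multiset.map_congr rfl fun a ha => (hw.1 a ha).two_pow_log_sub_one
    simp only [Multiset.toFinsupp_toMultiset, this]
    exact (List.Perm.eq_of_pairwise (fun _ _ _ _ => le_antisymm) (Multiset.pairwise_sort _ _)
      hw.2.pairwise (Multiset.coe_eq_coe.1 (Multiset.sort_eq _ _)))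
  right_inv f := by
    simp only [Multiset.sort_eq, Multiset.map_map, Function.comp_def, log_two_pow_sub_one_add_one,
      Multiset.map_id', Finsupp.toMultiset_toFinsupp]

lemma sum_sortedTwoPowEquiv (w : {w : List ℕ // IsSortedTwoPow w}) (φ : ℕ → ℕ) :
    (sortedTwoPowEquiv w).sum (fun i h => h * φ i) =
      (w.1.map fun a => φ (Nat.log 2 (a + 1))).sum := by
  have : ∀ s : Multiset ℕ, (Multiset.toFinsupp s).sum (fun i h => h * φ i) = (s.map φ).sum := by
    intro s
    induction s using Multiset.induction with
    | empty => simp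
    | cons a s ih =>
      rw [← Multiset.singleton_add, map_add, Finsupp.sum_add_index' (by simp) (by intros; ring), ih]
      simp
  change (Multiset.toFinsupp _).sum _ = _
  rw [this, Multiset.map_map]
  simp

/-- Sorted compositions of `n` with `n - m` parts, all powers of two. -/
noncomputable def blockSetSortedEquiv (n m : ℕ) :
    (blockSet n m ∩ {w | IsSortedTwoPow w} : Set (List ℕ)) ≃
      {f : ℕ →₀ ℕ // f.sum (fun i h => h * 2 ^ i) = n ∧ f.sum (fun i h => h * (2 ^ i - 1)) = m} :=
  (Equiv.subtypeEquivRight fun w => and_comm.trans (by rfl)).trans <|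
    (Equiv.subtypeSubtypeEquivSubtypeInter (fun w => IsSortedTwoPow w) (· ∈ blockSet n m)).symm.trans
      (sortedTwoPowEquiv.subtypeEquiv fun w => by
        have h₁ : w.1.map (fun a => 2 ^ Nat.log 2 (a + 1) - 1) = w.1 := by
          conv_rhs => rw [← List.map_id w.1]
          exact List.map_congr_left fun a ha => (w.2.1 a ha).two_pow_log_sub_one
        have h₂ : w.1.map (fun a => 2 ^ Nat.log 2 (a + 1)) = w.1.map (· + 1) :=
          List.map_congr_left fun a ha => w.2.1 a ha
        rw [sum_sortedTwoPowEquiv, sum_sortedTwoPowEquiv, h₁, h₂, List.sum_map_add]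
        simp [blockSet, and_comm])

end Exponents

section Comparison

open Finsupp

/-- A resolution by free modules with a graded basis `A` of an algebra `R` augmented over `𝔽₂`;
every basis element of degree `0` has augmentation `1`. -/
structure IsFreeResolution {R X : Type*} [Ring R] (ε : R →+* ZMod 2) (A : ℕ → Set X)
    (D : (X →₀ R) →ₗ[R] (X →₀ R)) : Prop where
  disjoint {k l : ℕ} {x : X} : x ∈ A k → x ∈ A l → k = l
  nonempty : (A 0).Nonempty
  boundary_zero {x : X} : x ∈ A 0 → D (single x 1) = 0
  boundary_succ {k : ℕ} {x : X} : x ∈ A (k + 1) → D (single x 1) ∈ supported R R (A k)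
  aug {x : X} : x ∈ A 1 → (D (single x 1)).sum (fun _ r => ε r) = 0
  boundary_boundary (v : X →₀ R) : D (D v) = 0
  exact_zero {v : X →₀ R} : v ∈ supported R R (A 0) → v.sum (fun _ r => ε r) = 0 →
    ∃ y ∈ supported R R (A 1), D y = v
  exact_succ {k : ℕ} {v : X →₀ R} : v ∈ supported R R (A (k + 1)) → D v = 0 →
    ∃ y ∈ supported R R (A (k + 2)), D y = v

variable {R : Type*} [Ring R] {ε : R →+* ZMod 2}

/-- Linear maps out of a module with graded basis can be built by recursion on the degree. -/
lemma exists_linearMap_of_degree {X M : Type*} [AddCommGroup M] [Module R M] {A : ℕ → Set X}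
    (hA : ∀ {k l : ℕ} {x : X}, x ∈ A k → x ∈ A l → k = l)
    (T : ((X →₀ R) →ₗ[R] M) → ℕ → X → M → Prop)
    (hloc : ∀ L L' k x y, x ∈ A k → (∀ j < k, ∀ x' ∈ A j, L (single x' 1) = L' (single x' 1)) →
      T L k x y → T L' k x y)
    (hex : ∀ L k x, x ∈ A k → (∀ j < k, ∀ x' ∈ A j, T L j x' (L (single x' 1))) →
      ∃ y, T L k x y) :
    ∃ L : (X →₀ R) →ₗ[R] M, ∀ k, ∀ x ∈ A k, T L k x (L (single x 1)) := by
  classical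
  let step : ℕ → ((X →₀ R) →ₗ[R] M) → ((X →₀ R) →ₗ[R] M) := fun k L =>
    Finsupp.lift M R X fun x => if h : x ∈ A k ∧ ∃ y, T L k x y then h.2.choose else L (single x 1)
  let S : ℕ → ((X →₀ R) →ₗ[R] M) := fun k => Nat.rec 0 step k
  have hstep : ∀ k x, S (k + 1) (single x 1) =
      if h : x ∈ A k ∧ ∃ y, T (S k) k x y then h.2.choose else S k (single x 1) := by
    intro k x
    change (Finsupp.lift M R X _) (single x 1) = _
    simp only [Finsupp.lift_apply, zero_smul, Finsupp.sum_single_index, one_smul, S]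
  have hstable : ∀ k l x, x ∈ A k → k + 1 ≤ l → S l (single x 1) = S (k + 1) (single x 1) := by
    intro k l x hx hl
    induction l, hl using Nat.le_induction with
    | base => rfl
    | succ l hl ih =>
      rw [hstep, dif_neg, ih]
      rintro ⟨h, -⟩
      have := hA hx h
      omega
  let L : (X →₀ R) →ₗ[R] M := Finsupp.lift M R X fun x =>
    if h : ∃ k, x ∈ A k then S (h.choose + 1) (single x 1) else 0
  have hL : ∀ k, ∀ x ∈ A k, L (single x 1) = S (k + 1) (single x 1) := by
    intro k x hx
    have h : ∃ k, x ∈ A k := ⟨k, hx⟩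
    have : L (single x 1) = S (h.choose + 1) (single x 1) := by
      simp only [L, Finsupp.lift_apply, zero_smul, Finsupp.sum_single_index, one_smul, dif_pos h]
    rw [this, hA h.choose_spec hx]
  have hLS : ∀ k, ∀ j < k, ∀ x' ∈ A j, S k (single x' 1) = L (single x' 1) := by
    intro k j hj x hx
    rw [hL j x hx, hstable j k x hx hj]
  refine ⟨L, fun k => ?_⟩
  induction k using Nat.strong_induction_on with
  | _ k ih =>
    intro x hx
    have h : ∃ y, T (S k) k x y := by
      obtain ⟨y, hy⟩ := hex L k x hx ih
      exact ⟨y, hloc L (S k) k x y hx (fun j hj x' hx' => (hLS k j hj x' hx').symm) hy⟩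
    rw [hL k x hx, hstep, dif_pos ⟨hx, h⟩]
    exact hloc (S k) L k x _ hx (hLS k) h.choose_spec

lemma Finsupp.map_eq_map_of_supported {X M : Type*} [AddCommGroup M] [Module R M] {s : Set X}
    {L L' : (X →₀ R) →ₗ[R] M} (h : ∀ x ∈ s, L (single x 1) = L' (single x 1)) {v : X →₀ R}
    (hv : v ∈ supported R R s) : L v = L' v := by
  rw [Finsupp.supported_eq_span_single] at hv
  induction hv using Submodule.span_induction with
  | mem x hx => obtain ⟨x, hx, rfl⟩ := hx; exact h x hx
  | zero => simp
  | add x y _ _ hx hy => simp [hx, hy]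
  | smul r x _ hx => simp [hx]

lemma Finsupp.map_mem_of_supported {X M : Type*} [AddCommGroup M] [Module R M] {s : Set X}
    {L : (X →₀ R) →ₗ[R] M} {N : Submodule R M} (h : ∀ x ∈ s, L (single x 1) ∈ N) {v : X →₀ R}
    (hv : v ∈ supported R R s) : L v ∈ N := by
  rw [Finsupp.supported_eq_span_single] at hv
  exact (Submodule.span_le (p := N.comap L)).2 (by rintro _ ⟨x, hx, rfl⟩; exact h x hx) hv

namespace IsFreeResolution

variable {X Y : Type*} {A : ℕ → Set X} {B : ℕ → Set Y} {D : (X →₀ R) →ₗ[R] (X →₀ R)}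
  {E : (Y →₀ R) →ₗ[R] (Y →₀ R)}

/-- The sum of the augmentations of the coefficients. -/
noncomputable def augSum (ε : R →+* ZMod 2) (v : X →₀ R) : ZMod 2 := v.sum fun _ r => ε r

lemma augSum_add (v w : X →₀ R) : augSum ε (v + w) = augSum ε v + augSum ε w :=
  Finsupp.sum_add_index' (by simp) (by simp)

lemma augSum_single (x : X) (r : R) : augSum ε (single x r) = ε r := by
  simp [augSum, Finsupp.sum_single_index]

lemma augSum_smul (r : R) (v : X →₀ R) : augSum ε (r • v) = ε r * augSum ε v := by
  induction v using Finsupp.induction_linear with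
  | zero => simp [augSum]
  | add v w hv hw => rw [smul_add, augSum_add, augSum_add, hv, hw, mul_add]
  | single x s => rw [Finsupp.smul_single, augSum_single, augSum_single, smul_eq_mul, map_mul]

lemma augSum_map (L : (X →₀ R) →ₗ[R] (Y →₀ R)) (c : ZMod 2) {s : Set X}
    (h : ∀ x ∈ s, augSum ε (L (single x 1)) = c) {v : X →₀ R} (hv : v ∈ supported R R s) :
    augSum ε (L v) = c * augSum ε v := by
  rw [Finsupp.supported_eq_span_single] at hv
  induction hv using Submodule.span_induction with
  | mem x hx => obtain ⟨x, hx, rfl⟩ := hx; simp [h x hx, augSum_single]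
  | zero => simp [augSum]
  | add x y _ _ hx hy => rw [map_add, augSum_add, augSum_add, hx, hy, mul_add]
  | smul r x _ hx => rw [map_smul, augSum_smul, augSum_smul, hx, mul_left_comm]

theorem exists_lift (hD : IsFreeResolution ε A D) (hE : IsFreeResolution ε B E) :
    ∃ L : (X →₀ R) →ₗ[R] (Y →₀ R), (∀ k, ∀ x ∈ A k, L (single x 1) ∈ supported R R (B k)) ∧
      (∀ k, ∀ x ∈ A k, E (L (single x 1)) = L (D (single x 1))) ∧
      ∀ x ∈ A 0, augSum ε (L (single x 1)) = 1 := by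
  obtain ⟨L, hL⟩ := exists_linearMap_of_degree (M := Y →₀ R) hD.disjoint
    (fun L k x y => y ∈ supported R R (B k) ∧ E y = L (D (single x 1)) ∧ (k = 0 → augSum ε y = 1))
    (by
      rintro L L' k x y hx hLL ⟨h₁, h₂, h₃⟩
      refine ⟨h₁, h₂.trans ?_, h₃⟩
      cases k with
      | zero => rw [hD.boundary_zero hx, map_zero, map_zero]
      | succ k => exact Finsupp.map_eq_map_of_supported (hLL k (by omega)) (hD.boundary_succ hx))
    (by
      intro L k x hx ih
      cases k with
      | zero =>
        obtain ⟨y, hy⟩ := hE.nonempty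
        refine ⟨single y 1, single_mem_supported _ _ hy, ?_, fun _ => ?_⟩
        · rw [hE.boundary_zero hy, hD.boundary_zero hx, map_zero]
        · rw [augSum_single, map_one]
      | succ k =>
        have hs := Finsupp.map_mem_of_supported (fun x' hx' => (ih k (by omega) x' hx').1)
          (hD.boundary_succ hx)
        cases k with
        | zero =>
          obtain ⟨y, hy, h⟩ := hE.exact_zero hs (by
            have := augSum_map L 1 (fun x' hx' => (ih 0 (by omega) x' hx').2.2 rfl) (hD.boundary_succ hx)
            rw [one_mul] at this
            exact this.trans (hD.aug hx))
          exact ⟨y, hy, h, by simp⟩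
        | succ k =>
          obtain ⟨y, hy, h⟩ := hE.exact_succ hs (by
            have := Finsupp.map_eq_map_of_supported (L := E ∘ₗ L) (L' := L ∘ₗ D)
              (fun x' hx' => (ih (k + 1) (by omega) x' hx').2.1) (hD.boundary_succ hx)
            simpa [hD.boundary_boundary] using this)
          exact ⟨y, hy, h, by simp⟩)
  exact ⟨L, fun k x hx => (hL k x hx).1, fun k x hx => (hL k x hx).2.1,
    fun x hx => (hL 0 x hx).2.2 rfl⟩

theorem exists_homotopy [Module (ZMod 2) R] (hD : IsFreeResolution ε A D)
    {N : (X →₀ R) →ₗ[R] (X →₀ R)}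
    (h₁ : ∀ k, ∀ x ∈ A k, N (single x 1) ∈ supported R R (A k))
    (h₂ : ∀ k, ∀ x ∈ A k, D (N (single x 1)) = N (D (single x 1)))
    (h₃ : ∀ x ∈ A 0, augSum ε (N (single x 1)) = 0) :
    ∃ S : (X →₀ R) →ₗ[R] (X →₀ R), (∀ k, ∀ x ∈ A k, S (single x 1) ∈ supported R R (A (k + 1))) ∧
      ∀ k, ∀ x ∈ A k, D (S (single x 1)) + S (D (single x 1)) = N (single x 1) := by
  obtain ⟨L, hL⟩ := exists_linearMap_of_degree (M := X →₀ R) hD.disjoint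
    (fun L k x y => y ∈ supported R R (A (k + 1)) ∧ D y + L (D (single x 1)) = N (single x 1))
    (by
      rintro L L' k x y hx hLL ⟨h₁, h₂⟩
      refine ⟨h₁, ?_⟩
      rw [← h₂]
      congr 1
      cases k with
      | zero => rw [hD.boundary_zero hx, map_zero, map_zero]
      | succ k => exact (Finsupp.map_eq_map_of_supported (hLL k (by omega)) (hD.boundary_succ hx)).symm)
    (by
      intro L k x hx ih
      cases k with
      | zero =>
        obtain ⟨y, hy, h⟩ := hD.exact_zero (h₁ 0 x hx) (h₃ x hx)
        exact ⟨y, hy, by rw [hD.boundary_zero hx, map_zero, add_zero, h]⟩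
      | succ k =>
        have hs := Finsupp.map_mem_of_supported (fun x' hx' => (ih k (by omega) x' hx').1)
          (hD.boundary_succ hx)
        obtain ⟨y, hy, h⟩ := hD.exact_succ (v := N (single x 1) + L (D (single x 1)))
          (Submodule.add_mem _ (h₁ _ x hx) hs) (by
            have := Finsupp.map_eq_map_of_supported (L := D ∘ₗ L + L ∘ₗ D) (L' := N)
              (fun x' hx' => (ih k (by omega) x' hx').2) (hD.boundary_succ hx)
            simp only [LinearMap.add_apply, LinearMap.comp_apply, hD.boundary_boundary, map_zero,
              add_zero] at this
            rw [map_add, h₂ _ x hx, this, ZModModule.add_self])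
        exact ⟨y, hy, by rw [h, add_assoc, ZModModule.add_self, add_zero]⟩)
  exact ⟨L, fun k x hx => (hL k x hx).1, fun k x hx => (hL k x hx).2⟩

end IsFreeResolution

end Comparison

section Reduction

open Finsupp IsFreeResolution

variable {X Y : Type*} {A : ℕ → Set X} {B : ℕ → Set Y}

/-- A chain map between complexes with graded bases. -/
structure IsGradedChainMap (A : ℕ → Set X) (B : ℕ → Set Y)
    (d : (X →₀ ZMod 2) →ₗ[ZMod 2] (X →₀ ZMod 2)) (e : (Y →₀ ZMod 2) →ₗ[ZMod 2] (Y →₀ ZMod 2))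
    (l : (X →₀ ZMod 2) →ₗ[ZMod 2] (Y →₀ ZMod 2)) : Prop where
  mem {k : ℕ} {v : X →₀ ZMod 2} : v ∈ supported (ZMod 2) (ZMod 2) (A k) →
    l v ∈ supported (ZMod 2) (ZMod 2) (B k)
  comm {k : ℕ} {v : X →₀ ZMod 2} : v ∈ supported (ZMod 2) (ZMod 2) (A k) → e (l v) = l (d v)

variable {d : (X →₀ ZMod 2) →ₗ[ZMod 2] (X →₀ ZMod 2)}
  {e : (Y →₀ ZMod 2) →ₗ[ZMod 2] (Y →₀ ZMod 2)}
  {l : (X →₀ ZMod 2) →ₗ[ZMod 2] (Y →₀ ZMod 2)} {l' : (Y →₀ ZMod 2) →ₗ[ZMod 2] (X →₀ ZMod 2)}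

namespace IsGradedChainMap

/-- The map induced on cycles. -/
noncomputable def cyclesMap (h : IsGradedChainMap A B d e l) (m : ℕ) :
    gradedCycles A d m →ₗ[ZMod 2] gradedCycles B e m :=
  l.restrict fun v hv => ⟨h.mem hv.1, LinearMap.mem_ker.2 <| by
    rw [h.comm hv.1, LinearMap.mem_ker.1 hv.2, map_zero]⟩

/-- The map induced on homology. -/
noncomputable def homologyMap (h : IsGradedChainMap A B d e l) (m : ℕ) :
    GradedHomology A d m →ₗ[ZMod 2] GradedHomology B e m :=
  Submodule.mapQ _ _ (h.cyclesMap m) (by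
    rintro ⟨v, hv⟩ ⟨y, hy, hyv⟩
    exact ⟨l y, h.mem hy, (h.comm hy).trans (congrArg l hyv)⟩)

lemma homologyMap_comp (h : IsGradedChainMap A B d e l) (h' : IsGradedChainMap B A e d l')
    {m : ℕ} {s : (X →₀ ZMod 2) →ₗ[ZMod 2] (X →₀ ZMod 2)}
    (hs : ∀ v ∈ supported (ZMod 2) (ZMod 2) (A m), s v ∈ supported (ZMod 2) (ZMod 2) (A (m + 1)))
    (hs' : ∀ v ∈ supported (ZMod 2) (ZMod 2) (A m), d (s v) + s (d v) = v + l' (l v)) :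
    h'.homologyMap m ∘ₗ h.homologyMap m = LinearMap.id := by
  apply Submodule.linearMap_qext
  ext1 ⟨v, hv⟩
  change Submodule.Quotient.mk (h'.cyclesMap m (h.cyclesMap m ⟨v, hv⟩)) =
    Submodule.Quotient.mk ⟨v, hv⟩
  rw [Submodule.Quotient.eq]
  refine ⟨s v, hs v hv.1, ?_⟩
  have := hs' v hv.1
  rw [LinearMap.mem_ker.1 hv.2, map_zero, add_zero] at this
  rw [this, add_comm, ← ZModModule.sub_eq_add]
  rfl

end IsGradedChainMap

variable {R : Type*} [Ring R] (ε : R →+* ZMod 2)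

/-- The reduction of a linear map between free modules along the augmentation. -/
noncomputable def reduceMap (L : (X →₀ R) →ₗ[R] (Y →₀ R)) :
    (X →₀ ZMod 2) →ₗ[ZMod 2] (Y →₀ ZMod 2) :=
  Finsupp.linearCombination (ZMod 2) fun x => (L (single x 1)).mapRange ε (map_zero ε)

lemma reduceMap_single (L : (X →₀ R) →ₗ[R] (Y →₀ R)) (x : X) :
    reduceMap ε L (single x 1) = (L (single x 1)).mapRange ε (map_zero ε) := by
  simp [reduceMap]

lemma reduceMap_mapRange (L : (X →₀ R) →ₗ[R] (Y →₀ R)) (v : X →₀ R) :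
    reduceMap ε L (v.mapRange ε (map_zero ε)) = (L v).mapRange ε (map_zero ε) := by
  induction v using Finsupp.induction_linear with
  | zero => simp
  | add v w hv hw => simp only [Finsupp.mapRange_add (map_add ε), map_add, hv, hw]
  | single x r =>
    rw [Finsupp.mapRange_single, reduceMap, Finsupp.linearCombination_single,
      show single x r = r • single x 1 by simp, map_smul]
    ext y
    simp

lemma reduceMap_mem {s : Set X} {t : Set Y} {L : (X →₀ R) →ₗ[R] (Y →₀ R)}
    (h : ∀ x ∈ s, L (single x 1) ∈ supported R R t) {v : X →₀ ZMod 2}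
    (hv : v ∈ supported (ZMod 2) (ZMod 2) s) :
    reduceMap ε L v ∈ supported (ZMod 2) (ZMod 2) t :=
  Finsupp.map_mem_of_supported (fun x hx => by
    rw [reduceMap_single]
    exact fun y hy => h x hx (Finsupp.support_mapRange hy)) hv

variable {ε} {D : (X →₀ R) →ₗ[R] (X →₀ R)} {E : (Y →₀ R) →ₗ[R] (Y →₀ R)}
  {L : (X →₀ R) →ₗ[R] (Y →₀ R)} {L' : (Y →₀ R) →ₗ[R] (X →₀ R)}

lemma isGradedChainMap_reduceMap
    (h₁ : ∀ k, ∀ x ∈ A k, L (single x 1) ∈ supported R R (B k))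
    (h₂ : ∀ k, ∀ x ∈ A k, E (L (single x 1)) = L (D (single x 1))) :
    IsGradedChainMap A B (reduceMap ε D) (reduceMap ε E) (reduceMap ε L) where
  mem {k _} hv := reduceMap_mem ε (h₁ k) hv
  comm {k v} hv := by
    refine Finsupp.map_eq_map_of_supported (L := reduceMap ε E ∘ₗ reduceMap ε L)
      (L' := reduceMap ε L ∘ₗ reduceMap ε D) (fun x hx => ?_) hv
    rw [LinearMap.comp_apply, LinearMap.comp_apply, reduceMap_single, reduceMap_single,
      reduceMap_mapRange, reduceMap_mapRange, h₂ k x hx]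

lemma IsFreeResolution.exists_reduced_homotopy [Module (ZMod 2) R] (hD : IsFreeResolution ε A D)
    (h₁ : ∀ k, ∀ x ∈ A k, L (single x 1) ∈ supported R R (B k))
    (h₂ : ∀ k, ∀ x ∈ A k, E (L (single x 1)) = L (D (single x 1)))
    (h₃ : ∀ x ∈ A 0, augSum ε (L (single x 1)) = 1)
    (h₁' : ∀ k, ∀ x ∈ B k, L' (single x 1) ∈ supported R R (A k))
    (h₂' : ∀ k, ∀ x ∈ B k, D (L' (single x 1)) = L' (E (single x 1)))
    (h₃' : ∀ x ∈ B 0, augSum ε (L' (single x 1)) = 1) (m : ℕ) :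
    ∃ s : (X →₀ ZMod 2) →ₗ[ZMod 2] (X →₀ ZMod 2),
      (∀ v ∈ supported (ZMod 2) (ZMod 2) (A m), s v ∈ supported (ZMod 2) (ZMod 2) (A (m + 1))) ∧
      ∀ v ∈ supported (ZMod 2) (ZMod 2) (A m), reduceMap ε D (s v) + s (reduceMap ε D v) =
        v + reduceMap ε L' (reduceMap ε L v) := by
  obtain ⟨S, hS, hS'⟩ := hD.exists_homotopy (N := LinearMap.id + L' ∘ₗ L)
    (fun k x hx => Submodule.add_mem _ (single_mem_supported _ _ hx)
      (Finsupp.map_mem_of_supported (h₁' k) (h₁ k x hx)))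
    (fun k x hx => by
      have := Finsupp.map_eq_map_of_supported (L := D ∘ₗ L') (L' := L' ∘ₗ E) (h₂' k) (h₁ k x hx)
      simp only [LinearMap.comp_apply] at this
      simp only [LinearMap.add_apply, LinearMap.id_apply, LinearMap.comp_apply, map_add, this,
        h₂ k x hx])
    (fun x hx => by
      rw [LinearMap.add_apply, augSum_add, LinearMap.id_apply, augSum_single, map_one,
        LinearMap.comp_apply, augSum_map L' 1 h₃' (h₁ 0 x hx), one_mul, h₃ x hx]
      rfl)
  refine ⟨reduceMap ε S, fun v hv => reduceMap_mem ε (hS m) hv, fun v hv => ?_⟩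
  refine Finsupp.map_eq_map_of_supported
    (L := reduceMap ε D ∘ₗ reduceMap ε S + reduceMap ε S ∘ₗ reduceMap ε D)
    (L' := LinearMap.id + reduceMap ε L' ∘ₗ reduceMap ε L) (fun x hx => ?_) hv
  have := congrArg (Finsupp.mapRange ε (map_zero ε)) (hS' m x hx)
  rw [Finsupp.mapRange_add (map_add ε), LinearMap.add_apply, Finsupp.mapRange_add (map_add ε),
    LinearMap.id_apply, Finsupp.mapRange_single, map_one, LinearMap.comp_apply] at this
  simpa only [LinearMap.add_apply, LinearMap.comp_apply, LinearMap.id_apply, reduceMap_single,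
    reduceMap_mapRange] using this

theorem IsFreeResolution.nonempty_gradedHomology_equiv [Module (ZMod 2) R]
    (hD : IsFreeResolution ε A D) (hE : IsFreeResolution ε B E) (m : ℕ) :
    Nonempty (GradedHomology A (reduceMap ε D) m ≃ₗ[ZMod 2]
      GradedHomology B (reduceMap ε E) m) := by
  obtain ⟨L, h₁, h₂, h₃⟩ := hD.exists_lift hE
  obtain ⟨L', h₁', h₂', h₃'⟩ := hE.exists_lift hD
  obtain ⟨s, hs, hs'⟩ := hD.exists_reduced_homotopy h₁ h₂ h₃ h₁' h₂' h₃' m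
  obtain ⟨t, ht, ht'⟩ := hE.exists_reduced_homotopy h₁' h₂' h₃' h₁ h₂ h₃ m
  have hL := isGradedChainMap_reduceMap (ε := ε) h₁ h₂
  have hL' := isGradedChainMap_reduceMap (ε := ε) h₁' h₂'
  exact ⟨LinearEquiv.ofLinearMap (hL.homologyMap m) (hL'.homologyMap m)
    (hL'.homologyMap_comp hL ht ht') (hL.homologyMap_comp hL' hs hs')⟩

end Reduction

section BarResolution

open Finsupp IsFreeResolution

variable (G : Type) [Group G]

/-- The augmentation of the group algebra. -/
noncomputable def groupAug : MonoidAlgebra (ZMod 2) G →+* ZMod 2 :=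
  (MonoidAlgebra.lift (ZMod 2) (ZMod 2) G 1).toRingHom

variable {G}

lemma groupAug_of (g : G) : groupAug G (MonoidAlgebra.of (ZMod 2) G g) = 1 := by
  simp [groupAug]

variable (G) in
/-- The basis of the bar resolution in degree `k`. -/
def barBasis (k : ℕ) : Set (Σ m, Fin m → G) := {x | x.1 = k}

/-- The boundary in the bar resolution. -/
noncomputable def barBoundary : (Σ m, Fin m → G) → (Σ m, Fin m → G) →₀ MonoidAlgebra (ZMod 2) G
  | ⟨0, _⟩ => 0
  | ⟨m + 1, g⟩ => single ⟨m, fun k => g k.succ⟩ (MonoidAlgebra.of (ZMod 2) G (g 0)) +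
      ∑ j : Fin m, single ⟨m, Fin.contractNth j.castSucc (· * ·) g⟩ 1 +
      single ⟨m, fun k => g k.castSucc⟩ 1

variable (G) in
/-- The differential of the bar resolution. -/
noncomputable def barResD : ((Σ m, Fin m → G) →₀ MonoidAlgebra (ZMod 2) G)
    →ₗ[MonoidAlgebra (ZMod 2) G] ((Σ m, Fin m → G) →₀ MonoidAlgebra (ZMod 2) G) :=
  Finsupp.linearCombination _ barBoundary

lemma barResD_single (x : Σ m, Fin m → G) (r : MonoidAlgebra (ZMod 2) G) :
    barResD G (single x r) = r • barBoundary x := by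
  simp [barResD]

/-- Put a group element in front of a bar. -/
def barCons (g : G) (x : Σ m, Fin m → G) : Σ m, Fin m → G := ⟨x.1 + 1, Fin.cons g x.2⟩

variable (G) in
/-- The contracting homotopy of the bar resolution. -/
noncomputable def barCone : ((Σ m, Fin m → G) →₀ MonoidAlgebra (ZMod 2) G)
    →ₗ[ZMod 2] ((Σ m, Fin m → G) →₀ MonoidAlgebra (ZMod 2) G) :=
  Finsupp.lsum (ZMod 2) fun x =>
    (Finsupp.linearCombination (ZMod 2) fun g => single (barCons g x) 1) ∘ₗ
      (MonoidAlgebra.coeffLinearEquiv (ZMod 2)).toLinearMap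

lemma barCone_single_of (x : Σ m, Fin m → G) (g : G) :
    barCone G (single x (MonoidAlgebra.of (ZMod 2) G g)) = single (barCons g x) 1 := by
  simp [barCone]

lemma contractNth_zero_cons {m : ℕ} (g : G) (w : Fin (m + 1) → G) :
    Fin.contractNth (Fin.castSucc 0) (· * ·) (Fin.cons g w : Fin (m + 2) → G) =
      Fin.cons (g * w 0) fun k => w k.succ := by
  ext i
  induction i using Fin.cases with
  | zero => simp [Fin.contractNth]
  | succ i => simp [Fin.contractNth]

lemma contractNth_succ_cons {m : ℕ} (g : G) (w : Fin (m + 1) → G) (j : Fin m) :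
    Fin.contractNth (Fin.castSucc j.succ) (· * ·) (Fin.cons g w : Fin (m + 2) → G) =
      Fin.cons g (Fin.contractNth j.castSucc (· * ·) w) := by
  ext i
  induction i using Fin.cases with
  | zero => simp [Fin.contractNth]
  | succ i => simp [Fin.contractNth]

lemma cons_comp_castSucc {α : Type*} {m : ℕ} (g : α) (w : Fin (m + 1) → α) :
    (fun k : Fin (m + 1) => (Fin.cons g w : Fin (m + 2) → α) k.castSucc) =
      Fin.cons g fun k => w k.castSucc := by
  ext i
  induction i using Fin.cases with
  | zero => rfl
  | succ i => simp

lemma barBoundary_barCons_succ (m : ℕ) (w : Fin (m + 1) → G) (g : G) :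
    barBoundary (barCons g ⟨m + 1, w⟩) = single ⟨m + 1, w⟩ (MonoidAlgebra.of (ZMod 2) G g) +
      (single (barCons (g * w 0) ⟨m, fun k => w k.succ⟩) 1 +
        ∑ j : Fin m, single (barCons g ⟨m, Fin.contractNth j.castSucc (· * ·) w⟩) 1 +
        single (barCons g ⟨m, fun k => w k.castSucc⟩) 1) := by
  change single (⟨m + 1, fun k : Fin (m + 1) => (Fin.cons g w : Fin (m + 2) → G) k.succ⟩ :
      Σ m, Fin m → G) (MonoidAlgebra.of (ZMod 2) G ((Fin.cons g w : Fin (m + 2) → G) 0)) +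
      ∑ j : Fin (m + 1), single (⟨m + 1, Fin.contractNth j.castSucc (· * ·)
        (Fin.cons g w : Fin (m + 2) → G)⟩ : Σ m, Fin m → G) 1 +
      single (⟨m + 1, fun k : Fin (m + 1) => (Fin.cons g w : Fin (m + 2) → G) k.castSucc⟩ :
        Σ m, Fin m → G) 1 = _
  rw [Fin.sum_univ_succ, contractNth_zero_cons, cons_comp_castSucc]
  simp only [contractNth_succ_cons, Fin.cons_succ, Fin.cons_zero, barCons, add_assoc]

lemma barResD_barCone_of (m : ℕ) (w : Fin (m + 1) → G) (g : G) :
    barResD G (barCone G (single ⟨m + 1, w⟩ (MonoidAlgebra.of (ZMod 2) G g))) +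
      barCone G (barResD G (single ⟨m + 1, w⟩ (MonoidAlgebra.of (ZMod 2) G g))) =
    single ⟨m + 1, w⟩ (MonoidAlgebra.of (ZMod 2) G g) := by
  have h : barCone G (barResD G (single ⟨m + 1, w⟩ (MonoidAlgebra.of (ZMod 2) G g))) =
      single (barCons (g * w 0) ⟨m, fun k => w k.succ⟩) 1 +
        ∑ j : Fin m, single (barCons g ⟨m, Fin.contractNth j.castSucc (· * ·) w⟩) 1 +
        single (barCons g ⟨m, fun k => w k.castSucc⟩) 1 := by
    rw [barResD_single, barBoundary]
    simp only [smul_add, Finset.smul_sum, smul_single, smul_eq_mul, mul_one, ← map_mul,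
      map_add, map_sum, barCone_single_of]
  rw [barCone_single_of, h, barResD_single, one_smul, barBoundary_barCons_succ, add_assoc,
    ZModModule.add_self, add_zero]

lemma barResD_barCone_of_zero (w : Fin 0 → G) (g : G) :
    barResD G (barCone G (single ⟨0, w⟩ (MonoidAlgebra.of (ZMod 2) G g))) =
    single ⟨0, w⟩ (MonoidAlgebra.of (ZMod 2) G g) + single ⟨0, w⟩ 1 := by
  rw [barCone_single_of, barResD_single, one_smul]
  change single (⟨0, _⟩ : Σ m, Fin m → G) (MonoidAlgebra.of (ZMod 2) G g) +
    ∑ j : Fin 0, _ + single (⟨0, _⟩ : Σ m, Fin m → G) 1 = _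
  simp [Subsingleton.elim _ w]

/-- Additive induction on the chains of degree `k` in the bar resolution. -/
lemma barInduction {k : ℕ} {P : ((Σ m, Fin m → G) →₀ MonoidAlgebra (ZMod 2) G) → Prop}
    (hzero : P 0) (hadd : ∀ u v, P u → P v → P (u + v))
    (hof : ∀ (w : Fin k → G) (g : G), P (single ⟨k, w⟩ (MonoidAlgebra.of (ZMod 2) G g)))
    {v : (Σ m, Fin m → G) →₀ MonoidAlgebra (ZMod 2) G}
    (hv : v ∈ supported (MonoidAlgebra (ZMod 2) G) (MonoidAlgebra (ZMod 2) G) (barBasis G k)) :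
    P v := by
  rw [← Finsupp.sum_single v]
  refine Finset.sum_induction _ P hadd hzero fun x hx => ?_
  obtain ⟨l, w⟩ := x
  obtain rfl : l = k := (Finsupp.mem_supported _ v).1 hv hx
  induction v ⟨l, w⟩ using MonoidAlgebra.induction_linear with
  | zero => simpa using hzero
  | add a b ha hb => rw [single_add]; exact hadd _ _ ha hb
  | single g c =>
    obtain rfl | rfl : c = 0 ∨ c = 1 := by revert c; decide
    · simpa using hzero
    · exact hof w g

lemma barResD_barCone {m : ℕ} {v : (Σ m, Fin m → G) →₀ MonoidAlgebra (ZMod 2) G}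
    (hv : v ∈ supported (MonoidAlgebra (ZMod 2) G) (MonoidAlgebra (ZMod 2) G)
      (barBasis G (m + 1))) :
    barResD G (barCone G v) + barCone G (barResD G v) = v := by
  refine barInduction (P := fun v => barResD G (barCone G v) + barCone G (barResD G v) = v)
    (by simp) (fun u v hu hv => ?_) (barResD_barCone_of m) hv
  conv_rhs => rw [← hu, ← hv]
  simp only [map_add]
  abel

lemma barResD_barCone_zero {v : (Σ m, Fin m → G) →₀ MonoidAlgebra (ZMod 2) G}
    (hv : v ∈ supported (MonoidAlgebra (ZMod 2) G) (MonoidAlgebra (ZMod 2) G)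
      (barBasis G 0)) :
    barResD G (barCone G v) = v + augSum (groupAug G) v • single ⟨0, Fin.elim0⟩ 1 := by
  refine barInduction (P := fun v => barResD G (barCone G v) = v + augSum (groupAug G) v •
    single ⟨0, Fin.elim0⟩ 1) (by simp [augSum]) (fun u v hu hv => ?_) (fun w g => ?_) hv
  · rw [map_add, map_add, hu, hv, augSum_add, add_smul]
    abel
  · rw [barResD_barCone_of_zero, augSum_single, groupAug_of, one_smul, Subsingleton.elim w]

lemma barCone_mem_supported {m : ℕ} {v : (Σ m, Fin m → G) →₀ MonoidAlgebra (ZMod 2) G}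
    (hv : v ∈ supported (MonoidAlgebra (ZMod 2) G) (MonoidAlgebra (ZMod 2) G) (barBasis G m)) :
    barCone G v ∈ supported (MonoidAlgebra (ZMod 2) G) (MonoidAlgebra (ZMod 2) G)
      (barBasis G (m + 1)) := by
  refine barInduction (P := fun v => barCone G v ∈ supported (MonoidAlgebra (ZMod 2) G)
    (MonoidAlgebra (ZMod 2) G) (barBasis G (m + 1))) (by simp) (fun u v hu hv => ?_)
    (fun w g => ?_) hv
  · rw [map_add]; exact add_mem hu hv
  · rw [barCone_single_of]
    exact single_mem_supported _ _ rfl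

lemma barResD_single_mem_supported {m : ℕ} {x : Σ m, Fin m → G} (hx : x ∈ barBasis G (m + 1)) :
    barResD G (single x 1) ∈ supported (MonoidAlgebra (ZMod 2) G) (MonoidAlgebra (ZMod 2) G)
      (barBasis G m) := by
  obtain ⟨l, w⟩ := x
  obtain rfl : l = m + 1 := hx
  rw [barResD_single, one_smul, barBoundary]
  exact add_mem (add_mem (single_mem_supported _ _ rfl)
    (sum_mem fun _ _ => single_mem_supported _ _ rfl)) (single_mem_supported _ _ rfl)

lemma augSum_barResD_single {x : Σ m, Fin m → G} (hx : x ∈ barBasis G 1) :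
    augSum (groupAug G) (barResD G (single x 1)) = 0 := by
  obtain ⟨l, w⟩ := x
  obtain rfl : l = 1 := hx
  rw [barResD_single, one_smul, barBoundary]
  simp only [augSum_add, augSum_single, Finset.univ_eq_empty, Finset.sum_empty, add_zero,
    groupAug_of, map_one]
  decide

lemma barResD_single_zero {x : Σ m, Fin m → G} (hx : x ∈ barBasis G 0) :
    barResD G (single x 1) = 0 := by
  obtain ⟨l, w⟩ := x
  obtain rfl : l = 0 := hx
  rw [barResD_single, one_smul, barBoundary]

lemma barResD_mem_supported {m : ℕ} {v : (Σ m, Fin m → G) →₀ MonoidAlgebra (ZMod 2) G}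
    (hv : v ∈ supported (MonoidAlgebra (ZMod 2) G) (MonoidAlgebra (ZMod 2) G)
      (barBasis G (m + 1))) :
    barResD G v ∈ supported (MonoidAlgebra (ZMod 2) G) (MonoidAlgebra (ZMod 2) G)
      (barBasis G m) :=
  Finsupp.map_mem_of_supported (fun _ => barResD_single_mem_supported) hv

lemma barResD_barResD_single (m : ℕ) :
    ∀ x ∈ barBasis G m, barResD G (barResD G (single x 1)) = 0 := by
  induction m using Nat.strong_induction_on with
  | _ m ih =>
    rintro ⟨l, w⟩ hx
    obtain rfl : l = m := hx
    match l, w, ih with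
    | 0, w, _ => rw [barResD_single_zero rfl, map_zero]
    | 1, w, _ =>
      exact Finsupp.map_eq_map_of_supported (L' := 0) (fun x => barResD_single_zero)
        (barResD_single_mem_supported rfl)
    | k + 2, w, ih =>
      let u : (Σ m, Fin m → G) →₀ MonoidAlgebra (ZMod 2) G :=
        single ⟨k + 1, fun i => w i.succ⟩ (MonoidAlgebra.of (ZMod 2) G (w 0))
      have hu : u ∈ supported (MonoidAlgebra (ZMod 2) G) (MonoidAlgebra (ZMod 2) G)
          (barBasis G (k + 1)) := single_mem_supported _ _ rfl
      have huw : single ⟨k + 2, w⟩ 1 = barCone G u := by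
        rw [barCone_single_of, barCons]
        congr
        exact (Fin.cons_self_tail w).symm
      have hD : barResD G (barCone G u) = u + barCone G (barResD G u) := by
        rw [← ZModModule.sub_eq_add, eq_sub_iff_add_eq]
        exact barResD_barCone hu
      have hDu := barResD_mem_supported hu
      rw [huw, hD, map_add]
      suffices h : barResD G (barCone G (barResD G u)) = barResD G u by
        rw [h, ZModModule.add_self]
      cases k with
      | zero =>
        rw [barResD_barCone_zero hDu,
          augSum_map _ 0 (fun x hx => augSum_barResD_single hx) hu, zero_mul, zero_smul, add_zero]
      | succ k =>
        have h := barResD_barCone hDu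
        have h' : barResD G (barResD G u) = 0 :=
          Finsupp.map_eq_map_of_supported (L := barResD G ∘ₗ barResD G) (L' := 0)
            (ih (k + 2) (by omega)) hu
        rwa [h', map_zero, add_zero] at h

theorem isFreeResolution_bar :
    IsFreeResolution (groupAug G) (barBasis G) (barResD G) where
  disjoint h h' := h.symm.trans h'
  nonempty := ⟨⟨0, Fin.elim0⟩, rfl⟩
  boundary_zero := barResD_single_zero
  boundary_succ := barResD_single_mem_supported
  aug := augSum_barResD_single
  boundary_boundary v := by
    have : barResD G ∘ₗ barResD G = 0 := by
      refine Finsupp.lhom_ext fun x r => ?_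
      rw [← mul_one r, ← smul_eq_mul, ← smul_single, map_smul, LinearMap.comp_apply,
        barResD_barResD_single x.1 x rfl, smul_zero, LinearMap.zero_apply]
    exact LinearMap.congr_fun this v
  exact_zero {v} hv h := ⟨barCone G v, barCone_mem_supported hv, by
    rw [barResD_barCone_zero hv, show augSum (groupAug G) v = 0 from h, zero_smul, add_zero]⟩
  exact_succ {k v} hv h := ⟨barCone G v, barCone_mem_supported hv, by
    have := barResD_barCone hv
    rwa [h, map_zero, add_zero] at this⟩

end BarResolution

section BarHomology

open Finsupp

section Inclusion

variable {G : Type}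

variable (G) in
/-- The inclusion of the chains of degree `m` in the total bar complex. -/
noncomputable def barIncl (m : ℕ) : ((Fin m → G) →₀ ZMod 2) →ₗ[ZMod 2]
    ((Σ m, Fin m → G) →₀ ZMod 2) :=
  lmapDomain (ZMod 2) (ZMod 2) fun w => ⟨m, w⟩

variable (G) in
lemma barIncl_injective (m : ℕ) : Function.Injective
    (barIncl G m) :=
  mapDomain_injective fun _ _ h => eq_of_heq (Sigma.mk.inj h).2

lemma exists_barIncl {m : ℕ} {v : (Σ m, Fin m → G) →₀ ZMod 2}
    (hv : v ∈ supported (ZMod 2) (ZMod 2) (barBasis G m)) :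
    ∃ u, barIncl G m u = v := by
  have h : barBasis G m = (fun w => ⟨m, w⟩) '' Set.univ := by
    ext ⟨l, w⟩
    constructor
    · rintro rfl
      exact ⟨w, trivial, rfl⟩
    · rintro ⟨w, -, h⟩
      exact (congrArg Sigma.fst h).symm
  rw [h, ← Finsupp.lmapDomain_supported] at hv
  obtain ⟨u, -, hu⟩ := hv
  exact ⟨u, hu⟩

lemma barIncl_mem {m : ℕ} (u : (Fin m → G) →₀ ZMod 2) :
    barIncl G m u ∈ supported (ZMod 2) (ZMod 2) (barBasis G m) := by
  induction u using Finsupp.induction_linear with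
  | zero => simp
  | add u v hu hv => rw [map_add]; exact add_mem hu hv
  | single w c =>
    rw [barIncl, lmapDomain_apply, mapDomain_single]
    exact single_mem_supported _ _ rfl

end Inclusion

variable {G : Type} [Group G]

lemma reduceMap_barResD_zero (v : (Fin 0 → G) →₀ ZMod 2) :
    reduceMap (groupAug G) (barResD G) (barIncl G 0 v) = 0 := by
  have : reduceMap (groupAug G) (barResD G) ∘ₗ barIncl G 0 = 0 := by
    refine Finsupp.lhom_ext' fun w => LinearMap.ext_ring ?_
    simp only [LinearMap.comp_apply, lsingle_apply, lmapDomain_apply, mapDomain_single,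
      reduceMap_single, barIncl, LinearMap.zero_apply]
    rw [barResD_single_zero (x := ⟨0, w⟩) rfl, mapRange_zero]
  exact LinearMap.congr_fun this v

lemma reduceMap_barResD_succ {m : ℕ} (v : (Fin (m + 1) → G) →₀ ZMod 2) :
    reduceMap (groupAug G) (barResD G) (barIncl G (m + 1) v) =
      barIncl G m (barD G m v) := by
  have : reduceMap (groupAug G) (barResD G) ∘ₗ barIncl G (m + 1) =
      barIncl G m ∘ₗ barD G m := by
    refine Finsupp.lhom_ext' fun w => LinearMap.ext_ring ?_
    simp only [LinearMap.comp_apply, lsingle_apply, lmapDomain_apply, mapDomain_single,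
      reduceMap_single, barIncl, barResD_single, one_smul, barBoundary, barD, lift_apply,
      sum_single_index, zero_smul, mapDomain_add, mapDomain_finsetSum]
    rw [Finsupp.mapRange_add (map_add _), Finsupp.mapRange_add (map_add _),
      Finsupp.mapRange_finsetSum]
    simp only [mapRange_single, groupAug_of, map_one]
  exact LinearMap.congr_fun this v

lemma mem_barCycles_iff {m : ℕ} (u : (Fin m → G) →₀ ZMod 2) :
    u ∈ barCycles G m ↔ barIncl G m u ∈
      gradedCycles (barBasis G) (reduceMap (groupAug G) (barResD G)) m := by
  rw [gradedCycles, Submodule.mem_inf, LinearMap.mem_ker, and_iff_right (barIncl_mem u)]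
  cases m with
  | zero => simp [barCycles, reduceMap_barResD_zero]
  | succ m =>
    rw [reduceMap_barResD_succ, map_eq_zero_iff _ (barIncl_injective G m)]
    rfl

variable (G) in
/-- The comparison of the cycles of the bar complex with those of the bar resolution. -/
noncomputable def barCyclesMap (m : ℕ) : barCycles G m →ₗ[ZMod 2]
    gradedCycles (barBasis G) (reduceMap (groupAug G) (barResD G)) m :=
  (barIncl G m).restrict fun _ => (mem_barCycles_iff _).1

variable (G) in
theorem nonempty_barHomology_equiv (m : ℕ) : Nonempty (barHomology G m ≃ₗ[ZMod 2]
    GradedHomology (barBasis G) (reduceMap (groupAug G) (barResD G)) m) := by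
  have hsurj : Function.Surjective (barCyclesMap G m) := by
    rintro ⟨v, hv⟩
    obtain ⟨u, rfl⟩ := exists_barIncl hv.1
    exact ⟨⟨u, (mem_barCycles_iff u).2 hv⟩, rfl⟩
  let e := LinearEquiv.ofBijective (barCyclesMap G m) ⟨fun u v h => Subtype.ext <|
    barIncl_injective G m (congrArg Subtype.val h), hsurj⟩
  refine ⟨Submodule.Quotient.equiv _ _ e ?_⟩
  ext ⟨v, hv⟩
  constructor
  · rintro ⟨⟨u, hu⟩, ⟨y, hy⟩, h⟩
    refine ⟨barIncl G (m + 1) y, barIncl_mem y, ?_⟩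
    rw [reduceMap_barResD_succ, hy]
    exact congrArg Subtype.val h
  · rintro ⟨y, hy, h⟩
    obtain ⟨y, rfl⟩ := exists_barIncl hy
    rw [reduceMap_barResD_succ] at h
    have hc : barD G m y ∈ barCycles G m := by
      rw [mem_barCycles_iff, h]
      exact hv
    exact ⟨⟨barD G m y, hc⟩, ⟨y, rfl⟩, Subtype.ext h⟩

end BarHomology

section BraidResolution

open Finsupp IsFreeResolution

lemma GradedHomology.nonempty_equiv_of_eqOn {X : Type*} {A : ℕ → Set X}
    {d d' : (X →₀ ZMod 2) →ₗ[ZMod 2] (X →₀ ZMod 2)} {m : ℕ}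
    (h : ∀ k, ∀ v ∈ supported (ZMod 2) (ZMod 2) (A k), d v = d' v) :
    Nonempty (GradedHomology A d m ≃ₗ[ZMod 2] GradedHomology A d' m) := by
  have hc : gradedCycles A d m = gradedCycles A d' m := by
    ext v
    simp only [gradedCycles, Submodule.mem_inf, LinearMap.mem_ker]
    exact and_congr_right fun hv => by rw [h m v hv]
  refine ⟨Submodule.Quotient.equiv _ _ (LinearEquiv.ofEq _ _ hc) ?_⟩
  ext ⟨v, hv⟩
  constructor
  · rintro ⟨⟨u, hu⟩, ⟨y, hy, h₁⟩, h₂⟩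
    exact ⟨y, hy, ((h _ y hy).symm.trans h₁).trans (congrArg Subtype.val h₂)⟩
  · rintro ⟨y, hy, h₁⟩
    exact ⟨⟨v, hc ▸ hv⟩, ⟨y, hy, (h _ y hy).trans h₁⟩, rfl⟩

variable {G : Type} [Group G] {n : ℕ} {s : ℕ → G}

lemma mapRange_blockBoundary_groupGen {w : List ℕ} (hw : w.sum + w.length = n) :
    (blockBoundary (groupGen n s) 0 w).mapRange (groupAug G) (map_zero _) = binBoundary w := by
  rw [mapRange_blockBoundary]
  refine blockBoundary_eq_binBoundary 0 w fun i _ hi => ?_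
  rw [groupGen, if_pos (by omega), groupAug_of]

lemma reduceMap_blockD {m : ℕ} {v : List ℕ →₀ ZMod 2}
    (hv : v ∈ supported (ZMod 2) (ZMod 2) (blockSet n m)) :
    reduceMap (groupAug G) (blockD (groupGen n s) 0) v = binD v := by
  refine Finsupp.map_eq_map_of_supported (fun w hw => ?_) hv
  rw [reduceMap_single, blockD_single, binD_single, one_smul, one_smul,
    mapRange_blockBoundary_groupGen hw.2]

lemma blockBoundary_mem_supported {R : Type*} [Ring R] (f : ℕ → R) (j : ℕ) {m : ℕ} {w : List ℕ}
    (hw : w ∈ blockSet n (m + 1)) : blockBoundary f j w ∈ supported R R (blockSet n m) := by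
  intro w' hw'
  obtain ⟨h₁, h₂⟩ := blockBoundary_support f j w w' (mem_support_iff.1 hw')
  obtain ⟨h₃, h₄⟩ := hw
  exact ⟨by omega, by omega⟩

lemma List.eq_replicate_of_mem_blockSet_zero {w : List ℕ} (hw : w ∈ blockSet n 0) :
    w = List.replicate n 0 := by
  obtain ⟨h₁, h₂⟩ := hw
  have := List.eq_replicate_of_sum_eq_zero h₁
  rwa [show w.length = n by omega] at this

lemma binBoundary_eq_zero_of_sum_eq_one {w : List ℕ} (hw : w.sum = 1) : binBoundary w = 0 := by
  refine IsSortedTwoPow.binBoundary_eq_zero fun a ha => ?_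
  have : a ≤ 1 := hw ▸ List.single_le_sum (by simp) a ha
  obtain rfl | rfl : a = 0 ∨ a = 1 := by omega
  · exact isTwoPow_of_eq (k := 0) rfl
  · exact isTwoPow_of_eq (k := 1) rfl

theorem IsBraidGenerators.isFreeResolution (hs : IsBraidGenerators n s) :
    IsFreeResolution (groupAug G) (blockSet n) (blockD (groupGen n s) 0) where
  disjoint h h' := h.1.symm.trans h'.1
  nonempty := ⟨List.replicate n 0, by simp [blockSet]⟩
  boundary_zero {w} hw := by
    rw [blockD_single, one_smul]
    ext1 w'
    by_contra h
    have := (blockBoundary_support _ _ w w' h).1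
    have := hw.1
    omega
  boundary_succ {k w} hw := by
    rw [blockD_single, one_smul]
    exact blockBoundary_mem_supported _ _ hw
  aug {w} hw := by
    rw [blockD_single, one_smul]
    have h := mapRange_blockBoundary_groupGen (G := G) (s := s) hw.2
    rw [binBoundary_eq_zero_of_sum_eq_one hw.1] at h
    exact Finset.sum_eq_zero fun w' _ => DFunLike.congr_fun h w'
  boundary_boundary := hs.isBraidFamily_groupGen.blockD_blockD 0
  exact_zero {v} hv h := by
    have hv' : v = single (List.replicate n 0) (v (List.replicate n 0)) := by
      rw [← Finsupp.support_subset_singleton]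
      intro w hw
      exact Finset.mem_singleton.2 (List.eq_replicate_of_mem_blockSet_zero (hv hw))
    obtain ⟨y, hy, hyv⟩ := hs.exists_blockD_eq_single (v (List.replicate n 0))
    refine ⟨y, fun w hw => hy w (mem_support_iff.1 hw), ?_⟩
    have h' : MonoidAlgebra.lift (ZMod 2) (ZMod 2) G 1 (v (List.replicate n 0)) = 0 := by
      rw [hv'] at h
      exact (augSum_single _ _).symm.trans h
    rw [hyv, h', map_zero, add_zero, ← hv']
  exact_succ {k v} hv h := by
    obtain ⟨y, hy, hyv⟩ := hs.exists_blockD_eq (k := k + 1) (by omega)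
      (fun w hw => hv (mem_support_iff.2 hw)) h
    exact ⟨y, fun w hw => hy w (mem_support_iff.1 hw), hyv⟩

end BraidResolution

theorem fuks_mod_two_homology_of_braid_groups (n m : ℕ) (hn : 1 ≤ n) :
    Nonempty (barHomology (BraidGroup n) m ≃ₗ[ZMod 2]
      ({f : ℕ →₀ ℕ // f.sum (fun i h => h * 2 ^ i) = n ∧
          f.sum (fun i h => h * (2 ^ i - 1)) = m} →₀ ZMod 2)) := by
  obtain ⟨e₁⟩ := nonempty_barHomology_equiv (BraidGroup n) m
  obtain ⟨e₂⟩ := isFreeResolution_bar.nonempty_gradedHomology_equiv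
    (BraidGroup.isBraidGenerators_gen n).isFreeResolution m
  obtain ⟨e₃⟩ := GradedHomology.nonempty_equiv_of_eqOn (A := blockSet n) (m := m)
    fun k v => reduceMap_blockD (G := BraidGroup n) (s := BraidGroup.gen n)
  obtain ⟨e₄⟩ := exists_nonempty_linearEquiv_gradedHomology n m
  exact ⟨e₁ ≪≫ₗ e₂ ≪≫ₗ e₃ ≪≫ₗ e₄ ≪≫ₗ Finsupp.domLCongr (blockSetSortedEquiv n m)⟩
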